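/- (Parametric holonomic approximation with embedded integral lifts; Theorem B.4 of del Pino–Toussaint, stated over the n-torus with k-torus parameter space.) Fix integers n ≥ 1, ℓ ≥ 1, r ≥ 1, k ≥ 1 with (r,ℓ) ≠ (1,1), and fix ε > 0. Let σ_i : ℝ^k × ℝⁿ → Sym^i(ℝⁿ,ℝ^ℓ), 0 ≤ i ≤ r, be jointly continuous, ℤ^k-periodic in the first variable and ℤⁿ-periodic in the second. Then there exist jointly smooth maps X : ℝ^k × ℝⁿ → ℝⁿ and ζ_i : ℝ^k × ℝⁿ → Sym^i(ℝⁿ,ℝ^ℓ), ℤ^k-periodic in the parameter, such that for every parameter κ ∈ ℝ^k: (a) the tuple (X(κ,·), ζ_i(κ,·)) is a ℤⁿ-equivariant integral r-jet tuple; (b) the set {p : fderiv ℝ (X(κ,·)) p is a linear isomorphism} is dense in ℝⁿ; (c) the full lift L_κ : p ↦ (X(κ,p), ζ_0(κ,p),…,ζ_r(κ,p)) is an injective immersion modulo ℤⁿ, i.e. its differential in p is injective at every point, and L_κ(p) = L_κ(q) + (m,0,…,0) with m ∈ ℤⁿ implies p = q + m; (d) if moreover ℓ ≥ 2 or r is even,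 the front p ↦ (X(κ,p), ζ_0(κ,p)) is injective modulo ℤⁿ; (e) ‖X(κ,p) − p‖ < ε and ‖ζ_i(κ,p) − σ_i(κ,p)‖ < ε for all κ, p and 0 ≤ i ≤ r. -/

import Mathlib

/- `ℝⁿ` in standard coordinates. -/
noncomputable section

abbrev Vec (n : ℕ) := Fin n → ℝ

/-- The ambient space of `Sym^i(ℝⁿ, ℝ^ℓ)`: continuous `i`-multilinear maps `(ℝⁿ)^i → ℝ^ℓ`. -/
abbrev SymMap (n ℓ i : ℕ) := ContinuousMultilinearMap ℝ (fun _ : Fin i => Vec n) (Vec ℓ)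

/-- A multilinear map is symmetric if it is invariant under permutations of its arguments. -/
def IsSymmMap {n ℓ i : ℕ} (A : SymMap n ℓ i) : Prop :=
  ∀ (e : Equiv.Perm (Fin i)) (v : Fin i → Vec n), A (v ∘ e) = A v

/-- The inclusion `ℤⁿ → ℝⁿ`. -/
def zcast {n : ℕ} (m : Fin n → ℤ) : Vec n := fun j => (m j : ℝ)

section Jets
open Filter Topology
variable {P E F : Type} [NormedAddCommGroup P] [NormedSpace ℝ P]
  [NormedAddCommGroup E] [NormedSpace ℝ E] [NormedAddCommGroup F] [NormedSpace ℝ F]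

local notation "C∞" => ((⊤ : ℕ∞) : WithTop ℕ∞)

theorem two_le_smooth : (2 : WithTop ℕ∞) ≤ C∞ := by
  have : ((2 : ℕ∞) : WithTop ℕ∞) ≤ C∞ := WithTop.coe_le_coe.2 le_top
  exact this

theorem smooth_parjet (i : ℕ) {f : P → E → F} (hf : ContDiff ℝ C∞ (Function.uncurry f)) :
    ContDiff ℝ C∞ (fun z : P × E => iteratedFDeriv ℝ i (f z.1) z.2) := by
  induction i with
  | zero =>
    rw [show (fun z : P × E => iteratedFDeriv ℝ 0 (f z.1) z.2) =
      (continuousMultilinearCurryFin0 ℝ E F).symm ∘ Function.uncurry f from rfl]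
    exact (LinearIsometryEquiv.contDiff _).comp hf
  | succ i ih =>
    let I : (E →L[ℝ] (E [×i]→L[ℝ] F)) →L[ℝ] (E [×(i+1)]→L[ℝ] F) :=
      ((continuousMultilinearCurryLeftEquiv ℝ (fun _ : Fin (i + 1) => E) F).symm).toContinuousLinearEquiv
    rw [show (fun z : P × E => iteratedFDeriv ℝ (i+1) (f z.1) z.2) =
      I ∘ (fun z : P × E => fderiv ℝ (iteratedFDeriv ℝ i (f z.1)) z.2) from rfl]
    have hI : ContDiff ℝ C∞ (fun A : E →L[ℝ] (E [×i]→L[ℝ] F) => I A) :=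
      ContinuousLinearMap.contDiff (𝕜 := ℝ) (E := E →L[ℝ] (E [×i]→L[ℝ] F))
        (F := E [×(i+1)]→L[ℝ] F) I
    refine hI.comp ?_
    refine ContDiff.fderiv (m := C∞) (f := fun z : P × E => iteratedFDeriv ℝ i (f z.1)) ?_
      contDiff_snd (by simp)
    exact ih.comp ((contDiff_fst.comp contDiff_fst).prodMk contDiff_snd)

theorem smooth_jet (i : ℕ) {f : E → F} (hf : ContDiff ℝ C∞ f) :
    ContDiff ℝ C∞ (iteratedFDeriv ℝ i f) :=
  hf.iteratedFDeriv_right (i := i) (by exact_mod_cast le_top)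

theorem smooth_diff {f : E → F} (hf : ContDiff ℝ C∞ f) : Differentiable ℝ f :=
  hf.differentiable (by simp)

theorem jet_symm (i : ℕ) {f : E → F} (hf : ContDiff ℝ C∞ f) :
    ∀ (e : Equiv.Perm (Fin i)) (x : E) (v : Fin i → E),
      iteratedFDeriv ℝ i f x (v ∘ e) = iteratedFDeriv ℝ i f x v := by
  induction i with
  | zero => intro e x v; congr 1; ext j; exact j.elim0
  | succ m ih =>
    intro e
    have he : e ∈ Submonoid.closure (Set.range fun i : Fin m ↦ Equiv.swap i.castSucc i.succ) := by
      rw [Equiv.Perm.mclosure_swap_castSucc_succ]; trivial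
    induction he using Submonoid.closure_induction with
    | one => intro x v; rfl
    | mul a b _ _ ha hb =>
      intro x v
      have := hb x (v ∘ a)
      rw [ha] at this
      exact this
    | mem e he =>
      obtain ⟨j, rfl⟩ := he
      intro x v
      have hdiff : ∀ m, Differentiable ℝ (iteratedFDeriv ℝ m f) := fun m =>
        smooth_diff (smooth_jet m hf)
      rw [iteratedFDeriv_succ_apply_left, iteratedFDeriv_succ_apply_left]
      cases m with
      | zero => exact j.elim0
      | succ m =>
      refine Fin.cases ?_ (fun j => ?_) j
      · rw [← fderiv_continuousMultilinear_apply_const_apply (hdiff _ x),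
          ← fderiv_continuousMultilinear_apply_const_apply (hdiff _ x)]
        have key : ∀ (a : E) (w : Fin (m+1) → E),
            fderiv ℝ (fun y => iteratedFDeriv ℝ (m+1) f y w) x a =
            fderiv ℝ (fderiv ℝ (iteratedFDeriv ℝ m f)) x a (w 0) (Fin.tail w) := by
          intro a w
          have h2 : Differentiable ℝ (fderiv ℝ (iteratedFDeriv ℝ m f)) :=
            smooth_diff ((smooth_jet m hf).fderiv_right (m := C∞) (by simp))
          simp only [iteratedFDeriv_succ_apply_left]
          rw [fderiv_continuousMultilinear_apply_const_apply (𝕜 := ℝ)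
            (c := fun y => fderiv ℝ (iteratedFDeriv ℝ m f) y (w 0))
            ((h2 x).clm_apply (differentiableAt_const _))]
          rw [fderiv_clm_apply (h2 x) (differentiableAt_const _)]
          simp
        rw [key, key]
        have hs : IsSymmSndFDerivAt ℝ (iteratedFDeriv ℝ m f) x :=
          (smooth_jet m hf).contDiffAt.isSymmSndFDerivAt (by simpa using two_le_smooth)
        have t1 : (v ∘ Equiv.swap (Fin.castSucc (0 : Fin (m+1))) (Fin.succ 0)) 0 = v 1 := by
          simp
        have t2 : Fin.tail (v ∘ Equiv.swap (Fin.castSucc (0 : Fin (m+1))) (Fin.succ 0)) 0 = v 0 := by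
          simp [Fin.tail]
        have t3 : Fin.tail (Fin.tail (v ∘ Equiv.swap (Fin.castSucc (0 : Fin (m+1))) (Fin.succ 0)))
            = Fin.tail (Fin.tail v) := by
          ext1 l
          simp only [Fin.tail, Function.comp]
          rw [Equiv.swap_apply_of_ne_of_ne]
          · simp [Fin.ext_iff]
          · simp [Fin.ext_iff]
        rw [t1, t2, t3]
        rw [hs (v 1) (v 0)]
        rfl
      · have t0 : (v ∘ Equiv.swap (Fin.castSucc j.succ) (Fin.succ j.succ)) 0 = v 0 := by
          simp only [Function.comp]
          rw [Equiv.swap_apply_of_ne_of_ne]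
          · simp [Fin.ext_iff]
          · simp [Fin.ext_iff]
        have t1 : Fin.tail (v ∘ Equiv.swap (Fin.castSucc j.succ) (Fin.succ j.succ))
            = Fin.tail v ∘ Equiv.swap (Fin.castSucc j) (Fin.succ j) := by
          ext1 l
          simp only [Fin.tail, Function.comp]
          congr 1
          have := (Equiv.swap_apply_def (Fin.castSucc j.succ) (Fin.succ j.succ) l.succ)
          rw [this, Equiv.swap_apply_def, ← Fin.succ_castSucc]
          simp only [Fin.succ_inj]
          split_ifs <;> rfl
        rw [t0, t1, ← fderiv_continuousMultilinear_apply_const_apply (hdiff _ x),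
          ← fderiv_continuousMultilinear_apply_const_apply (hdiff _ x)]
        simp only [ih]

theorem mixed_partial {f : P → E → F} (hf : ContDiff ℝ C∞ (Function.uncurry f))
    (p v : P) (x : E) :
    fderiv ℝ (fun q => fderiv ℝ (f q) x) p v
      = fderiv ℝ (fun x => fderiv ℝ (fun q => f q x) p v) x := by
  have hd := smooth_diff hf
  have h2 : Differentiable ℝ (fderiv ℝ (Function.uncurry f)) :=
    smooth_diff (hf.fderiv_right (m := C∞) (by simp))
  have e1 : ∀ q x, fderiv ℝ (f q) x
      = (fderiv ℝ (Function.uncurry f) (q, x)).comp (ContinuousLinearMap.inr ℝ P E) := by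
    intro q x
    exact ((hd (q, x)).hasFDerivAt.comp x (hasFDerivAt_prodMk_right q x)).fderiv
  have e2 : ∀ q x, fderiv ℝ (fun q => f q x) q
      = (fderiv ℝ (Function.uncurry f) (q, x)).comp (ContinuousLinearMap.inl ℝ P E) := by
    intro q x
    exact ((hd (q, x)).hasFDerivAt.comp (f := fun q => (q, x)) q (hasFDerivAt_prodMk_left q x)).fderiv
  have hs : IsSymmSndFDerivAt ℝ (Function.uncurry f) (p, x) :=
          hf.contDiffAt.isSymmSndFDerivAt (by simpa using two_le_smooth)
  ext w
  simp only [e1, e2]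
  have l1 : HasFDerivAt (fun q => (fderiv ℝ (Function.uncurry f) (q, x)).comp (ContinuousLinearMap.inr ℝ P E))
      (((ContinuousLinearMap.compL ℝ E (P × E) F).flip (ContinuousLinearMap.inr ℝ P E)).comp
       ((fderiv ℝ (fderiv ℝ (Function.uncurry f)) (p, x)).comp (ContinuousLinearMap.inl ℝ P E))) p :=
    (((ContinuousLinearMap.compL ℝ E (P × E) F).flip (ContinuousLinearMap.inr ℝ P E)).hasFDerivAt).comp p
      ((h2 (p, x)).hasFDerivAt.comp p (hasFDerivAt_prodMk_left p x))
  have l2 : HasFDerivAt (fun x => (fderiv ℝ (Function.uncurry f) (p, x)) (v, 0))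
      ((ContinuousLinearMap.apply ℝ F ((v, 0) : P × E)).comp
       ((fderiv ℝ (fderiv ℝ (Function.uncurry f)) (p, x)).comp (ContinuousLinearMap.inr ℝ P E))) x :=
    ((ContinuousLinearMap.apply ℝ F ((v, 0) : P × E)).hasFDerivAt).comp x
      ((h2 (p, x)).hasFDerivAt.comp x (hasFDerivAt_prodMk_right p x))
  rw [l1.fderiv]
  simp only [ContinuousLinearMap.comp_apply, ContinuousLinearMap.inl_apply]
  rw [l2.fderiv]
  simpa using hs (v, 0) (0, w)

theorem fderiv_param_jet (i : ℕ) {f : P → E → F} (hf : ContDiff ℝ C∞ (Function.uncurry f))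
    (p v : P) : ∀ x : E,
    fderiv ℝ (fun q => iteratedFDeriv ℝ i (f q) x) p v
      = iteratedFDeriv ℝ i (fun x => fderiv ℝ (fun q => f q x) p v) x := by
  induction i with
  | zero =>
    intro x
    have h : DifferentiableAt ℝ (fun q => f q x) p :=
      (smooth_diff hf (p, x)).comp (f := fun q => (q, x)) p (by fun_prop)
    rw [show (fun q => iteratedFDeriv ℝ 0 (f q) x) =
      (continuousMultilinearCurryFin0 ℝ E F).symm ∘ (fun q => f q x) from rfl]
    rw [LinearIsometryEquiv.comp_fderiv]
    rfl
  | succ i ih =>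
    intro x
    let I : (E →L[ℝ] (E [×i]→L[ℝ] F)) →L[ℝ] (E [×(i+1)]→L[ℝ] F) :=
      ((continuousMultilinearCurryLeftEquiv ℝ (fun _ : Fin (i + 1) => E) F).symm).toContinuousLinearEquiv
    rw [show (fun q => iteratedFDeriv ℝ (i+1) (f q) x) =
      I ∘ (fun q => fderiv ℝ (iteratedFDeriv ℝ i (f q)) x) from rfl]
    have hB : Differentiable ℝ (fun q => fderiv ℝ (iteratedFDeriv ℝ i (f q)) x) := by
      refine smooth_diff (ContDiff.fderiv (m := C∞) (f := fun q => iteratedFDeriv ℝ i (f q)) ?_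
        contDiff_const (by simp))
      exact smooth_parjet i hf
    rw [(I.hasFDerivAt.comp p (hB p).hasFDerivAt).fderiv, ContinuousLinearMap.comp_apply]
    rw [mixed_partial (f := fun q => iteratedFDeriv ℝ i (f q)) (smooth_parjet i hf)]
    rw [iteratedFDeriv_succ_eq_comp_left]
    simp only [Function.comp]
    have : (fun x => fderiv ℝ (fun q => iteratedFDeriv ℝ i (f q) x) p v) =
        iteratedFDeriv ℝ i (fun x => fderiv ℝ (fun q => f q x) p v) := funext ih
    rw [this]; rfl

theorem fderiv_jet_along (i : ℕ) {f : P → E → F} (hf : ContDiff ℝ C∞ (Function.uncurry f))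
    {X : P → E} (hX : ContDiff ℝ C∞ X) (p v : P) (w : Fin i → E) :
    fderiv ℝ (fun q => iteratedFDeriv ℝ i (f q) (X q)) p v w
      = iteratedFDeriv ℝ i (fun x => fderiv ℝ (fun q => f q x) p v) (X p) w
       + iteratedFDeriv ℝ (i+1) (f p) (X p) (Fin.cons (fderiv ℝ X p v) w) := by
  have hd := smooth_diff (smooth_parjet i hf)
  have e1 : fderiv ℝ (iteratedFDeriv ℝ i (f p)) (X p)
      = (fderiv ℝ (fun z : P × E => iteratedFDeriv ℝ i (f z.1) z.2) (p, X p)).comp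
        (ContinuousLinearMap.inr ℝ P E) :=
    ((hd (p, X p)).hasFDerivAt.comp (X p) (hasFDerivAt_prodMk_right p (X p))).fderiv
  have e2 : fderiv ℝ (fun q => iteratedFDeriv ℝ i (f q) (X p)) p
      = (fderiv ℝ (fun z : P × E => iteratedFDeriv ℝ i (f z.1) z.2) (p, X p)).comp
        (ContinuousLinearMap.inl ℝ P E) :=
    ((hd (p, X p)).hasFDerivAt.comp (f := fun q => (q, X p)) p (hasFDerivAt_prodMk_left p (X p))).fderiv
  have e3 : fderiv ℝ (fun q => iteratedFDeriv ℝ i (f q) (X q)) p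
      = (fderiv ℝ (fun z : P × E => iteratedFDeriv ℝ i (f z.1) z.2) (p, X p)).comp
        ((ContinuousLinearMap.id ℝ P).prod (fderiv ℝ X p)) :=
    ((hd (p, X p)).hasFDerivAt.comp (f := fun q => (q, X q)) p ((hasFDerivAt_id p).prodMk (smooth_diff hX p).hasFDerivAt)).fderiv
  rw [iteratedFDeriv_succ_apply_left, e1, ← fderiv_param_jet i hf p v, e2, e3]
  simp only [ContinuousLinearMap.comp_apply, Fin.cons_zero, Fin.tail_cons,
    ContinuousLinearMap.inl_apply, ContinuousLinearMap.inr_apply, ContinuousLinearMap.prod_apply]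
  rw [← add_apply, ← map_add]
  simp

/-- order of vanishing of `u^r • g` -/
theorem jet_pow_smul (r : ℕ) : ∀ {F : Type} [NormedAddCommGroup F] [NormedSpace ℝ F]
    {u : E → ℝ} {g : E → F} (_ : ContDiff ℝ C∞ u) (_ : ContDiff ℝ C∞ g) (x : E) (_ : u x = 0),
    (∀ i < r, iteratedFDeriv ℝ i (fun x => u x ^ r • g x) x = 0) ∧
    ∀ m : Fin r → E, iteratedFDeriv ℝ r (fun x => u x ^ r • g x) x m
      = ((r.factorial : ℝ) * ∏ j, fderiv ℝ u x (m j)) • g x := by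
  induction r with
  | zero =>
    intro F _ _ u g hu hg x hx
    simp
  | succ r ih =>
    intro F _ _ u g hu hg x hx
    have hud := smooth_diff hu
    have hgd := smooth_diff hg
    set g' : E → (E →L[ℝ] F) := fun x => ((r:ℝ)+1) • (fderiv ℝ u x).smulRight (g x) + u x • fderiv ℝ g x
      with hg'
    have hdu : ContDiff ℝ C∞ (fderiv ℝ u) := hu.fderiv_right (m := C∞) (by simp)
    have hdg : ContDiff ℝ C∞ (fderiv ℝ g) := hg.fderiv_right (m := C∞) (by simp)
    have hg's : ContDiff ℝ C∞ g' := by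
      refine ContDiff.add ?_ (hu.smul hdg)
      exact ContDiff.const_smul ((r:ℝ)+1) (hdu.smulRight hg)
    have hder : (fun x => fderiv ℝ (fun x => u x ^ (r+1) • g x) x) = fun x => u x ^ r • g' x := by
      funext y
      have h1 := ((hud y).hasFDerivAt.pow (r+1)).smul (hgd y).hasFDerivAt
      have h2 : fderiv ℝ (fun x => u x ^ (r+1) • g x) y = _ := h1.fderiv
      rw [h2, hg']
      ext w
      simp [pow_succ, smul_smul, smul_add]
      rw [add_comm]
      congr 2
      ring
    obtain ⟨I1, I2⟩ := ih hu hg's x hx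
    constructor
    · intro i hi
      cases i with
      | zero => ext m; simp [hx]
      | succ i =>
        ext1 m
        rw [iteratedFDeriv_succ_apply_right, hder, I1 i (by omega)]
        simp
    · intro m
      rw [iteratedFDeriv_succ_apply_right, hder, I2]
      simp only [hg', hx, zero_smul, add_zero, Fin.prod_univ_castSucc, Nat.factorial_succ, Fin.init]
      simp [smul_smul]
      congr 1
      ring
end Jets

section Close
open Filter Topology
variable {Q E F : Type} [NormedAddCommGroup Q] [NormedSpace ℝ Q]
  [NormedAddCommGroup E] [NormedSpace ℝ E] [NormedAddCommGroup F] [NormedSpace ℝ F]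

local notation "C∞" => ((⊤ : ℕ∞) : WithTop ℕ∞)

theorem nat_le_smooth (i : ℕ) : (i : WithTop ℕ∞) ≤ C∞ := by
  have : (((i : ℕ) : ℕ∞) : WithTop ℕ∞) ≤ C∞ := WithTop.coe_le_coe.2 le_top
  exact this

theorem comp_close (i : ℕ) (M : ℝ) (hM : 0 ≤ M) : ∃ Cc : ℝ, 0 ≤ Cc ∧
    ∀ (f : Q × E → F) (γ : E → Q) (x₀ : E) (ν : ℝ), ContDiff ℝ C∞ f → ContDiff ℝ C∞ γ → 0 ≤ ν → ν ≤ 1 →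
      (∀ b ≤ i, ‖iteratedFDeriv ℝ b f (γ x₀, x₀)‖ ≤ M) →
      (∀ b, 1 ≤ b → b ≤ i → ‖iteratedFDeriv ℝ b γ x₀‖ ≤ ν) →
      ‖iteratedFDeriv ℝ i (fun x => f (γ x, x)) x₀ - iteratedFDeriv ℝ i (fun x => f (γ x₀, x)) x₀‖
        ≤ Cc * ν := by
  refine ⟨∑ c : OrderedFinpartition i, M * c.length * 2 ^ (c.length - 1), by positivity, ?_⟩
  intro f γ x₀ ν hf hγ hν hν1 hfM hγν
  set g : E → Q × E := fun x => (γ x, x) with hg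
  set g0 : E → Q × E := fun x => (γ x₀, x) with hg0
  have hgs : ContDiff ℝ C∞ g := hγ.prodMk contDiff_id
  have hg0s : ContDiff ℝ C∞ g0 := contDiff_const.prodMk contDiff_id
  have hdiff : ∀ b, 1 ≤ b → b ≤ i → ‖iteratedFDeriv ℝ b g x₀ - iteratedFDeriv ℝ b g0 x₀‖ ≤ ν := by
    intro b hb hbi
    rw [← iteratedFDeriv_sub_apply (hgs.of_le (nat_le_smooth b)).contDiffAt (hg0s.of_le (nat_le_smooth b)).contDiffAt]
    have : g - g0 = fun x => (ContinuousLinearMap.inl ℝ Q E) ((fun x => γ x - γ x₀) x) := by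
      funext x; simp [g, g0]
    rw [this]
    have hs : ContDiff ℝ C∞ (fun x => γ x - γ x₀) := hγ.sub contDiff_const
    have h := ContinuousLinearMap.norm_iteratedFDeriv_comp_left (𝕜 := ℝ) (f := fun x => γ x - γ x₀)
      (ContinuousLinearMap.inl ℝ Q E) (hs.contDiffAt (x := x₀)) (nat_le_smooth b)
    refine h.trans ?_
    have h2 : iteratedFDeriv ℝ b (fun x => γ x - γ x₀) x₀ = iteratedFDeriv ℝ b γ x₀ := by
      have := iteratedFDeriv_sub_apply (f := γ) (g := fun _ => γ x₀) (x := x₀) (hγ.of_le (nat_le_smooth b)).contDiffAt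
        (contDiff_const (𝕜 := ℝ) (n := b)).contDiffAt
      rw [show (fun x => γ x - γ x₀) = γ - fun _ => γ x₀ from rfl, this,
        iteratedFDeriv_const_of_ne (by omega)]
      simp
    rw [h2]
    calc _ ≤ 1 * ν := mul_le_mul (ContinuousLinearMap.norm_inl_le_one ℝ Q E) (hγν b hb hbi) (norm_nonneg _) zero_le_one
      _ = ν := one_mul _
  have hg0b : ∀ b, 1 ≤ b → ‖iteratedFDeriv ℝ b g0 x₀‖ ≤ 1 := by
    intro b hb
    obtain ⟨b, rfl⟩ : ∃ b', b = b' + 1 := ⟨b - 1, by omega⟩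
    rw [← norm_iteratedFDeriv_fderiv]
    have : fderiv ℝ g0 = fun _ => ContinuousLinearMap.inr ℝ Q E := by
      funext x; exact (hasFDerivAt_prodMk_right (γ x₀) x).fderiv
    rw [this]
    cases b with
    | zero => simpa using ContinuousLinearMap.norm_inr_le_one ℝ Q E
    | succ b => rw [iteratedFDeriv_const_of_ne (by omega)]; simp
  have hgb : ∀ b, 1 ≤ b → b ≤ i → ‖iteratedFDeriv ℝ b g x₀‖ ≤ 2 := by
    intro b hb hbi
    have := norm_le_norm_add_norm_sub' (iteratedFDeriv ℝ b g x₀) (iteratedFDeriv ℝ b g0 x₀)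
    linarith [hdiff b hb hbi, hg0b b hb]
  have e1 := iteratedFDeriv_comp (g := f) (f := g) (x := x₀) (hf.contDiffAt) hgs.contDiffAt (nat_le_smooth i)
  have e2 := iteratedFDeriv_comp (g := f) (f := g0) (x := x₀) (hf.contDiffAt) hg0s.contDiffAt (nat_le_smooth i)
  rw [show (fun x => f (γ x, x)) = f ∘ g from rfl, show (fun x => f (γ x₀, x)) = f ∘ g0 from rfl, e1, e2]
  unfold FormalMultilinearSeries.taylorComp
  rw [← Finset.sum_sub_distrib, Finset.sum_mul]
  refine (norm_sum_le _ _).trans (Finset.sum_le_sum fun c _ => ?_)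
  unfold FormalMultilinearSeries.compAlongOrderedFinpartition
  have hg00 : g0 x₀ = g x₀ := rfl
  rw [hg00]
  refine (c.norm_compAlongOrderedFinpartition_sub_compAlongOrderedFinpartition_le _ _ _ _).trans ?_
  simp only [sub_self, norm_zero, zero_mul, add_zero]
  have hps : ∀ m, 1 ≤ c.partSize m ∧ c.partSize m ≤ i := fun m => ⟨c.partSize_pos m, c.partSize_le m⟩
  gcongr
  · exact hfM _ c.length_le
  · refine max_le ?_ ?_
    · refine (pi_norm_le_iff_of_nonneg (by norm_num)).2 fun m => hgb _ (hps m).1 (hps m).2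
    · refine (pi_norm_le_iff_of_nonneg (by norm_num)).2 fun m => (hg0b _ (hps m).1).trans (by norm_num)
  · refine (pi_norm_le_iff_of_nonneg hν).2 fun m => hdiff _ (hps m).1 (hps m).2
end Close

section Periodic
open Filter Topology Set
local notation "C∞" => ((⊤ : ℕ∞) : WithTop ℕ∞)

theorem exists_floor_vec {n : ℕ} (p : Vec n) : ∃ (p0 : Vec n) (m : Fin n → ℤ),
    p0 ∈ Icc (0 : Vec n) 1 ∧ p = p0 + zcast m := by
  refine ⟨fun j => Int.fract (p j), fun j => ⌊p j⌋, ⟨fun j => Int.fract_nonneg _, fun j => (Int.fract_lt_one _).le⟩, ?_⟩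
  funext j
  simp [zcast]

theorem periodic_bounded {k n : ℕ} {D W : Type} [TopologicalSpace D] [SeminormedAddCommGroup W]
    (K : Set D) (hK : IsCompact K) (f : (Vec k × Vec n) × D → W) (hf : Continuous f)
    (hper : ∀ mk m κ p d, f ((κ + zcast mk, p + zcast m), d) = f ((κ, p), d)) :
    ∃ M : ℝ, 0 ≤ M ∧ ∀ z, ∀ d ∈ K, ‖f (z, d)‖ ≤ M := by
  have hc : IsCompact ((Icc (0 : Vec k) 1 ×ˢ Icc (0 : Vec n) 1) ×ˢ K) :=
    (isCompact_Icc.prod isCompact_Icc).prod hK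
  obtain ⟨M, hM⟩ := hc.exists_bound_of_continuousOn hf.continuousOn
  refine ⟨max M 0, le_max_right _ _, ?_⟩
  rintro ⟨κ, p⟩ d hd
  obtain ⟨κ0, mk, h1, rfl⟩ := exists_floor_vec κ
  obtain ⟨p0, m, h2, rfl⟩ := exists_floor_vec p
  rw [hper]
  exact (hM _ ⟨⟨h1, h2⟩, hd⟩).trans (le_max_left _ _)

theorem periodic_bounded' {n : ℕ} {W : Type} [SeminormedAddCommGroup W]
    (f : Vec n → W) (hf : Continuous f)
    (hper : ∀ m p, f (p + zcast m) = f p) :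
    ∃ M : ℝ, 0 ≤ M ∧ ∀ p, ‖f p‖ ≤ M := by
  obtain ⟨M, hM, h⟩ := periodic_bounded (k := 0) (n := n) (D := Unit) univ isCompact_univ
    (fun z => f z.1.2) (by fun_prop) (fun mk m κ p d => hper m p)
  exact ⟨M, hM, fun p => h (0, p) () trivial⟩

theorem periodic_unifCont {k n : ℕ} {W : Type} [SeminormedAddCommGroup W]
    (f : Vec k × Vec n → W) (hf : Continuous f)
    (hper : ∀ mk m κ p, f (κ + zcast mk, p + zcast m) = f (κ, p)) :
    UniformContinuous f := by
  have hc : IsCompact ((Icc (-1 : Vec k) 2 ×ˢ Icc (-1 : Vec n) 2)) :=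
    (isCompact_Icc.prod isCompact_Icc)
  have hu := hc.uniformContinuousOn_of_continuous hf.continuousOn
  rw [Metric.uniformContinuous_iff]
  intro ε hε
  obtain ⟨δ, hδ, h⟩ := Metric.uniformContinuousOn_iff.1 hu ε hε
  refine ⟨min δ 1, by positivity, ?_⟩
  rintro ⟨κ, p⟩ ⟨κ', p'⟩ hd
  obtain ⟨κ0, mk, h1, rfl⟩ := exists_floor_vec κ
  obtain ⟨p0, m, h2, rfl⟩ := exists_floor_vec p
  have e1 : κ' = (κ' - zcast mk) + zcast mk := by simp
  have e2 : p' = (p' - zcast m) + zcast m := by simp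
  rw [e1, e2] at hd ⊢
  set κ1 := κ' - zcast mk
  set p1 := p' - zcast m
  rw [hper, hper]
  have hd' : dist ((κ0, p0) : Vec k × Vec n) (κ1, p1) < min δ 1 := by
    simpa [Prod.dist_eq, dist_add_right] using hd
  have key : ∀ {n : ℕ} (a b : Vec n), a ∈ Icc (0 : Vec n) 1 → dist a b < 1 → b ∈ Icc (-1 : Vec n) 2 := by
    intro n a b ha hab
    have := fun j => (dist_le_pi_dist a b j).trans_lt hab
    simp only [Real.dist_eq, abs_lt] at this
    constructor
    · intro j; have := this j; have := ha.1 j; simp at *; linarith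
    · intro j; have := this j; have := ha.2 j; simp at *; linarith
  have k1 : dist κ0 κ1 < 1 := ((le_max_left _ _).trans_lt hd').trans_le (min_le_right _ _)
  have k2 : dist p0 p1 < 1 := ((le_max_right _ _).trans_lt hd').trans_le (min_le_right _ _)
  exact h _ ⟨key κ0 κ0 h1 (by simp), key p0 p0 h2 (by simp)⟩ _ ⟨key _ _ h1 k1, key _ _ h2 k2⟩
    (hd'.trans_le (min_le_left _ _))

open MeasureTheory in
theorem mollify {E W W' : Type} [NormedAddCommGroup E] [NormedSpace ℝ E] [FiniteDimensional ℝ E]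
    [NormedAddCommGroup W] [NormedSpace ℝ W] [CompleteSpace W]
    [NormedAddCommGroup W'] [NormedSpace ℝ W'] [CompleteSpace W']
    (f : E → W) (hf : UniformContinuous f) (ε : ℝ) (hε : 0 < ε) :
    ∃ g : E → W, ContDiff ℝ C∞ g ∧ (∀ z, ‖g z - f z‖ ≤ ε) ∧
      (∀ a, (∀ z, f (z + a) = f z) → ∀ z, g (z + a) = g z) ∧
      (∀ L : W →L[ℝ] W', (∀ z, L (f z) = 0) → ∀ z, L (g z) = 0) := by
  borelize E
  obtain ⟨δ, hδ, hfδ⟩ := Metric.uniformContinuous_iff.mp hf ε hε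
  let μ : Measure E := Measure.addHaar
  have hl : LocallyIntegrable f μ := hf.continuous.locallyIntegrable
  set φ : ContDiffBump (0 : E) := ⟨δ / 2, δ, half_pos hδ, half_lt_self hδ⟩
  refine ⟨_, (φ.hasCompactSupport_normed (μ := μ)).contDiff_convolution_left (μ := μ) (ContinuousLinearMap.lsmul ℝ ℝ) (φ.contDiff_normed (μ := μ)) hl,
    ?_, ?_, ?_⟩
  · intro z
    rw [← dist_eq_norm]
    exact φ.dist_normed_convolution_le hl.aestronglyMeasurable (fun x hx => (hfδ hx).le)
  · intro a ha z
    simp only [convolution_def]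
    congr 1
    funext t
    rw [show z + a - t = (z - t) + a by abel, ha]
  · intro L hL z
    simp only [convolution_def]
    rw [← L.integral_comp_comm]
    · simp [hL]
    · have := (φ.hasCompactSupport_normed (μ := μ)).convolutionExists_left (ContinuousLinearMap.lsmul ℝ ℝ)
        φ.continuous_normed hl z
      exact this
end Periodic

section Taylor
open Filter Topology Set
local notation "C∞" => ((⊤ : ℕ∞) : WithTop ℕ∞)

def taylorP {n ℓ : ℕ} (A : (i : ℕ) → SymMap n ℓ i) (r : ℕ) (q x : Vec n) : Vec ℓ :=
  ∑ i ∈ Finset.range (r+1), ((i.factorial : ℝ)⁻¹) • A i (fun _ => x - q)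

theorem taylorP_jet {n ℓ : ℕ} (A : (i : ℕ) → SymMap n ℓ i) (r : ℕ) (q : Vec n)
    (hA : ∀ i ≤ r, IsSymmMap (A i)) (i : ℕ) (hi : i ≤ r) :
    iteratedFDeriv ℝ i (fun x => taylorP A r q x) q = A i := by
  let p : FormalMultilinearSeries ℝ (Vec n) (Vec ℓ) := fun i =>
    if i ≤ r then ((i.factorial : ℝ)⁻¹) • A i else 0
  have hp : HasFiniteFPowerSeriesOnBall (fun x => taylorP A r q x) p q (r+1) ⊤ := by
    refine HasFiniteFPowerSeriesOnBall.mk' ?_ (by simp) ?_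
    · intro m hm
      simp only [p]
      rw [if_neg (by omega)]
    · intro y _
      simp only [taylorP]
      refine Finset.sum_congr rfl fun i hi => ?_
      simp only [p]
      rw [if_pos (by simpa [Nat.lt_succ_iff] using hi)]
      simp
  ext1 v
  rw [hp.toHasFPowerSeriesOnBall.iteratedFDeriv_eq_sum_of_completeSpace]
  have : ∀ e : Equiv.Perm (Fin i), p i (fun j => v (e j)) = ((i.factorial : ℝ)⁻¹) • A i v := by
    intro e
    simp only [p, if_pos hi]
    have := hA i hi e v
    simp only [Function.comp_def] at this
    simp [this]
  simp only [this]
  rw [Finset.sum_const, Finset.card_univ, Fintype.card_perm, Fintype.card_fin, ← Nat.cast_smul_eq_nsmul ℝ, smul_smul, mul_inv_cancel₀, one_smul]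
  exact_mod_cast Nat.factorial_ne_zero i

theorem smooth_mlapply {Z : Type} [NormedAddCommGroup Z] [NormedSpace ℝ Z] {n ℓ i : ℕ}
    {A : Z → SymMap n ℓ i} {d : Z → Vec n} (hA : ContDiff ℝ C∞ A) (hd : ContDiff ℝ C∞ d) :
    ContDiff ℝ C∞ (fun z => A z (fun _ => d z)) := by
  let B := (ContinuousLinearMap.id ℝ (SymMap n ℓ i)).flipMultilinear
  have hB : ContDiff ℝ C∞ (fun v : Fin i → Vec n => B v) :=
    ContinuousMultilinearMap.contDiff (𝕜 := ℝ) (ι := Fin i) (E := fun _ : Fin i => Vec n)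
      (F := SymMap n ℓ i →L[ℝ] Vec ℓ) (n := C∞) B
  have hD : ContDiff ℝ C∞ (fun z => (fun _ : Fin i => d z)) := contDiff_pi.2 fun _ => hd
  have h1 : ContDiff ℝ C∞ (fun z => B (fun _ => d z)) := hB.comp hD
  exact h1.clm_apply hA

theorem propP (n ℓ r k : ℕ) (ε : ℝ) (hε : 0 < ε)
    (σ : (i : ℕ) → Vec k × Vec n → SymMap n ℓ i)
    (hσcont : ∀ i ≤ r, Continuous (σ i))
    (hσperK : ∀ i ≤ r, ∀ (mk : Fin k → ℤ) (κ : Vec k) (p : Vec n),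
      σ i (κ + zcast mk, p) = σ i (κ, p))
    (hσperN : ∀ i ≤ r, ∀ (κ : Vec k) (m : Fin n → ℤ) (p : Vec n),
      σ i (κ, p + zcast m) = σ i (κ, p))
    (hσsym : ∀ i ≤ r, ∀ (κ : Vec k) (p : Vec n), IsSymmMap (σ i (κ, p))) :
    ∃ (Pf : Vec k → Vec n × Vec n → Vec ℓ) (C ν : ℝ), 0 ≤ C ∧ 0 < ν ∧ ν ≤ 1 ∧
      ContDiff ℝ C∞ (Function.uncurry Pf) ∧
      (∀ mk κ z, Pf (κ + zcast mk) z = Pf κ z) ∧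
      (∀ κ m q x, Pf κ (q + zcast m, x + zcast m) = Pf κ (q, x)) ∧
      (∀ κ x q q', ‖q - x‖ ≤ 1 → ‖q' - x‖ ≤ 1 → ‖Pf κ (q, x) - Pf κ (q', x)‖ ≤ C * ‖q - q'‖) ∧
      (∀ i ≤ r, ∀ κ (γ : Vec n → Vec n) (x₀ p : Vec n), ContDiff ℝ C∞ γ →
        ‖γ x₀ - p‖ ≤ ν → ‖x₀ - p‖ ≤ ν → (∀ b, 1 ≤ b → b ≤ r → ‖iteratedFDeriv ℝ b γ x₀‖ ≤ ν) →
        ‖iteratedFDeriv ℝ i (fun x => Pf κ (γ x, x)) x₀ - σ i (κ, p)‖ ≤ ε) := by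
  -- mollified formal section
  have hS : ∀ i, ∃ s : Vec k × Vec n → SymMap n ℓ i, ContDiff ℝ C∞ s ∧
      (∀ mk m κ p, s (κ + zcast mk, p + zcast m) = s (κ, p)) ∧
      (i ≤ r → (∀ z, ‖s z - σ i z‖ ≤ ε / 4) ∧ ∀ z, IsSymmMap (s z)) := by
    intro i
    by_cases hi : i ≤ r
    · have hper : ∀ mk m κ p, σ i (κ + zcast mk, p + zcast m) = σ i (κ, p) := by
        intro mk m κ p
        rw [hσperK i hi, hσperN i hi]
      obtain ⟨s, h1, h2, h3, h4⟩ := mollify (W' := Vec ℓ) (σ i) (periodic_unifCont _ (hσcont i hi) hper) (ε/4) (by positivity)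
      refine ⟨s, h1, ?_, fun _ => ⟨h2, ?_⟩⟩
      · intro mk m κ p
        exact h3 (zcast mk, zcast m) (fun z => hper mk m z.1 z.2) (κ, p)
      · intro z e v
        have := h4 (ContinuousMultilinearMap.apply ℝ (fun _ : Fin i => Vec n) (Vec ℓ) (v ∘ e) -
          ContinuousMultilinearMap.apply ℝ (fun _ : Fin i => Vec n) (Vec ℓ) v) (by
            intro z
            have := hσsym i hi z.1 z.2 e v
            simp [this]) z
        simpa [sub_eq_zero] using this
    · exact ⟨fun _ => 0, contDiff_const, fun _ _ _ _ => rfl, fun h => absurd h hi⟩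
  choose s hs1 hs2 hs3 using hS
  let Pf : Vec k → Vec n × Vec n → Vec ℓ := fun κ z => taylorP (fun i => s i (κ, z.1)) r z.1 z.2
  have hPs : ContDiff ℝ C∞ (Function.uncurry Pf) := by
    have : Function.uncurry Pf = fun z : Vec k × Vec n × Vec n => ∑ i ∈ Finset.range (r+1),
        ((i.factorial : ℝ)⁻¹) • s i (z.1, z.2.1) (fun _ => z.2.2 - z.2.1) := rfl
    rw [this]
    refine ContDiff.sum fun i _ => ContDiff.const_smul ((i.factorial : ℝ)⁻¹) ?_
    refine smooth_mlapply (A := fun z : Vec k × Vec n × Vec n => s i (z.1, z.2.1))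
      (d := fun z : Vec k × Vec n × Vec n => z.2.2 - z.2.1) ((hs1 i).comp (by fun_prop)) (by fun_prop)
  have hs2K : ∀ i mk κ p, s i (κ + zcast mk, p) = s i (κ, p) := by
    intro i mk κ p
    have := hs2 i mk 0 κ p
    rwa [show (zcast (0 : Fin n → ℤ)) = 0 by funext j; simp [zcast], add_zero] at this
  have hs2N : ∀ i m κ p, s i (κ, p + zcast m) = s i (κ, p) := by
    intro i m κ p
    have := hs2 i 0 m κ p
    rwa [show (zcast (0 : Fin k → ℤ)) = 0 by funext j; simp [zcast], add_zero] at this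
  have hPK : ∀ mk κ z, Pf (κ + zcast mk) z = Pf κ z := by
    intro mk κ z
    simp only [Pf, hs2K]
  have hPN : ∀ κ m q x, Pf κ (q + zcast m, x + zcast m) = Pf κ (q, x) := by
    intro κ m q x
    simp only [Pf, hs2N, taylorP]
    simp
  have hPκ : ∀ κ, ContDiff ℝ C∞ (Pf κ) := fun κ => hPs.comp (contDiff_const.prodMk contDiff_id)
  -- uniform bounds
  have hM : ∀ b : ℕ, ∃ M : ℝ, 0 ≤ M ∧ ∀ κ q x, ‖x - q‖ ≤ 1 → ‖iteratedFDeriv ℝ b (Pf κ) (q, x)‖ ≤ M := by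
    intro b
    obtain ⟨M, hM0, hM⟩ := periodic_bounded (k := k) (n := n) (D := Vec n) (Metric.closedBall 0 1)
      (isCompact_closedBall _ _) (fun z => iteratedFDeriv ℝ b (Pf z.1.1) (z.1.2, z.1.2 + z.2))
      ((smooth_parjet b hPs).continuous.comp (f := fun z : (Vec k × Vec n) × Vec n => (z.1.1, (z.1.2, z.1.2 + z.2))) (by fun_prop)) (by
        intro mk m κ p d
        have e1 : Pf (κ + zcast mk) = Pf κ := funext fun z => hPK mk κ z
        have e2 : (fun z => Pf κ (z + (zcast m, zcast m))) = Pf κ := by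
          funext z; exact hPN κ m z.1 z.2
        simp only [e1]
        have := iteratedFDeriv_comp_add_right (𝕜 := ℝ) (f := Pf κ) b (zcast m, zcast m) (p, p + d)
        rw [e2] at this
        rw [this]
        congr 1
        simp
        abel)
    refine ⟨M, hM0, fun κ q x hx => ?_⟩
    have := hM (κ, q) (x - q) (by simpa using hx)
    simpa using this
  choose Mb hMb0 hMb using hM
  -- derivative in q
  have hLip : ∀ κ x q q', ‖q - x‖ ≤ 1 → ‖q' - x‖ ≤ 1 →
      ‖Pf κ (q, x) - Pf κ (q', x)‖ ≤ Mb 1 * ‖q - q'‖ := by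
    intro κ x q q' hq hq'
    have hd : ∀ y ∈ Metric.closedBall x 1, HasFDerivWithinAt (fun y => Pf κ (y, x))
        ((fderiv ℝ (Pf κ) (y, x)).comp (ContinuousLinearMap.inl ℝ _ _)) (Metric.closedBall x 1) y := by
      intro y hy
      exact ((smooth_diff (hPκ κ) (y, x)).hasFDerivAt.comp (f := fun y => (y, x)) y
        (hasFDerivAt_prodMk_left y x)).hasFDerivWithinAt
    refine (convex_closedBall x 1).norm_image_sub_le_of_norm_hasFDerivWithin_le hd ?_
      (by simpa [dist_eq_norm] using hq') (by simpa [dist_eq_norm] using hq)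
    intro y hy
    refine (ContinuousLinearMap.opNorm_comp_le _ _).trans ?_
    have h1 := hMb 1 κ y x (by rw [← dist_eq_norm, dist_comm]; exact hy)
    rw [norm_iteratedFDeriv_one] at h1
    calc _ ≤ Mb 1 * 1 := mul_le_mul h1 (ContinuousLinearMap.norm_inl_le_one ℝ _ _) (norm_nonneg _) (hMb0 1)
      _ = _ := mul_one _
  -- Lipschitz of the i-th pure jet
  have hJL : ∀ i κ q x, ‖x - q‖ ≤ 1 →
      ‖iteratedFDeriv ℝ i (fun x => Pf κ (q, x)) x - iteratedFDeriv ℝ i (fun x => Pf κ (q, x)) q‖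
        ≤ ((i+1).factorial * (∑ b ∈ Finset.range (i+2), Mb b)) * ‖x - q‖ := by
    intro i κ q x hx
    have hsm : ContDiff ℝ C∞ (fun x => Pf κ (q, x)) := (hPκ κ).comp (contDiff_const.prodMk contDiff_id)
    have hd : ∀ y ∈ Metric.closedBall q 1, HasFDerivWithinAt (iteratedFDeriv ℝ i (fun x => Pf κ (q, x)))
        (fderiv ℝ (iteratedFDeriv ℝ i (fun x => Pf κ (q, x))) y) (Metric.closedBall q 1) y := by
      intro y hy
      exact (smooth_diff (smooth_jet i hsm) y).hasFDerivAt.hasFDerivWithinAt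
    refine (convex_closedBall q 1).norm_image_sub_le_of_norm_hasFDerivWithin_le hd ?_
      (by simp) (by simpa [dist_eq_norm] using hx)
    intro y hy
    rw [norm_fderiv_iteratedFDeriv]
    have := norm_iteratedFDeriv_comp_le (g := Pf κ) (f := fun x => ((q, x) : Vec n × Vec n)) (n := i+1) (N := C∞)
      (hPκ κ) (contDiff_const.prodMk contDiff_id) (nat_le_smooth (i+1)) y
      (C := ∑ b ∈ Finset.range (i+2), Mb b) (D := 1) ?_ ?_
    · rw [one_pow, mul_one] at this
      exact this
    · intro b hb
      refine (hMb b κ q y (by rw [← dist_eq_norm]; exact hy)).trans ?_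
      exact Finset.single_le_sum (f := Mb) (fun b _ => hMb0 b) (by simp; omega)
    · intro b hb _
      obtain ⟨b, rfl⟩ : ∃ b', b = b' + 1 := ⟨b - 1, by omega⟩
      rw [← norm_iteratedFDeriv_fderiv]
      have : fderiv ℝ (fun x => ((q, x) : Vec n × Vec n)) = fun _ => ContinuousLinearMap.inr ℝ _ _ := by
        funext x; exact (hasFDerivAt_prodMk_right q x).fderiv
      rw [this]
      cases b with
      | zero => simpa using ContinuousLinearMap.norm_inr_le_one ℝ (Vec n) (Vec n)
      | succ b => rw [iteratedFDeriv_const_of_ne (by omega)]; simp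
  have hcc := fun i => comp_close (Q := Vec n) (E := Vec n) (F := Vec ℓ) i (∑ b ∈ Finset.range (i+1), Mb b)
    (Finset.sum_nonneg fun b _ => hMb0 b)
  choose Cc hCc0 hCc using hcc
  -- choice of ν
  have hνi : ∀ i ≤ r, ∃ ν : ℝ, 0 < ν ∧ ν ≤ 1 ∧ Cc i * ν ≤ ε/4 ∧
      ((i+1).factorial * (∑ b ∈ Finset.range (i+2), Mb b)) * (2 * ν) ≤ ε / 4 ∧ 2 * ν ≤ 1 ∧
      ∀ κ p q, ‖q - p‖ ≤ ν → ‖s i (κ, q) - s i (κ, p)‖ ≤ ε/4 := by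
    intro i hi
    obtain ⟨δ, hδ, h⟩ := Metric.uniformContinuous_iff.1
      (periodic_unifCont (s i) (hs1 i).continuous (fun mk m κ p => hs2 i mk m κ p)) (ε/4) (by positivity)
    set L := ((i+1).factorial * (∑ b ∈ Finset.range (i+2), Mb b) : ℝ)
    have hL : 0 ≤ L := mul_nonneg (by positivity) (Finset.sum_nonneg fun b _ => hMb0 b)
    have hC0 := hCc0 i
    refine ⟨min (min (1/2) (δ/2)) (min (ε/4/(Cc i + 1)) (ε/4/(2*L+1))), by positivity, ?_, ?_, ?_, ?_, ?_⟩
    · exact ((min_le_left _ _).trans (min_le_left _ _)).trans (by norm_num)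
    · calc _ ≤ Cc i * (ε/4/(Cc i + 1)) := by
            gcongr; exact (min_le_right _ _).trans (min_le_left _ _)
        _ ≤ (Cc i + 1) * (ε/4/(Cc i + 1)) := by gcongr; linarith
        _ = ε/4 := by field_simp
    · calc _ ≤ L * (2 * (ε/4/(2*L+1))) := by
            gcongr; exact (min_le_right _ _).trans (min_le_right _ _)
        _ = (2 * L) * (ε/4/(2*L+1)) := by ring
        _ ≤ (2*L + 1) * (ε/4/(2*L+1)) := by gcongr; linarith
        _ = ε/4 := by field_simp
    · have : min (min (1/2) (δ/2)) (min (ε/4/(Cc i + 1)) (ε/4/(2*L+1))) ≤ 1/2 :=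
        ((min_le_left _ _).trans (min_le_left _ _))
      linarith
    · intro κ p q hq
      have h3 : ‖q - p‖ ≤ δ/2 := hq.trans ((min_le_left _ _).trans (min_le_right _ _))
      have := h (a := (κ, q)) (b := (κ, p)) (by rw [dist_prod_same_left, dist_eq_norm]; linarith)
      rw [dist_eq_norm] at this
      exact this.le
  have hν : ∃ ν : ℝ, 0 < ν ∧ ν ≤ 1 ∧ ∀ i ≤ r, Cc i * ν ≤ ε/4 ∧
      ((i+1).factorial * (∑ b ∈ Finset.range (i+2), Mb b)) * (2 * ν) ≤ ε / 4 ∧ 2 * ν ≤ 1 ∧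
      ∀ κ p q, ‖q - p‖ ≤ ν → ‖s i (κ, q) - s i (κ, p)‖ ≤ ε/4 := by
    have hνi' : ∀ i : Fin (r+1), _ := fun i => hνi i.1 (by omega)
    choose νf h1 h2 h3 h4 h5 h6 using hνi'
    refine ⟨Finset.univ.inf' Finset.univ_nonempty νf, ?_, ?_, ?_⟩
    · rw [Finset.lt_inf'_iff]; exact fun i _ => h1 i
    · exact (Finset.inf'_le _ (Finset.mem_univ 0)).trans (h2 0)
    · intro i hi
      have hle : Finset.univ.inf' Finset.univ_nonempty νf ≤ νf ⟨i, by omega⟩ := Finset.inf'_le _ (Finset.mem_univ _)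
      have hL : (0:ℝ) ≤ ((i+1).factorial * (∑ b ∈ Finset.range (i+2), Mb b) : ℝ) :=
        mul_nonneg (by positivity) (Finset.sum_nonneg fun b _ => hMb0 b)
      refine ⟨?_, ?_, ?_, ?_⟩
      · exact (mul_le_mul_of_nonneg_left hle (hCc0 i)).trans (h3 ⟨i, by omega⟩)
      · refine le_trans ?_ (h4 ⟨i, by omega⟩)
        exact mul_le_mul_of_nonneg_left (by linarith) hL
      · linarith [h5 ⟨i, by omega⟩]
      · intro κ p q hq
        exact h6 ⟨i, by omega⟩ κ p q (hq.trans hle)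
  obtain ⟨ν, hν0, hν1, hν⟩ := hν
  refine ⟨Pf, Mb 1, ν, hMb0 1, hν0, hν1, hPs, hPK, hPN, hLip, ?_⟩
  intro i hi κ γ x₀ p hγ hq hx hb
  obtain ⟨n1, n2, n3, n4⟩ := hν i hi
  have hxq : ‖x₀ - γ x₀‖ ≤ 2 * ν := by
    have : x₀ - γ x₀ = (x₀ - p) - (γ x₀ - p) := by abel
    rw [this]
    linarith [norm_sub_le (x₀ - p) (γ x₀ - p)]
  have s1 := hCc i (Pf κ) γ x₀ ν (hPκ κ) hγ hν0.le hν1 (fun b hbi =>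
    (hMb b κ (γ x₀) x₀ (hxq.trans n3)).trans
      (Finset.single_le_sum (f := Mb) (fun b _ => hMb0 b) (by simp; omega)))
    (fun b h1 h2 => hb b h1 (h2.trans hi))
  have s2 := hJL i κ (γ x₀) x₀ (hxq.trans n3)
  have hL : (0:ℝ) ≤ ((i+1).factorial * (∑ b ∈ Finset.range (i+2), Mb b) : ℝ) :=
        mul_nonneg (by positivity) (Finset.sum_nonneg fun b _ => hMb0 b)
  have s2' := s2.trans (mul_le_mul_of_nonneg_left hxq hL)
  have s3 : iteratedFDeriv ℝ i (fun x => Pf κ (γ x₀, x)) (γ x₀) = s i (κ, γ x₀) :=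
    taylorP_jet (fun i => s i (κ, γ x₀)) r (γ x₀) (fun i hi => (hs3 i hi).2 _) i hi
  rw [s3] at s2'
  have s4 := n4 κ p (γ x₀) hq
  have s5 := (hs3 i hi).1 (κ, p)
  generalize iteratedFDeriv ℝ i (fun x => Pf κ (γ x, x)) x₀ = a at *
  generalize iteratedFDeriv ℝ i (fun x => Pf κ (γ x₀, x)) x₀ = b at *
  calc ‖a - σ i (κ, p)‖ = ‖(a - b) + (b - s i (κ, γ x₀)) + (s i (κ, γ x₀) - s i (κ, p)) + (s i (κ, p) - σ i (κ, p))‖ := by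
        congr 1; abel
    _ ≤ ‖a - b‖ + ‖b - s i (κ, γ x₀)‖ + ‖s i (κ, γ x₀) - s i (κ, p)‖ + ‖s i (κ, p) - σ i (κ, p)‖ := norm_add₄_le
    _ ≤ ε/4 + ε/4 + ε/4 + ε/4 := by
        gcongr
        · exact s1.trans n1
        · exact s2'.trans n2
    _ = ε := by ring
end Taylor

section Blocks
open Filter Topology Set
local notation "C∞" => ((⊤ : ℕ∞) : WithTop ℕ∞)

def s1 (x : ℝ) : ℝ := Real.smoothTransition (16 * x - 15/2)

theorem s1_zero {x : ℝ} (h : x ≤ 15/32) : s1 x = 0 :=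
  Real.smoothTransition.zero_of_nonpos (by linarith)
theorem s1_one {x : ℝ} (h : 17/32 ≤ x) : s1 x = 1 :=
  Real.smoothTransition.one_of_one_le (by linarith)
theorem s1_nonneg (x : ℝ) : 0 ≤ s1 x := Real.smoothTransition.nonneg _
theorem s1_le (x : ℝ) : s1 x ≤ 1 := Real.smoothTransition.le_one _
theorem s1_mono : Monotone s1 := fun x y h => Real.smoothTransition.monotone (by linarith)
theorem s1_smooth : ContDiff ℝ C∞ s1 :=
  Real.smoothTransition.contDiff.comp (by fun_prop)

def KK (L : ℕ) (θ : ℝ) : ℝ := ⌊θ / L⌋ - 1 + s1 (θ - L * ⌊θ / L⌋)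

theorem KK_eq {L : ℕ} (hL : 1 ≤ L) (j : ℤ) {θ : ℝ} (h1 : (j-1) * L + 17/32 ≤ θ)
    (h2 : θ ≤ (j+1) * L + 15/32) : KK L θ = j - 1 + s1 (θ - j * L) := by
  have hL' : (1:ℝ) ≤ L := by exact_mod_cast hL
  have hL0 : (0:ℝ) < L := by linarith
  unfold KK
  rcases lt_or_ge θ (j * L) with h | h
  · have hf : ⌊θ / L⌋ = j - 1 := by
      rw [Int.floor_eq_iff]; push_cast
      constructor
      · rw [le_div_iff₀ hL0]; linarith
      · rw [div_lt_iff₀ hL0]; linarith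
    rw [hf, s1_one (by push_cast; linarith), s1_zero (by linarith)]
    push_cast; ring
  rcases lt_or_ge θ ((j+1) * L) with h' | h'
  · have hf : ⌊θ / L⌋ = j := by
      rw [Int.floor_eq_iff]
      constructor
      · rw [le_div_iff₀ hL0]; linarith
      · rw [div_lt_iff₀ hL0]; linarith
    rw [hf, mul_comm]
  · have hf : ⌊θ / L⌋ = j + 1 := by
      rw [Int.floor_eq_iff]; push_cast
      constructor
      · rw [le_div_iff₀ hL0]; linarith
      · rw [div_lt_iff₀ hL0]; linarith
    rw [hf, s1_zero (by push_cast; linarith), s1_one (by linarith)]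
    push_cast; ring

theorem KK_loc {L : ℕ} (hL : 1 ≤ L) (θ : ℝ) :
    KK L =ᶠ[𝓝 θ] fun t => (⌊θ / L⌋ : ℝ) - 1 + s1 (t - ⌊θ / L⌋ * L) := by
  have hL' : (1:ℝ) ≤ L := by exact_mod_cast hL
  have hL0 : (0:ℝ) < L := by linarith
  have a1 : (⌊θ / L⌋ : ℝ) * L ≤ θ := by rw [← le_div_iff₀ hL0]; exact Int.floor_le _
  have a2 : θ < (⌊θ / L⌋ + 1 : ℝ) * L := by rw [← div_lt_iff₀ hL0]; exact Int.lt_floor_add_one _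
  filter_upwards [Ioo_mem_nhds (show ((⌊θ / L⌋ : ℝ) - 1) * L + 17/32 < θ by linarith)
    (show θ < (⌊θ / L⌋ + 1 : ℝ) * L + 15/32 by linarith)] with t ht
  exact KK_eq hL _ ht.1.le ht.2.le

theorem KK_smooth {L : ℕ} (hL : 1 ≤ L) : ContDiff ℝ C∞ (KK L) := by
  rw [contDiff_iff_contDiffAt]
  intro θ
  refine ContDiffAt.congr_of_eventuallyEq ?_ (KK_loc hL θ)
  exact (contDiff_const.add (s1_smooth.comp (by fun_prop))).contDiffAt

theorem KK_deriv_nonneg {L : ℕ} (hL : 1 ≤ L) (θ : ℝ) : 0 ≤ deriv (KK L) θ := by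
  rw [(KK_loc hL θ).deriv_eq]
  have : Monotone (fun t => (⌊θ / L⌋ : ℝ) - 1 + s1 (t - ⌊θ / L⌋ * L)) := by
    intro a b h
    have := s1_mono (show a - ⌊θ / L⌋ * L ≤ b - ⌊θ / L⌋ * L by linarith)
    simpa using this
  exact this.deriv_nonneg

theorem KK_mono {L : ℕ} (hL : 1 ≤ L) : Monotone (KK L) :=
  monotone_of_deriv_nonneg (smooth_diff (KK_smooth hL)) (KK_deriv_nonneg hL)

theorem KK_shift {L : ℕ} (hL : 1 ≤ L) (N : ℤ) (θ : ℝ) : KK L (θ + N * L) = KK L θ + N := by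
  have hL0 : (0:ℝ) < L := by exact_mod_cast hL
  unfold KK
  have : (θ + N * L) / L = θ / L + N := by field_simp
  rw [this, Int.floor_add_intCast]
  push_cast
  rw [show θ + N * L - L * (⌊θ / L⌋ + N) = θ - L * (⌊θ / L⌋ : ℝ) by ring]
  ring

theorem KK_bound {L : ℕ} (hL : 1 ≤ L) (θ : ℝ) : |KK L θ - θ / L| ≤ 2 := by
  unfold KK
  have h1 := Int.floor_le (θ / L)
  have h2 := Int.lt_floor_add_one (θ / L)
  have h3 := s1_nonneg (θ - L * ⌊θ / L⌋)
  have h4 := s1_le (θ - L * ⌊θ / L⌋)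
  rw [abs_le]; constructor <;> linarith

/-- flat around integers -/
theorem KK_flat {L : ℕ} (hL : 1 ≤ L) (i : ℤ) : ∃ N : ℤ, ∀ θ : ℝ, |θ - i| ≤ 15/32 → KK L θ = N := by
  have hL' : (1:ℝ) ≤ L := by exact_mod_cast hL
  have hLz : (0:ℤ) < L := by exact_mod_cast hL
  have e : (L : ℤ) * (i / L) + i % L = i := Int.mul_ediv_add_emod i L
  have m0 := Int.emod_nonneg i hLz.ne'
  have m1 := Int.emod_lt_of_pos i hLz
  set j := i / (L : ℤ)
  set m := i % (L : ℤ)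
  have e' : (L : ℝ) * j + m = i := by exact_mod_cast e
  rcases m0.eq_or_lt with h | h
  · refine ⟨j - 1, fun θ hθ => ?_⟩
    rw [abs_le] at hθ
    have : (m : ℝ) = 0 := by exact_mod_cast h.symm
    rw [KK_eq hL j (by nlinarith) (by nlinarith), s1_zero (by nlinarith)]
    push_cast; ring
  · refine ⟨j, fun θ hθ => ?_⟩
    rw [abs_le] at hθ
    have g1 : (1:ℝ) ≤ m := by exact_mod_cast h
    have g2 : (m:ℝ) + 1 ≤ L := by exact_mod_cast m1
    rw [KK_eq hL j (by nlinarith) (by nlinarith), s1_one (by nlinarith)]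
    ring

theorem KK_const {L : ℕ} (hL : 1 ≤ L) (i : ℤ) {a b : ℝ} (ha : |a - i| ≤ 15/32) (hb : |b - i| ≤ 15/32) :
    KK L a = KK L b := by
  obtain ⟨N, hN⟩ := KK_flat hL i
  rw [hN _ ha, hN _ hb]

theorem KK_val {L : ℕ} (hL : 1 ≤ L) (j : ℤ) {θ : ℝ} (h1 : j * L + 17/32 ≤ θ) (h2 : θ ≤ (j+1) * L + 15/32) :
    KK L θ = j := by
  have hL' : (1:ℝ) ≤ L := by exact_mod_cast hL
  rw [KK_eq hL j (by linarith) h2, s1_one (by linarith)]; ring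

theorem KK_loc_const {L : ℕ} (hL : 1 ≤ L) (i : ℤ) {θ : ℝ} (h : |θ - i| < 15/32) :
    ∀ᶠ t in 𝓝 θ, KK L t = KK L θ := by
  have : ∀ᶠ t : ℝ in 𝓝 θ, |t - i| < 15/32 :=
    (by fun_prop : Continuous fun t : ℝ => |t - i|).continuousAt.eventually_lt continuousAt_const h
  filter_upwards [this] with t ht
  exact KK_const hL i ht.le h.le

/-- every point is near an integer or near a half-integer -/
theorem near_int (θ : ℝ) : ∃ i : ℤ, |θ - i| ≤ 1/2 := ⟨round θ, abs_sub_round θ⟩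

def JJ (θ : ℝ) : ℝ := KK 1 θ + 1

theorem JJ_val (i : ℤ) {θ : ℝ} (h : |θ - i| ≤ 15/32) : JJ θ = i := by
  rw [abs_le] at h
  unfold JJ
  rw [KK_val le_rfl (i-1) (by push_cast; linarith) (by push_cast; linarith)]
  push_cast; ring

theorem JJ_smooth : ContDiff ℝ C∞ JJ := (KK_smooth le_rfl).add contDiff_const
theorem JJ_shift (N : ℤ) (θ : ℝ) : JJ (θ + N) = JJ θ + N := by
  have := KK_shift le_rfl N θ
  simp only [Nat.cast_one, mul_one] at this
  unfold JJ; rw [this]; ring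
theorem JJ_bound (θ : ℝ) : |JJ θ - θ| ≤ 3 := by
  have := KK_bound le_rfl θ
  unfold JJ
  rw [abs_le] at *
  norm_num at this
  constructor <;> linarith

/-! the wave -/
def cw (θ : ℝ) : ℝ := - Real.cos (2 * Real.pi * θ)

theorem cw_smooth : ContDiff ℝ C∞ cw := by unfold cw; fun_prop
theorem cw_le (θ : ℝ) : cw θ ≤ 1 := by unfold cw; linarith [Real.neg_one_le_cos (2 * Real.pi * θ)]
theorem le_cw (θ : ℝ) : -1 ≤ cw θ := by unfold cw; linarith [Real.cos_le_one (2 * Real.pi * θ)]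
theorem cw_shift (N : ℤ) (θ : ℝ) : cw (θ + N) = cw θ := by
  unfold cw
  rw [show 2 * Real.pi * (θ + N) = 2 * Real.pi * θ + N * (2 * Real.pi) by ring, Real.cos_add_int_mul_two_pi]
theorem cw_half (θ : ℝ) : cw (θ + 1/2) = - cw θ := by
  unfold cw
  rw [show 2 * Real.pi * (θ + 1/2) = 2 * Real.pi * θ + Real.pi by ring, Real.cos_add_pi]
theorem cw_abs (i : ℤ) (θ : ℝ) : cw θ = - Real.cos (2 * Real.pi * |θ - i|) := by
  have h := cw_shift (-i) θ
  rw [← h]; push_cast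
  unfold cw
  rw [← Real.cos_abs, abs_mul, abs_of_pos (by positivity : 0 < 2 * Real.pi), ← sub_eq_add_neg]
theorem cw_lt (i : ℤ) {u θ : ℝ} (h : |u - i| < |θ - i|) (h' : |θ - i| ≤ 1/2) : cw u < cw θ := by
  rw [cw_abs i u, cw_abs i θ, neg_lt_neg_iff]
  have := Real.pi_pos
  apply Real.cos_lt_cos_of_nonneg_of_le_pi (by positivity) (by nlinarith)
  have := mul_lt_mul_of_pos_left h (by positivity : 0 < 2 * Real.pi)
  exact this
theorem cw_gt (i : ℤ) {u θ : ℝ} (h : |u - i - 1/2| < |θ - i - 1/2|) (h' : |θ - i - 1/2| ≤ 1/2) : cw θ < cw u := by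
  have h1 := cw_half (u - 1/2)
  have h2 := cw_half (θ - 1/2)
  simp only [sub_add_cancel] at h1 h2
  have := cw_lt i (u := u - 1/2) (θ := θ - 1/2) (by convert h using 2 <;> ring) (by convert h' using 2; ring)
  linarith
theorem cw_zone_lo {θ : ℝ} (h : cw θ ≤ -1/4) : ∃ i : ℤ, |θ - i| < 7/32 := by
  obtain ⟨i, hi⟩ := near_int θ
  refine ⟨i, ?_⟩
  by_contra hc
  push Not at hc
  rw [cw_abs i θ] at h
  have hpi := Real.pi_pos
  have h4 := Real.pi_lt_four
  have : Real.cos (2 * Real.pi * |θ - i|) ≤ Real.cos (2 * Real.pi * (7/32)) :=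
    Real.cos_le_cos_of_nonneg_of_le_pi (by positivity) (by nlinarith) (by gcongr)
  rw [show 2 * Real.pi * (7/32) = Real.pi / 2 - Real.pi/16 by ring, Real.cos_pi_div_two_sub] at this
  have h5 := Real.sin_lt (show 0 < Real.pi/16 by positivity)
  linarith
theorem cw_zone_hi {θ : ℝ} (h : 1/4 ≤ cw θ) : ∃ i : ℤ, |θ - i - 1/2| < 7/32 := by
  have h1 := cw_half (θ - 1/2)
  simp only [sub_add_cancel] at h1
  obtain ⟨i, hi⟩ := cw_zone_lo (θ := θ - 1/2) (by linarith)
  exact ⟨i, by convert hi using 2; ring⟩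
theorem cw_zone_lo' (i : ℤ) {θ : ℝ} (h : |θ - i| ≤ 1/16) : cw θ < -1/2 := by
  rw [cw_abs i θ]
  have h0 := abs_nonneg (θ - i)
  have hpi := Real.pi_pos
  have h4 := Real.pi_lt_four
  have := Real.one_sub_sq_div_two_le_cos (x := 2 * Real.pi * |θ - i|)
  have h5 : 2 * Real.pi * |θ - i| ≤ 1/2 := by nlinarith
  have h6 : 0 ≤ 2 * Real.pi * |θ - i| := by positivity
  nlinarith
theorem cw_zone_hi' (i : ℤ) {θ : ℝ} (h : |θ - i - 1/2| ≤ 1/16) : 1/2 < cw θ := by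
  have h1 := cw_half (θ - 1/2)
  simp only [sub_add_cancel] at h1
  have := cw_zone_lo' i (θ := θ - 1/2) (by convert h using 2; ring)
  linarith

theorem cw_hasDeriv (θ : ℝ) : HasDerivAt cw (2 * Real.pi * Real.sin (2 * Real.pi * θ)) θ := by
  unfold cw
  have := ((hasDerivAt_id θ).const_mul (2 * Real.pi)).cos.neg
  simp only [id] at this
  refine (this.congr_deriv ?_)
  ring
end Blocks

section Norm1
open Filter Topology Set
local notation "C∞" => ((⊤ : ℕ∞) : WithTop ℕ∞)

def sS (x : ℝ) : ℝ := Real.smoothTransition (x + 1/2)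
def cR (x : ℝ) : ℝ := Real.smoothTransition (4 * x - 1)
def cL (x : ℝ) : ℝ := Real.smoothTransition (-4 * x - 1)

theorem sS_smooth : ContDiff ℝ C∞ sS := Real.smoothTransition.contDiff.comp (by fun_prop)
theorem cR_smooth : ContDiff ℝ C∞ cR := Real.smoothTransition.contDiff.comp (by fun_prop)
theorem cL_smooth : ContDiff ℝ C∞ cL := Real.smoothTransition.contDiff.comp (by fun_prop)
theorem sS_zero {x : ℝ} (h : x ≤ -1/2) : sS x = 0 := Real.smoothTransition.zero_of_nonpos (by linarith)
theorem sS_one {x : ℝ} (h : 1/2 ≤ x) : sS x = 1 := Real.smoothTransition.one_of_one_le (by linarith)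
theorem sS_nonneg (x : ℝ) : 0 ≤ sS x := Real.smoothTransition.nonneg _
theorem sS_le (x : ℝ) : sS x ≤ 1 := Real.smoothTransition.le_one _
theorem sS_mono : Monotone sS := fun x y h => Real.smoothTransition.monotone (by linarith)
theorem cR_zero {x : ℝ} (h : x ≤ 1/4) : cR x = 0 := Real.smoothTransition.zero_of_nonpos (by linarith)
theorem cR_pos {x : ℝ} (h : 1/4 < x) : 0 < cR x := Real.smoothTransition.pos_of_pos (by linarith)
theorem cL_zero {x : ℝ} (h : -1/4 ≤ x) : cL x = 0 := Real.smoothTransition.zero_of_nonpos (by linarith)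
theorem cL_pos {x : ℝ} (h : x < -1/4) : 0 < cL x := Real.smoothTransition.pos_of_pos (by linarith)

def UU (L : ℕ) (θ : ℝ) : ℝ := KK L (θ + 1/4) + cw θ / 8
def EE (L : ℕ) (θ y : ℝ) : ℝ := sS (8 * (y - KK L (θ + 1/2)))
def psi (L : ℕ) (θ y : ℝ) : ℝ := (1 - EE L θ y) * JJ θ + EE L θ y * (JJ (θ - 1/2) + 1/2)
def VV (L k : ℕ) (θ : ℝ) : ℝ := ∫ u in (0:ℝ)..θ, UU L u ^ k
def QQ (L r : ℕ) (θ y : ℝ) : ℝ :=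
  ∑ k ∈ Finset.range (r+1), (VV L k θ) * ((-y)^(r-k)) * (r.choose k)
def TT (L r : ℕ) (θ y : ℝ) : ℝ :=
  Real.cos (Real.pi * KK L (θ + 1/4)) *
    (cR (8 * (y - KK L (θ + 1/2))) * (QQ L r θ y - QQ L r (JJ (θ - 1/2) + 1/2) y) +
     (-1)^r * cL (8 * (y - KK L θ)) * (QQ L r θ y - QQ L r (JJ θ) y))
def rh (L r : ℕ) (θ y : ℝ) : ℝ :=
  Real.cos (Real.pi * KK L (θ + 1/4)) *
    (cR (8 * (y - KK L (θ + 1/2))) + (-1)^r * cL (8 * (y - KK L θ)))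

variable {L : ℕ} (hL : 1 ≤ L)
include hL

theorem UU_smooth : ContDiff ℝ C∞ (UU L) :=
  ((KK_smooth hL).comp (by fun_prop)).add (cw_smooth.div_const _)

theorem graph_hi (θ : ℝ) : 8 * (UU L θ - KK L (θ + 1/2)) ≤ cw θ := by
  have := KK_mono hL (show θ + 1/4 ≤ θ + 1/2 by linarith)
  unfold UU; linarith
theorem graph_lo (θ : ℝ) : cw θ ≤ 8 * (UU L θ - KK L θ) := by
  have := KK_mono hL (show θ ≤ θ + 1/4 by linarith)
  unfold UU; linarith

theorem VV_hasDeriv (k : ℕ) (θ : ℝ) : HasDerivAt (VV L k) (UU L θ ^ k) θ := by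
  have hc : Continuous (fun u => UU L u ^ k) := ((UU_smooth hL).continuous).pow k
  exact hc.integral_hasStrictDerivAt 0 θ |>.hasDerivAt

theorem VV_smooth (k : ℕ) : ContDiff ℝ C∞ (VV L k) := by
  rw [contDiff_infty_iff_deriv]
  refine ⟨fun θ => (VV_hasDeriv hL k θ).differentiableAt, ?_⟩
  have : deriv (VV L k) = fun θ => UU L θ ^ k := funext fun θ => (VV_hasDeriv hL k θ).deriv
  rw [this]
  exact (UU_smooth hL).pow k

theorem QQ_hasDeriv (r : ℕ) (θ y : ℝ) : HasDerivAt (fun t => QQ L r t y) ((UU L θ - y)^r) θ := by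
  unfold QQ
  have : HasDerivAt (fun t => ∑ k ∈ Finset.range (r+1), (VV L k t) * ((-y)^(r-k)) * (r.choose k : ℝ))
      (∑ k ∈ Finset.range (r+1), (UU L θ ^ k) * ((-y)^(r-k)) * (r.choose k : ℝ)) θ :=
    HasDerivAt.fun_sum fun k _ => ((VV_hasDeriv hL k θ).mul_const _).mul_const _
  rwa [← add_pow, ← sub_eq_add_neg] at this

theorem QQ_smooth (r : ℕ) : ContDiff ℝ C∞ (fun z : ℝ × ℝ => QQ L r z.1 z.2) := by
  unfold QQ
  refine ContDiff.sum fun k _ => ((((VV_smooth hL k).comp contDiff_fst).mul ?_).mul contDiff_const)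
  fun_prop

theorem EE_smooth : ContDiff ℝ C∞ (fun z : ℝ × ℝ => EE L z.1 z.2) := by
  unfold EE
  refine sS_smooth.comp ?_
  have : ContDiff ℝ C∞ (fun z : ℝ × ℝ => KK L (z.1 + 1/2)) := (KK_smooth hL).comp (by fun_prop)
  fun_prop

theorem psi_smooth : ContDiff ℝ C∞ (fun z : ℝ × ℝ => psi L z.1 z.2) := by
  unfold psi
  have h1 := EE_smooth hL
  have h2 : ContDiff ℝ C∞ (fun z : ℝ × ℝ => JJ z.1) := JJ_smooth.comp contDiff_fst
  have h3 : ContDiff ℝ C∞ (fun z : ℝ × ℝ => JJ (z.1 - 1/2)) := JJ_smooth.comp (by fun_prop)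
  fun_prop

omit hL in
theorem comp2 {Z : Type} [NormedAddCommGroup Z] [NormedSpace ℝ Z] {F : ℝ → ℝ → ℝ} {a b : Z → ℝ}
    (hF : ContDiff ℝ C∞ (fun z : ℝ × ℝ => F z.1 z.2)) (ha : ContDiff ℝ C∞ a) (hb : ContDiff ℝ C∞ b) :
    ContDiff ℝ C∞ (fun z => F (a z) (b z)) := hF.comp (ha.prodMk hb)

omit hL in
theorem comp1 {Z : Type} [NormedAddCommGroup Z] [NormedSpace ℝ Z] {F : ℝ → ℝ} {a : Z → ℝ}
    (hF : ContDiff ℝ C∞ F) (ha : ContDiff ℝ C∞ a) :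
    ContDiff ℝ C∞ (fun z => F (a z)) := hF.comp ha

theorem TT_smooth (r : ℕ) : ContDiff ℝ C∞ (fun z : ℝ × ℝ => TT L r z.1 z.2) := by
  unfold TT
  have hk0 : ContDiff ℝ C∞ (fun z : ℝ × ℝ => KK L z.1) := comp1 (KK_smooth hL) contDiff_fst
  have hk : ContDiff ℝ C∞ (fun z : ℝ × ℝ => KK L (z.1 + 1/2)) := comp1 (KK_smooth hL) (by fun_prop)
  have hk' : ContDiff ℝ C∞ (fun z : ℝ × ℝ => KK L (z.1 + 1/4)) := comp1 (KK_smooth hL) (by fun_prop)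
  have h1 : ContDiff ℝ C∞ (fun z : ℝ × ℝ => cR (8 * (z.2 - KK L (z.1 + 1/2)))) :=
    comp1 cR_smooth (by fun_prop)
  have h2 : ContDiff ℝ C∞ (fun z : ℝ × ℝ => cL (8 * (z.2 - KK L z.1))) :=
    comp1 cL_smooth (by fun_prop)
  have hj : ContDiff ℝ C∞ (fun z : ℝ × ℝ => JJ (z.1 - 1/2) + 1/2) :=
    (comp1 JJ_smooth (by fun_prop)).add contDiff_const
  have h3 : ContDiff ℝ C∞ (fun z : ℝ × ℝ => QQ L r (JJ (z.1 - 1/2) + 1/2) z.2) :=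
    comp2 (QQ_smooth hL r) hj contDiff_snd
  have h4 : ContDiff ℝ C∞ (fun z : ℝ × ℝ => QQ L r (JJ z.1) z.2) :=
    comp2 (QQ_smooth hL r) (comp1 JJ_smooth contDiff_fst) contDiff_snd
  have h5 := QQ_smooth hL r
  have h6 : ContDiff ℝ C∞ (fun z : ℝ × ℝ => Real.cos (Real.pi * KK L (z.1 + 1/4))) :=
    comp1 Real.contDiff_cos (by fun_prop)
  fun_prop

omit hL in
theorem ev_fst {f : ℝ → Prop} {θ y : ℝ} (h : ∀ᶠ t in 𝓝 θ, f t) : ∀ᶠ z : ℝ × ℝ in 𝓝 (θ, y), f z.1 :=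
  continuousAt_fst.eventually h

omit hL in
theorem shift_ev {f : ℝ → ℝ} {θ a : ℝ} (h : ∀ᶠ t in 𝓝 (θ + a), f t = f (θ + a)) : ∀ᶠ t in 𝓝 θ, f (t + a) = f (θ + a) :=
  (by fun_prop : Continuous fun t : ℝ => t + a).continuousAt.eventually h

omit hL in
theorem JJ_loc (i : ℤ) {θ : ℝ} (h : |θ - i| < 15/32) : ∀ᶠ t in 𝓝 θ, JJ t = JJ θ := by
  filter_upwards [KK_loc_const le_rfl i h] with t ht
  unfold JJ; rw [ht]

omit hL in
theorem JJ_loc' (i : ℤ) {θ : ℝ} (h : |θ - 1/2 - i| < 15/32) : ∀ᶠ t in 𝓝 θ, JJ (t - 1/2) = JJ (θ - 1/2) :=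
  (by fun_prop : Continuous fun t : ℝ => t - 1/2).continuousAt.eventually (JJ_loc i h)

theorem psi_loc (θ : ℝ) : ∀ᶠ z : ℝ × ℝ in 𝓝 (θ, UU L θ), psi L z.1 z.2 = psi L θ z.2 := by
  have hcont : Continuous (fun z : ℝ × ℝ => 8 * (z.2 - KK L (z.1 + 1/2))) := by
    have : Continuous (fun z : ℝ × ℝ => KK L (z.1 + 1/2)) := (KK_smooth hL).continuous.comp (by fun_prop)
    fun_prop
  have hcont2 : Continuous (fun z : ℝ × ℝ => 8 * (z.2 - KK L (θ + 1/2))) := by fun_prop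
  -- near an integer
  have caseA : ∀ i : ℤ, |θ - i| ≤ 1/16 → ∀ᶠ z : ℝ × ℝ in 𝓝 (θ, UU L θ), psi L z.1 z.2 = psi L θ z.2 := by
    intro i hi
    have hc := (graph_hi hL θ).trans_lt (cw_zone_lo' i hi)
    have e1 : ∀ᶠ z : ℝ × ℝ in 𝓝 (θ, UU L θ), 8 * (z.2 - KK L (z.1 + 1/2)) < -1/2 :=
      hcont.continuousAt.eventually_lt continuousAt_const hc
    have e2 : ∀ᶠ z : ℝ × ℝ in 𝓝 (θ, UU L θ), 8 * (z.2 - KK L (θ + 1/2)) < -1/2 :=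
      hcont2.continuousAt.eventually_lt continuousAt_const hc
    filter_upwards [e1, e2, ev_fst (JJ_loc i (hi.trans_lt (by norm_num)))] with z h1 h2 h3
    unfold psi EE
    rw [sS_zero h1.le, sS_zero h2.le, h3]; ring
  have gen : ∀ i j : ℤ, |θ + 1/2 - i| < 15/32 → |θ - 1/2 - j| < 15/32 →
      ((∃ i : ℤ, |θ - i| < 15/32) ∨ 1/2 < cw θ ∧ KK L (θ + 1/2) = KK L (θ + 1/4)) →
      ∀ᶠ z : ℝ × ℝ in 𝓝 (θ, UU L θ), psi L z.1 z.2 = psi L θ z.2 := by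
    intro i j h1 h2 h3
    have k1 := ev_fst (y := UU L θ) (shift_ev (KK_loc_const hL i h1))
    have k2 := ev_fst (y := UU L θ) (JJ_loc' j h2)
    rcases h3 with ⟨m, h3⟩ | ⟨h3, h4⟩
    · filter_upwards [k1, k2, ev_fst (JJ_loc m h3)] with z e1 e2 e3
      unfold psi EE
      rw [e1, e2, e3]
    · have e2 : ∀ᶠ z : ℝ × ℝ in 𝓝 (θ, UU L θ), 1/2 < 8 * (z.2 - KK L (θ + 1/2)) := by
        refine continuousAt_const.eventually_lt hcont2.continuousAt ?_
        simp only [UU, h4]; linarith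
      filter_upwards [k1, k2, e2] with z e1 e2 e3
      unfold psi EE
      rw [e1, e2, sS_one e3.le]; ring
  have f1 := Int.floor_le θ
  have f2 := Int.lt_floor_add_one θ
  set i := ⌊θ⌋
  by_cases c1 : θ ≤ i + 1/16
  · exact caseA i (by rw [abs_le]; constructor <;> linarith)
  by_cases c2 : i + 15/16 ≤ θ
  · exact caseA (i+1) (by rw [abs_le]; push_cast; constructor <;> linarith)
  push Not at c1 c2
  refine gen (i+1) i (by rw [abs_lt]; push_cast; constructor <;> linarith) (by rw [abs_lt]; constructor <;> linarith) ?_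
  by_cases c3 : θ < i + 7/16
  · exact Or.inl ⟨i, by rw [abs_lt]; constructor <;> linarith⟩
  by_cases c4 : i + 9/16 < θ
  · exact Or.inl ⟨i+1, by rw [abs_lt]; push_cast; constructor <;> linarith⟩
  push Not at c3 c4
  refine Or.inr ⟨cw_zone_hi' i (by rw [abs_le]; constructor <;> linarith), ?_⟩
  exact KK_const hL (i+1) (by rw [abs_le]; push_cast; constructor <;> linarith)
    (by rw [abs_le]; push_cast; constructor <;> linarith)

theorem TT_loc (r : ℕ) (θ : ℝ) : ∀ᶠ z : ℝ × ℝ in 𝓝 (θ, UU L θ),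
    TT L r z.1 z.2 = TT L r θ z.2 + rh L r θ z.2 * (QQ L r z.1 z.2 - QQ L r θ z.2) := by
  have hcont : Continuous (fun z : ℝ × ℝ => 8 * (z.2 - KK L (z.1 + 1/2))) := by
    have : Continuous (fun z : ℝ × ℝ => KK L (z.1 + 1/2)) := (KK_smooth hL).continuous.comp (by fun_prop)
    fun_prop
  have hcont2 : Continuous (fun z : ℝ × ℝ => 8 * (z.2 - KK L (θ + 1/2))) := by fun_prop
  have hcont' : Continuous (fun z : ℝ × ℝ => 8 * (z.2 - KK L z.1)) := by
    have : Continuous (fun z : ℝ × ℝ => KK L z.1) := (KK_smooth hL).continuous.comp (by fun_prop)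
    fun_prop
  have hcont2' : Continuous (fun z : ℝ × ℝ => 8 * (z.2 - KK L θ)) := by fun_prop
  have rz : cw θ < 1/4 → ∀ᶠ z : ℝ × ℝ in 𝓝 (θ, UU L θ), cR (8 * (z.2 - KK L (z.1 + 1/2))) = 0 ∧
      cR (8 * (z.2 - KK L (θ + 1/2))) = 0 := by
    intro h
    have hc := (graph_hi hL θ).trans_lt h
    filter_upwards [(hcont.continuousAt.eventually_lt continuousAt_const hc),
      (hcont2.continuousAt.eventually_lt continuousAt_const hc)] with z h1 h2
    exact ⟨cR_zero h1.le, cR_zero h2.le⟩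
  have lz : -1/4 < cw θ → ∀ᶠ z : ℝ × ℝ in 𝓝 (θ, UU L θ), cL (8 * (z.2 - KK L z.1)) = 0 ∧
      cL (8 * (z.2 - KK L θ)) = 0 := by
    intro h
    have hc := h.trans_le (graph_lo hL θ)
    filter_upwards [(continuousAt_const.eventually_lt hcont'.continuousAt hc),
      (continuousAt_const.eventually_lt hcont2'.continuousAt hc)] with z h1 h2
    exact ⟨cL_zero h1.le, cL_zero h2.le⟩
  rcases le_or_gt (1/4) (cw θ) with h | h
  · obtain ⟨i, hi⟩ := cw_zone_hi h
    rw [abs_lt] at hi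
    filter_upwards [lz (by linarith),
      ev_fst (shift_ev (KK_loc_const hL (i+1) (θ := θ + 1/2) (by rw [abs_lt]; push_cast; constructor <;> linarith))),
      ev_fst (shift_ev (KK_loc_const hL (i+1) (θ := θ + 1/4) (by rw [abs_lt]; push_cast; constructor <;> linarith))),
      ev_fst (JJ_loc' i (by rw [abs_lt]; constructor <;> linarith))] with z e1 e2 e3 e4
    unfold TT rh
    rw [e1.1, e1.2, e2, e3, e4]; ring
  rcases lt_or_ge (-1/4) (cw θ) with h' | h'
  · filter_upwards [lz h', rz h] with z e1 e2
    unfold TT rh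
    rw [e1.1, e1.2, e2.1, e2.2]; ring
  · obtain ⟨i, hi⟩ := cw_zone_lo h'
    rw [abs_lt] at hi
    filter_upwards [rz h,
      ev_fst (KK_loc_const hL i (θ := θ) (by rw [abs_lt]; constructor <;> linarith)),
      ev_fst (shift_ev (KK_loc_const hL i (θ := θ + 1/4) (by rw [abs_lt]; constructor <;> linarith))),
      ev_fst (JJ_loc i (by rw [abs_lt]; constructor <;> linarith))] with z e1 e2 e3 e4
    unfold TT rh
    rw [e1.1, e1.2, e2, e3, e4]; ring

/-! shifts -/
theorem UU_shift (N : ℤ) (θ : ℝ) : UU L (θ + N * L) = UU L θ + N := by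
  unfold UU
  have h1 := KK_shift hL N (θ + 1/4)
  have h2 := cw_shift (N * L) θ
  push_cast at h2
  rw [h2, show θ + N * L + 1/4 = θ + 1/4 + N * L by ring, h1]; ring

theorem psi_shift (N : ℤ) (θ y : ℝ) : psi L (θ + N * L) (y + N) = psi L θ y + N * L := by
  unfold psi EE
  have h1 := KK_shift hL N (θ + 1/2)
  have h2 := JJ_shift (N * L) θ
  have h3 := JJ_shift (N * L) (θ - 1/2)
  push_cast at h2 h3
  rw [h2, show θ + N * L - 1/2 = θ - 1/2 + N * L by ring, h3, show θ + N * L + 1/2 = θ + 1/2 + N * L by ring, h1,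
    show y + N - (KK L (θ + 1/2) + N) = y - KK L (θ + 1/2) by ring]
  ring

theorem QQ_shift (r : ℕ) (N : ℤ) (θ a y : ℝ) :
    QQ L r (θ + N * L) (y + N) - QQ L r (a + N * L) (y + N) = QQ L r θ y - QQ L r a y := by
  have hd : ∀ t, HasDerivAt (fun t => QQ L r (t + N * L) (y + N) - QQ L r t y) 0 t := by
    intro t
    have h1 := (QQ_hasDeriv hL r (t + N * L) (y + N)).comp_add_const t (N * L)
    have h2 := QQ_hasDeriv hL r t y
    refine (h1.sub h2).congr_deriv ?_
    rw [UU_shift hL]; ring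
  have := is_const_of_deriv_eq_zero (fun t => (hd t).differentiableAt) (fun t => (hd t).deriv) θ a
  linarith

theorem TT_shift (r : ℕ) (N : ℤ) (θ y : ℝ) :
    TT L r (θ + ((2 * N : ℤ) : ℝ) * L) (y + ((2 * N : ℤ) : ℝ)) = TT L r θ y := by
  unfold TT
  have h1 := KK_shift hL (2 * N) (θ + 1/2)
  have h1' := KK_shift hL (2 * N) (θ + 1/4)
  have h1'' := KK_shift hL (2 * N) θ
  have h2 := JJ_shift (2 * N * L) θ
  have h3 := JJ_shift (2 * N * L) (θ - 1/2)
  have h4 := QQ_shift hL r (2 * N) θ (JJ θ) y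
  have h5 := QQ_shift hL r (2 * N) θ (JJ (θ - 1/2) + 1/2) y
  have hc : Real.cos (Real.pi * (KK L (θ + 1/4) + ((2 * N : ℤ) : ℝ))) = Real.cos (Real.pi * KK L (θ + 1/4)) := by
    rw [show Real.pi * (KK L (θ + 1/4) + ((2 * N : ℤ) : ℝ)) = Real.pi * KK L (θ + 1/4) + N * (2 * Real.pi) by push_cast; ring,
      Real.cos_add_int_mul_two_pi]
  push_cast at *
  rw [h1'', h2, show θ + 2 * N * L - 1/2 = θ - 1/2 + 2 * N * L by ring, h3,
    show θ + 2 * N * L + 1/2 = θ + 1/2 + 2 * N * L by ring, h1,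
    show θ + 2 * N * L + 1/4 = θ + 1/4 + 2 * N * L by ring, h1', hc, h4,
    show JJ (θ - 1/2) + 2 * N * L + 1/2 = JJ (θ - 1/2) + 1/2 + 2 * N * L by ring, h5]
  congr 3
  · congr 2; ring
  · congr 3; ring

theorem UU_deriv_zero {θ : ℝ} (h : deriv (UU L) θ = 0) : ∃ i : ℤ, θ = i / 2 := by
  have hK := (smooth_diff (KK_smooth hL) (θ + 1/4)).hasDerivAt.comp_add_const θ (1/4)
  have hd := hK.add ((cw_hasDeriv θ).div_const 8)
  have hd' : deriv (UU L) θ = _ := hd.deriv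
  rw [h] at hd'
  have hK0 := KK_deriv_nonneg hL (θ + 1/4)
  have hsin : Real.sin (2 * Real.pi * θ) = 0 := by
    have hpi := Real.pi_pos
    by_cases hz : ∃ i : ℤ, |θ + 1/4 - i| < 15/32
    · obtain ⟨i, hi⟩ := hz
      have : deriv (KK L) (θ + 1/4) = 0 := by
        have : KK L =ᶠ[𝓝 (θ + 1/4)] fun _ => KK L (θ + 1/4) := KK_loc_const hL i hi
        rw [this.deriv_eq]; simp
      rw [this] at hd'
      have : 2 * Real.pi * Real.sin (2 * Real.pi * θ) = 0 := by linarith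
      rcases mul_eq_zero.1 this with h | h
      · linarith
      · exact h
    · exfalso
      push Not at hz
      have f1 := Int.floor_le (θ + 1/4)
      have f2 := Int.lt_floor_add_one (θ + 1/4)
      have g1 := hz ⌊θ + 1/4⌋
      have g2 := hz (⌊θ + 1/4⌋ + 1)
      set i := ⌊θ + 1/4⌋
      rw [abs_of_nonneg (by linarith)] at g1
      push_cast at g2
      rw [abs_of_nonpos (by linarith)] at g2
      have : 0 < Real.sin (2 * Real.pi * θ) := by
        have e : Real.sin (2 * Real.pi * θ) = Real.sin (2 * Real.pi * (θ - i)) := by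
          rw [show 2 * Real.pi * (θ - i) = 2 * Real.pi * θ - i * (2 * Real.pi) by ring, Real.sin_sub_int_mul_two_pi]
        rw [e]
        apply Real.sin_pos_of_pos_of_lt_pi
        · have : 0 < θ - i := by linarith
          positivity
        · nlinarith
      have : 0 < 2 * Real.pi * Real.sin (2 * Real.pi * θ) := by positivity
      linarith
  obtain ⟨i, hi⟩ := Real.sin_eq_zero_iff.1 hsin
  refine ⟨i, ?_⟩
  have hpi := Real.pi_pos
  have : Real.pi * (i - 2 * θ) = 0 := by linarith
  rcases mul_eq_zero.1 this with h | h
  · linarith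
  · linarith

end Norm1

section Sep1
open Filter Topology Set
local notation "C∞" => ((⊤ : ℕ∞) : WithTop ℕ∞)

variable {L : ℕ} (hL : 1 ≤ L)
include hL

theorem sep_block {θ θ' : ℝ} (h : θ < θ') (hU : UU L θ = UU L θ') :
    ∃ j : ℤ, |UU L θ - j| ≤ 1/8 ∧ j * L + 7/32 < θ ∧ θ' < (j + 1) * L + 9/32 := by
  have hL' : (1:ℝ) ≤ L := by exact_mod_cast hL
  have hmono := KK_mono hL
  have hab := hmono (show θ + 1/4 ≤ θ' + 1/4 by linarith)
  have c1 := cw_le θ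
  have c2 := le_cw θ
  have c3 := cw_le θ'
  have c4 := le_cw θ'
  have lo : ∀ j : ℤ, ∀ t, (j:ℝ) - 1 < KK L (t + 1/4) → j * L + 7/32 < t := by
    intro j t ht
    by_contra hc
    push Not at hc
    have := hmono (show t + 1/4 ≤ j * L + 15/32 by linarith)
    rw [KK_val hL (j-1) (θ := j * L + 15/32) (by push_cast; linarith) (by push_cast; linarith)] at this
    push_cast at this; linarith
  have hi : ∀ j : ℤ, ∀ t, KK L (t + 1/4) < j → t < j * L + 9/32 := by
    intro j t ht
    by_contra hc
    push Not at hc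
    have := hmono (show j * L + 17/32 ≤ t + 1/4 by linarith)
    rw [KK_val hL j (θ := j * L + 17/32) (by linarith) (by linarith)] at this
    linarith
  have hj : ∃ j : ℤ, KK L (θ + 1/4) ≤ j ∧ j ≤ KK L (θ' + 1/4) := by
    refine ⟨⌈KK L (θ + 1/4)⌉, Int.le_ceil _, ?_⟩
    by_contra hc
    push Not at hc
    have g1 := Int.ceil_lt_add_one (KK L (θ + 1/4))
    set j := ⌈KK L (θ + 1/4)⌉
    have l1 := lo j θ (by linarith)
    have l2 := hi j θ' hc
    have := cw_lt (j * L) (u := θ) (θ := θ') (by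
      push_cast; rw [abs_of_pos (by linarith), abs_of_pos (by linarith)]; linarith) (by
      push_cast; rw [abs_of_pos (by linarith)]; linarith)
    unfold UU at hU
    linarith
  obtain ⟨j, h1, h2⟩ := hj
  refine ⟨j, ?_, lo j θ ?_, ?_⟩
  · unfold UU at *; rw [abs_le]; constructor <;> linarith
  · unfold UU at hU; linarith
  · have := hi (j+1) θ' (by unfold UU at hU; push_cast; linarith)
    push_cast at this; exact this

theorem EE_near_int (i : ℤ) {θ : ℝ} (h : |θ - i| ≤ 1/16) : EE L θ (UU L θ) = 0 :=
  sS_zero ((graph_hi hL θ).trans (cw_zone_lo' i h).le)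

theorem EE_near_half (i : ℤ) {θ : ℝ} (h : |θ - i - 1/2| ≤ 1/16) : EE L θ (UU L θ) = 1 := by
  have hc := cw_zone_hi' i h
  rw [abs_le] at h
  refine sS_one ?_
  have : KK L (θ + 1/2) = KK L (θ + 1/4) :=
    KK_const hL (i+1) (by rw [abs_le]; push_cast; constructor <;> linarith)
      (by rw [abs_le]; push_cast; constructor <;> linarith)
  rw [this]; unfold UU; linarith

theorem psi_up (i : ℤ) {θ : ℝ} (h1 : i ≤ θ) (h2 : θ ≤ i + 1/2) :
    psi L θ (UU L θ) = i + EE L θ (UU L θ) / 2 := by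
  unfold psi
  have a1 : (1 - EE L θ (UU L θ)) * (JJ θ - i) = 0 := by
    by_cases h : θ ≤ i + 15/32
    · rw [JJ_val i (by rw [abs_le]; constructor <;> linarith)]; ring
    · rw [EE_near_half hL i (by rw [abs_le]; constructor <;> linarith)]; ring
  have a2 : EE L θ (UU L θ) * (JJ (θ - 1/2) - i) = 0 := by
    by_cases h : i + 1/32 ≤ θ
    · rw [JJ_val i (by rw [abs_le]; constructor <;> linarith)]; ring
    · rw [EE_near_int hL i (by rw [abs_le]; constructor <;> linarith)]; ring
  linarith

theorem psi_dn (i : ℤ) {θ : ℝ} (h1 : i + 1/2 ≤ θ) (h2 : θ ≤ i + 1) :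
    psi L θ (UU L θ) = i + 1 - EE L θ (UU L θ) / 2 := by
  unfold psi
  have a1 : (1 - EE L θ (UU L θ)) * (JJ θ - (i+1)) = 0 := by
    by_cases h : i + 17/32 ≤ θ
    · rw [JJ_val (i+1) (by rw [abs_le]; push_cast; constructor <;> linarith)]; push_cast; ring
    · rw [EE_near_half hL i (by rw [abs_le]; constructor <;> linarith)]; ring
  have a2 : EE L θ (UU L θ) * (JJ (θ - 1/2) - i) = 0 := by
    by_cases h : θ ≤ i + 31/32
    · rw [JJ_val i (by rw [abs_le]; constructor <;> linarith)]; ring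
    · rw [EE_near_int hL (i+1) (by rw [abs_le]; push_cast; constructor <;> linarith)]; ring
  linarith

theorem TT_hi (r : ℕ) (i : ℤ) {θ : ℝ} (hc : 1/4 < cw θ) (hi : |θ - i - 1/2| < 7/32) :
    ∃ P : ℝ, 0 < P ∧ TT L r θ (UU L θ) = Real.cos (Real.pi * KK L (θ + 1/4)) * (P * (θ - (i + 1/2))) := by
  have hi' := abs_lt.1 hi
  have hK : ∀ t : ℝ, |t - i - 1/2| < 7/32 → KK L (t + 1/4) = KK L (θ + 1/4) := by
    intro t ht
    rw [abs_lt] at ht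
    exact KK_const hL (i+1) (by rw [abs_le]; push_cast; constructor <;> linarith)
      (by rw [abs_le]; push_cast; constructor <;> linarith)
  have hK2 : KK L (θ + 1/2) = KK L (θ + 1/4) :=
    KK_const hL (i+1) (by rw [abs_le]; push_cast; constructor <;> linarith)
      (by rw [abs_le]; push_cast; constructor <;> linarith)
  have hz : 8 * (UU L θ - KK L (θ + 1/4)) = cw θ := by unfold UU; ring
  have hT : TT L r θ (UU L θ) = Real.cos (Real.pi * KK L (θ + 1/4)) *
      (cR (cw θ) * (QQ L r θ (UU L θ) - QQ L r (i + 1/2) (UU L θ))) := by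
    unfold TT
    rw [hK2, hz, cL_zero (by linarith [graph_lo hL θ]), JJ_val i (by rw [abs_le]; constructor <;> linarith)]
    ring
  rw [hT]
  have hp := cR_pos hc
  have hpow : ∀ u : ℝ, |u - i - 1/2| < |θ - i - 1/2| → 0 < (UU L u - UU L θ)^r := by
    intro u hu
    have := cw_gt i hu (by linarith)
    refine pow_pos ?_ r
    unfold UU
    rw [hK u (by linarith)]; linarith
  rcases lt_trichotomy θ (i + 1/2) with h | h | h
  · obtain ⟨u, hu, hq⟩ := exists_hasDerivAt_eq_slope (fun t => QQ L r t (UU L θ)) (fun t => (UU L t - UU L θ)^r) h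
      (fun t _ => (QQ_hasDeriv hL r t _).continuousAt.continuousWithinAt) (fun t _ => QQ_hasDeriv hL r t _)
    refine ⟨cR (cw θ) * (UU L u - UU L θ)^r, mul_pos hp (hpow u ?_), ?_⟩
    · rw [abs_of_neg (by linarith [hu.2]), abs_of_neg (by linarith)]; linarith [hu.1]
    · rw [eq_div_iff (by linarith)] at hq
      congr 1
      linear_combination (cR (cw θ)) * hq
  · exact ⟨1, one_pos, by rw [h]; ring⟩
  · obtain ⟨u, hu, hq⟩ := exists_hasDerivAt_eq_slope (fun t => QQ L r t (UU L θ)) (fun t => (UU L t - UU L θ)^r) h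
      (fun t _ => (QQ_hasDeriv hL r t _).continuousAt.continuousWithinAt) (fun t _ => QQ_hasDeriv hL r t _)
    refine ⟨cR (cw θ) * (UU L u - UU L θ)^r, mul_pos hp (hpow u ?_), ?_⟩
    · rw [abs_of_pos (by linarith [hu.1]), abs_of_pos (by linarith)]; linarith [hu.2]
    · rw [eq_div_iff (by linarith)] at hq
      congr 1
      linear_combination (-cR (cw θ)) * hq

theorem TT_lo (r : ℕ) (i : ℤ) {θ : ℝ} (hc : cw θ < -1/4) (hi : |θ - i| < 7/32) :
    ∃ P : ℝ, 0 < P ∧ TT L r θ (UU L θ) = Real.cos (Real.pi * KK L (θ + 1/4)) * (P * (θ - i)) := by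
  have hi' := abs_lt.1 hi
  have hK : ∀ t : ℝ, |t - i| < 7/32 → KK L (t + 1/4) = KK L (θ + 1/4) := by
    intro t ht
    rw [abs_lt] at ht
    exact KK_const hL i (by rw [abs_le]; constructor <;> linarith)
      (by rw [abs_le]; constructor <;> linarith)
  have hK2 : KK L θ = KK L (θ + 1/4) :=
    KK_const hL i (by rw [abs_le]; constructor <;> linarith)
      (by rw [abs_le]; constructor <;> linarith)
  have hz : 8 * (UU L θ - KK L (θ + 1/4)) = cw θ := by unfold UU; ring
  have hT : TT L r θ (UU L θ) = Real.cos (Real.pi * KK L (θ + 1/4)) *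
      (cL (cw θ) * ((-1)^r * (QQ L r θ (UU L θ) - QQ L r i (UU L θ)))) := by
    unfold TT
    rw [hK2, hz, cR_zero (by linarith [graph_hi hL θ]), JJ_val i (θ := θ) (by rw [abs_le]; constructor <;> linarith)]
    ring
  rw [hT]
  have hp := cL_pos hc
  have hpow : ∀ u : ℝ, |u - i| < |θ - i| → 0 < (-1)^r * (UU L u - UU L θ)^r := by
    intro u hu
    have := cw_lt i hu (by linarith)
    rw [← mul_pow]
    refine pow_pos ?_ r
    unfold UU
    rw [hK u (by linarith)]; linarith
  rcases lt_trichotomy θ i with h | h | h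
  · obtain ⟨u, hu, hq⟩ := exists_hasDerivAt_eq_slope (fun t => QQ L r t (UU L θ)) (fun t => (UU L t - UU L θ)^r) h
      (fun t _ => (QQ_hasDeriv hL r t _).continuousAt.continuousWithinAt) (fun t _ => QQ_hasDeriv hL r t _)
    refine ⟨cL (cw θ) * ((-1)^r * (UU L u - UU L θ)^r), mul_pos hp (hpow u ?_), ?_⟩
    · rw [abs_of_neg (by linarith [hu.2]), abs_of_neg (by linarith)]; linarith [hu.1]
    · rw [eq_div_iff (by linarith)] at hq
      congr 1
      linear_combination (cL (cw θ) * (-1)^r) * hq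
  · exact ⟨1, one_pos, by rw [h]; ring⟩
  · obtain ⟨u, hu, hq⟩ := exists_hasDerivAt_eq_slope (fun t => QQ L r t (UU L θ)) (fun t => (UU L t - UU L θ)^r) h
      (fun t _ => (QQ_hasDeriv hL r t _).continuousAt.continuousWithinAt) (fun t _ => QQ_hasDeriv hL r t _)
    refine ⟨cL (cw θ) * ((-1)^r * (UU L u - UU L θ)^r), mul_pos hp (hpow u ?_), ?_⟩
    · rw [abs_of_pos (by linarith [hu.1]), abs_of_pos (by linarith)]; linarith [hu.2]
    · rw [eq_div_iff (by linarith)] at hq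
      congr 1
      linear_combination (-cL (cw θ) * (-1)^r) * hq

omit hL in
def e1 : ℝ := min (sS (-1/4)) (1 - sS (1/4))
omit hL in
theorem e1_pos : 0 < e1 := by
  refine lt_min (Real.smoothTransition.pos_of_pos (by norm_num)) ?_
  have := Real.smoothTransition.lt_one_of_lt_one (show (1/4 : ℝ) + 1/2 < 1 by norm_num)
  unfold sS; linarith
omit hL in
theorem e1_le : e1 ≤ 1 := (min_le_left _ _).trans (sS_le _)

omit hL in
theorem cos_pi_int_sq (j : ℤ) : Real.cos (Real.pi * j) * Real.cos (Real.pi * j) = 1 := by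
  have := Real.sin_int_mul_pi j
  have h2 := Real.sin_sq_add_cos_sq (j * Real.pi)
  rw [this, mul_comm (j : ℝ)] at h2
  nlinarith

theorem sep_main (r : ℕ) {θ θ' : ℝ} (h : θ < θ') (hU : UU L θ = UU L θ') :
    ∃ j : ℤ, j * L ≤ psi L θ (UU L θ) ∧ psi L θ (UU L θ) ≤ psi L θ' (UU L θ') ∧
      psi L θ' (UU L θ') ≤ (j + 1) * L ∧
      (e1 / 2 ≤ psi L θ' (UU L θ') - psi L θ (UU L θ) ∨
        0 < Real.cos (Real.pi * j) * (TT L r θ' (UU L θ') - TT L r θ (UU L θ))) := by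
  have hL' : (1:ℝ) ≤ L := by exact_mod_cast hL
  obtain ⟨j, hj, hb1, hb2⟩ := sep_block hL h hU
  refine ⟨j, ?_⟩
  set E := sS (8 * (UU L θ - j)) with hE
  have E0 : 0 ≤ E := sS_nonneg _
  have E1 : E ≤ 1 := sS_le _
  have he1 := e1_le
  -- data of a point
  have data : ∀ t, UU L t = UU L θ → j * L + 7/32 < t → t < (j+1) * L + 9/32 → ∃ i : ℤ,
      (i ≤ t ∧ t ≤ i + 1/2 ∧ j * L ≤ (i:ℝ) ∧ (i:ℝ) ≤ (j+1) * L ∧ i ≤ psi L t (UU L t) ∧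
        psi L t (UU L t) ≤ i + E / 2 ∧ ((i:ℝ) < (j+1) * L → psi L t (UU L t) = i + E/2) ∧
        ((i:ℝ) = (j+1) * L → psi L t (UU L t) = i)) ∨
      (i + 1/2 ≤ t ∧ t ≤ i + 1 ∧ j * L ≤ (i:ℝ) ∧ (i:ℝ) + 1 ≤ (j+1) * L ∧ psi L t (UU L t) = i + 1 - E/2) := by
    intro t ht h1 h2
    have f1 := Int.floor_le t
    have f2 := Int.lt_floor_add_one t
    refine ⟨⌊t⌋, ?_⟩
    set i := ⌊t⌋
    have hEE : (t:ℝ) ≤ (j+1) * L - 1/32 → EE L t (UU L t) = E := by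
      intro hh
      unfold EE
      rw [KK_val hL j (θ := t + 1/2) (by linarith) (by linarith), ht]
    have hEE' : (j+1) * L - 1/32 ≤ t → EE L t (UU L t) = 0 := by
      intro hh
      by_cases hc : t ≤ (j+1) * L + 1/32
      · exact EE_near_int hL ((j+1) * L) (by rw [abs_le]; push_cast; constructor <;> linarith)
      · unfold EE
        rw [KK_val hL (j+1) (θ := t + 1/2) (by push_cast; linarith) (by push_cast; linarith)]
        refine sS_zero ?_
        rw [ht]
        rw [abs_le] at hj
        push_cast; linarith
    have hEs : ∀ m : ℤ, (t ≤ m → (m:ℝ) ≤ (j+1) * L → EE L t (UU L t) = E) := by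
      intro m hm hm'
      by_cases hc : t ≤ (j+1) * L - 1/32
      · exact hEE hc
      · rw [hEE' (by linarith)]
        have hK : KK L (t + 1/4) = j := KK_val hL j (by linarith) (by linarith)
        have : cw t < -1/2 := cw_zone_lo' ((j+1) * L) (by rw [abs_le]; push_cast; constructor <;> linarith)
        rw [hE, ← ht, sS_zero]
        unfold UU; rw [hK]; linarith
    rcases le_total t (i + 1/2) with hc | hc
    · left
      have g1 : j * L ≤ (i:ℝ) := by
        have : ((j * L : ℤ) : ℝ) < ((i + 1 : ℤ) : ℝ) := by push_cast; linarith
        have := Int.cast_lt.1 this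
        exact_mod_cast Int.lt_add_one_iff.1 this
      have g2 : (i:ℝ) ≤ (j+1) * L := by
        have : ((i : ℤ) : ℝ) < (((j + 1) * L + 1 : ℤ) : ℝ) := by push_cast; linarith
        have := Int.cast_lt.1 this
        exact_mod_cast Int.lt_add_one_iff.1 this
      have hp := psi_up hL i f1 hc
      have k1 : (i:ℝ) < (j+1) * L → EE L t (UU L t) = E := by
        intro hlt
        refine hEs (i+1) (by push_cast; linarith) ?_
        have : i < (j+1) * L := by exact_mod_cast hlt
        exact_mod_cast Int.add_one_le_iff.2 this
      have k2 : (i:ℝ) = (j+1) * L → EE L t (UU L t) = 0 := fun heq => hEE' (by linarith)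
      refine ⟨f1, hc, g1, g2, ?_, ?_, ?_, ?_⟩
      · rw [hp]; linarith [sS_nonneg (8 * (UU L t - KK L (t + 1/2))), show EE L t (UU L t) = sS (8 * (UU L t - KK L (t + 1/2))) from rfl]
      · rw [hp]
        rcases g2.lt_or_eq with g | g
        · rw [k1 g]
        · rw [k2 g]; linarith
      · intro g; rw [hp, k1 g]
      · intro g; rw [hp, k2 g]; ring
    · right
      have g1 : j * L ≤ (i:ℝ) := by
        have : ((j * L : ℤ) : ℝ) < ((i + 1 : ℤ) : ℝ) := by push_cast; linarith
        have := Int.cast_lt.1 this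
        exact_mod_cast Int.lt_add_one_iff.1 this
      have g2 : (i:ℝ) + 1 ≤ (j+1) * L := by
        have : ((i : ℤ) : ℝ) < (((j + 1) * L : ℤ) : ℝ) := by push_cast; linarith
        have := Int.cast_lt.1 this
        exact_mod_cast Int.add_one_le_iff.2 this
      refine ⟨hc, f2.le, g1, g2, ?_⟩
      rw [psi_dn hL i hc f2.le, hEs (i+1) (by push_cast; linarith) (by push_cast; linarith)]
  obtain ⟨i, hi⟩ := data θ rfl hb1 (h.trans hb2)
  obtain ⟨i', hi'⟩ := data θ' hU.symm (hb1.trans h) hb2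
  have cmp : ∀ a b : ℤ, a < b → (a:ℝ) + 1 ≤ b := fun a b hab => by exact_mod_cast Int.add_one_le_iff.2 hab
  rcases hi with ⟨u1, u2, u3, u4, u5, u6, u7, u8⟩ | ⟨d1, d2, d3, d4, d5⟩
  · rcases hi' with ⟨u1', u2', u3', u4', u5', u6', u7', u8'⟩ | ⟨d1', d2', d3', d4', d5'⟩
    · -- up up
      have hii : i ≤ i' := by
        by_contra hc
        push Not at hc
        have := cmp _ _ hc
        linarith
      rcases hii.lt_or_eq with hlt | heq
      · have hc := cmp _ _ hlt
        have hp := u7 (by linarith)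
        refine ⟨by linarith, by linarith, ?_, Or.inl (by linarith)⟩
        rcases u4'.lt_or_eq with g | g
        · have hp' := u7' g
          have : (i':ℝ) + 1 ≤ (j+1) * L := by
            have : i' < (j+1) * L := by exact_mod_cast g
            exact_mod_cast Int.add_one_le_iff.2 this
          linarith
        · rw [u8' g]; linarith
      · exfalso
        subst heq
        have hm := KK_mono hL (show θ + 1/4 ≤ θ' + 1/4 by linarith)
        have := cw_lt i (u := θ) (θ := θ') (by rw [abs_of_nonneg (by linarith), abs_of_nonneg (by linarith)]; linarith)
          (by rw [abs_of_nonneg (by linarith)]; linarith)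
        unfold UU at hU; linarith
    · -- up down
      have hii : i ≤ i' := by
        by_contra hc
        push Not at hc
        have := cmp _ _ hc
        have h3 : (i:ℝ) = i' + 1 := by
          linarith
        linarith
      rcases hii.lt_or_eq with hlt | heq
      · have hc := cmp _ _ hlt
        exact ⟨by linarith, by linarith, by linarith, Or.inl (by linarith)⟩
      · subst heq
        have hp := u7 (by linarith)
        refine ⟨by linarith, by linarith, by linarith, ?_⟩
        rcases le_or_gt (8 * (UU L θ - j)) (1/4) with hz | hz
        · left
          have : E ≤ sS (1/4) := sS_mono hz
          have h4 : e1 ≤ 1 - sS (1/4) := min_le_right _ _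
          have := e1_pos
          linarith
        · right
          have key : ∀ t : ℝ, UU L t = UU L θ → i ≤ t → t ≤ i + 1 → ∃ P : ℝ, 0 < P ∧
              TT L r t (UU L t) = Real.cos (Real.pi * j) * (P * (t - (i + 1/2))) := by
            intro t ht t1 t2
            have hKle : KK L (t + 1/4) ≤ j := by
              have := KK_mono hL (show t + 1/4 ≤ (j+1) * L + 15/32 by linarith)
              rwa [KK_val hL j (θ := (j+1) * L + 15/32) (by linarith) (by linarith)] at this
            have hcw : 1/4 < cw t := by
              rw [← ht] at hz; unfold UU at hz; linarith
            obtain ⟨m, hm⟩ := cw_zone_hi hcw.le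
            have hmi : m = i := by
              have hm' := abs_lt.1 hm
              have a1 : (m:ℝ) < ((i + 1 : ℤ) : ℝ) := by push_cast; linarith
              have a2 : (i:ℝ) < ((m + 1 : ℤ) : ℝ) := by push_cast; linarith
              have := Int.cast_lt.1 a1
              have := Int.cast_lt.1 a2
              omega
            subst hmi
            obtain ⟨P, hP, hT⟩ := TT_hi hL r m hcw hm
            have hm' := abs_lt.1 hm
            rw [KK_val hL j (θ := t + 1/4) (by linarith) (by linarith)] at hT
            exact ⟨P, hP, hT⟩
          obtain ⟨P, hP, hT⟩ := key θ rfl u1 (by linarith)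
          obtain ⟨P', hP', hT'⟩ := key θ' hU.symm (by linarith) d2'
          have hcs := cos_pi_int_sq j
          rw [hT, hT', ← mul_sub, ← mul_assoc, hcs, one_mul]
          rcases d1'.eq_or_lt with g | g
          · have : θ < i + 1/2 := by linarith
            have := mul_pos hP (sub_pos.2 this)
            rw [← g]; linarith
          · have := mul_pos hP' (sub_pos.2 g)
            have := mul_nonneg hP.le (sub_nonneg.2 u2)
            linarith
  · rcases hi' with ⟨u1', u2', u3', u4', u5', u6', u7', u8'⟩ | ⟨d1', d2', d3', d4', d5'⟩
    · -- down up
      have hii : i < i' := by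
        by_contra hc
        push Not at hc
        rcases hc.lt_or_eq with hc | hc
        · have := cmp _ _ hc
          linarith
        · rw [hc] at u2'; linarith
      have hc := cmp _ _ hii
      have top : psi L θ' (UU L θ') ≤ (j + 1) * L := by
        rcases u4'.lt_or_eq with g | g
        · have hp' := u7' g
          have : (i':ℝ) + 1 ≤ (j+1) * L := by
            have : i' < (j+1) * L := by exact_mod_cast g
            exact_mod_cast Int.add_one_le_iff.2 this
          linarith
        · rw [u8' g]; linarith
      refine ⟨by linarith, by linarith, top, ?_⟩
      by_cases hadj : i' = i + 1
      · rcases lt_or_ge (8 * (UU L θ - j)) (-1/4) with hz | hz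
        · right
          have hadj' : (i':ℝ) = i + 1 := by exact_mod_cast hadj
          have key : ∀ t : ℝ, UU L t = UU L θ → i + 1/2 ≤ t → t ≤ i + 3/2 → ∃ P : ℝ, 0 < P ∧
              TT L r t (UU L t) = Real.cos (Real.pi * j) * (P * (t - (i + 1))) := by
            intro t ht t1 t2
            have hKle : j ≤ KK L (t + 1/4) := by
              have := KK_mono hL (show j * L + 17/32 ≤ t + 1/4 by linarith)
              rwa [KK_val hL j (θ := j * L + 17/32) (by linarith) (by linarith)] at this
            have hcw : cw t < -1/4 := by
              rw [← ht] at hz; unfold UU at hz; linarith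
            obtain ⟨m, hm⟩ := cw_zone_lo hcw.le
            have hmi : m = i + 1 := by
              have hm' := abs_lt.1 hm
              have a1 : (m:ℝ) < ((i + 2 : ℤ) : ℝ) := by push_cast; linarith
              have a2 : (i:ℝ) < ((m : ℤ) : ℝ) := by push_cast; linarith
              have := Int.cast_lt.1 a1
              have := Int.cast_lt.1 a2
              omega
            subst hmi
            obtain ⟨P, hP, hT⟩ := TT_lo hL r (i+1) hcw hm
            have hm' := abs_lt.1 hm
            push_cast at hm' hT
            rw [KK_val hL j (θ := t + 1/4) (by linarith) (by linarith)] at hT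
            exact ⟨P, hP, hT⟩
          obtain ⟨P, hP, hT⟩ := key θ rfl d1 (by linarith)
          obtain ⟨P', hP', hT'⟩ := key θ' hU.symm (by linarith) (by linarith)
          have hcs := cos_pi_int_sq j
          rw [hT, hT', ← mul_sub, ← mul_assoc, hcs, one_mul]
          rcases d2.eq_or_lt with g | g
          · have : (i:ℝ) + 1 < θ' := by linarith
            have := mul_pos hP' (sub_pos.2 this)
            rw [g]; linarith
          · have := mul_pos hP (sub_pos.2 g)
            have := mul_nonneg hP'.le (sub_nonneg.2 (show (i:ℝ) + 1 ≤ θ' by linarith))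
            linarith
        · left
          have : sS (-1/4) ≤ E := sS_mono hz
          have h4 : e1 ≤ sS (-1/4) := min_le_left _ _
          linarith
      · left
        have : i + 1 < i' := by omega
        have := cmp _ _ this
        push_cast at this
        linarith
    · -- down down
      have hii : i ≤ i' := by
        by_contra hc
        push Not at hc
        have := cmp _ _ hc
        linarith
      rcases hii.lt_or_eq with hlt | heq
      · have hc := cmp _ _ hlt
        exact ⟨by linarith, by linarith, by linarith, Or.inl (by linarith)⟩
      · exfalso
        subst heq
        have hm : KK L (θ + 1/4) = KK L (θ' + 1/4) :=
          KK_const hL (i+1) (by rw [abs_le]; push_cast; constructor <;> linarith)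
            (by rw [abs_le]; push_cast; constructor <;> linarith)
        have := cw_lt (i+1) (u := θ') (θ := θ) (by push_cast; rw [abs_of_nonpos (by linarith), abs_of_nonpos (by linarith)]; linarith)
          (by push_cast; rw [abs_of_nonpos (by linarith)]; linarith)
        unfold UU at hU; linarith
end Sep1

section Bd
open Filter Topology Set
open scoped Nat
local notation "C∞" => ((⊤ : ℕ∞) : WithTop ℕ∞)

theorem fin_bound (r : ℕ) (f : ℕ → ℝ → ℝ) (h : ∀ i, 1 ≤ i → ∃ M, ∀ x, |f i x| ≤ M) :
    ∃ M : ℝ, 1 ≤ M ∧ ∀ i, 1 ≤ i → i ≤ r → ∀ x, |f i x| ≤ M := by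
  induction r with
  | zero => exact ⟨1, le_rfl, fun i h1 h2 => by omega⟩
  | succ r ih =>
    obtain ⟨M, hM, h1⟩ := ih
    obtain ⟨M', h2⟩ := h (r+1) (by omega)
    refine ⟨max M M', le_max_of_le_left hM, fun i hi hi' x => ?_⟩
    rcases Nat.lt_or_ge i (r+1) with hlt | hge
    · exact (h1 i hi (by omega) x).trans (le_max_left _ _)
    · obtain rfl : i = r + 1 := by omega
      exact (h2 x).trans (le_max_right _ _)

theorem per_deriv_bound {f : ℝ → ℝ} (hf : ContDiff ℝ C∞ f) (c : ℝ) (hp : ∀ x, f (x + 2) = f x + c) (r : ℕ) :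
    ∃ M : ℝ, 1 ≤ M ∧ ∀ i, 1 ≤ i → i ≤ r → ∀ x, |iteratedDeriv i f x| ≤ M := by
  refine fin_bound r (fun i x => iteratedDeriv i f x) fun i hi => ?_
  have hper : Function.Periodic (iteratedDeriv i f) 2 := by
    intro x
    have h1 := congrFun (iteratedDeriv_comp_add_const (n := i) (f := f) (s := 2)) x
    have h2 : (fun z => f (z + 2)) = fun z => c + f z := by funext z; rw [hp]; ring
    rw [h2, iteratedDeriv_const_add (by omega)] at h1
    exact h1.symm
  have hc : Continuous (iteratedDeriv i f) := hf.continuous_iteratedDeriv i (nat_le_smooth i)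
  obtain ⟨M, hM⟩ := (isCompact_Icc (a := (0:ℝ)) (b := 2)).exists_bound_of_continuousOn hc.continuousOn
  refine ⟨M, fun x => ?_⟩
  obtain ⟨y, hy, hxy⟩ := hper.exists_mem_Ico₀ (by norm_num) x
  rw [hxy]
  exact hM y ⟨hy.1, hy.2.le⟩

theorem sS_deriv_bound (r : ℕ) : ∃ M : ℝ, 1 ≤ M ∧ ∀ i, 1 ≤ i → i ≤ r → ∀ x, |iteratedDeriv i sS x| ≤ M := by
  refine fin_bound r (fun i x => iteratedDeriv i sS x) fun i hi => ?_
  have hc : Continuous (iteratedDeriv i sS) := sS_smooth.continuous_iteratedDeriv i (nat_le_smooth i)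
  obtain ⟨M, hM⟩ := (isCompact_Icc (a := (-1:ℝ)) (b := 1)).exists_bound_of_continuousOn hc.continuousOn
  refine ⟨max M 0, fun x => ?_⟩
  by_cases hx : x ∈ Icc (-1:ℝ) 1
  · exact (hM x hx).trans (le_max_left _ _)
  · have hz : ∀ a : ℝ, sS =ᶠ[𝓝 x] (fun _ => a) → iteratedDeriv i sS x = 0 := by
      intro a ha
      rw [ha.iteratedDeriv_eq, iteratedDeriv_const, if_neg (by omega)]
    have : iteratedDeriv i sS x = 0 := by
      rw [mem_Icc, not_and_or] at hx
      push Not at hx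
      rcases hx with h | h
      · refine hz 0 ?_
        filter_upwards [gt_mem_nhds h] with y hy
        exact sS_zero (by linarith)
      · refine hz 1 ?_
        filter_upwards [lt_mem_nhds h] with y hy
        exact sS_one (by linarith)
    simp [this]

theorem aff_deriv {g : ℝ → ℝ} (hg : ContDiff ℝ C∞ g) (s c : ℝ) (i : ℕ) (x : ℝ) :
    iteratedDeriv i (fun y => g (s * y + c)) x = s ^ i * iteratedDeriv i g (s * x + c) := by
  have h1 := congrFun (iteratedDeriv_comp_const_mul (n := i) (f := fun z => g (z + c))
    ((comp1 hg (by fun_prop)).of_le (nat_le_smooth i)) s) x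
  rw [h1, iteratedDeriv_comp_add_const]

/-- composition bound, orders `1 ≤ b ≤ r` only -/
theorem comp_small {E : Type} [NormedAddCommGroup E] [NormedSpace ℝ E] {g : ℝ → ℝ} {f : E → ℝ}
    (hg : ContDiff ℝ C∞ g) (hf : ContDiff ℝ C∞ f) (x : E) (r : ℕ) {C D : ℝ} (hC0 : 0 ≤ C) (hD1 : 1 ≤ D)
    (hC : ∀ i, 1 ≤ i → i ≤ r → |iteratedDeriv i g (f x)| ≤ C)
    (hD : ∀ i, 1 ≤ i → i ≤ r → ‖iteratedFDeriv ℝ i f x‖ ≤ D) (b : ℕ) (hb : 1 ≤ b) (hbr : b ≤ r) :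
    ‖iteratedFDeriv ℝ b (fun y => g (f y)) x‖ ≤ r ! * C * D ^ r := by
  have h1 : iteratedFDeriv ℝ b (fun y => g (f y)) x = iteratedFDeriv ℝ b ((fun z => g z - g (f x)) ∘ f) x := by
    have : ((fun z => g z - g (f x)) ∘ f) = fun y => g (f y) + -g (f x) := by
      funext y; simp [sub_eq_add_neg]
    have hgf : ContDiff ℝ C∞ (fun y => g (f y)) := hg.comp hf
    rw [this]
    have h2 := iteratedFDeriv_add_apply (𝕜 := ℝ) (i := b) (x := x) (f := fun y => g (f y)) (g := fun _ => -g (f x))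
      ((hgf.of_le (nat_le_smooth b)).contDiffAt) contDiffAt_const
    have h3 : (fun y => g (f y) + -g (f x)) = (fun y => g (f y)) + fun _ => -g (f x) := rfl
    rw [h3, h2, iteratedFDeriv_const_of_ne (by omega)]
    simp
  rw [h1]
  have h := norm_iteratedFDeriv_comp_le (𝕜 := ℝ) (g := fun z => g z - g (f x)) (f := f) (n := b)
    (hg.sub contDiff_const) hf (nat_le_smooth b) x (C := C) (D := D) ?_ ?_
  · refine h.trans ?_
    have : (b ! : ℝ) ≤ r ! := by exact_mod_cast Nat.factorial_le hbr
    have : D ^ b ≤ D ^ r := pow_le_pow_right₀ hD1 hbr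
    gcongr
  · intro i hi
    rcases Nat.eq_zero_or_pos i with rfl | hpos
    · simpa using hC0
    · rw [norm_iteratedFDeriv_eq_norm_iteratedDeriv]
      have : (fun z => g z - g (f x)) = fun z => -g (f x) + g z := by funext z; ring
      rw [this, iteratedDeriv_const_add hpos]
      exact hC i hpos (by omega)
  · intro i hi hi'
    exact (hD i hi (by omega)).trans (le_self_pow₀ hD1 (by omega))

/-- The shape used in one variable. -/
theorem shape1 {g : ℝ → ℝ} (hg : ContDiff ℝ C∞ g) {r : ℕ} {B M : ℝ} (hB0 : 1 ≤ B) (hM1 : 1 ≤ M)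
    (hB : ∀ i, 1 ≤ i → i ≤ r → ∀ x, |iteratedDeriv i g x| ≤ B)
    (hM : ∀ i, 1 ≤ i → i ≤ r → ∀ x, |iteratedDeriv i sS x| ≤ M)
    (c s l u : ℝ) (hs : |s| ≤ 1) (hl : 1 ≤ l) (y : ℝ) (b : ℕ) (hb : 1 ≤ b) (hbr : b ≤ r) :
    ‖iteratedFDeriv ℝ b (fun y => g (s * sS (l * y + u) + c)) y‖ ≤ r ! * (|s| * B) * (l ^ r * M) ^ r := by
  have hf : ContDiff ℝ C∞ (fun y : ℝ => sS (l * y + u)) := comp1 sS_smooth (by fun_prop)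
  have hg' : ContDiff ℝ C∞ (fun z : ℝ => g (s * z + c)) := comp1 hg (by fun_prop)
  refine comp_small hg' hf y r (by positivity) ?_ ?_ ?_ b hb hbr
  · have := one_le_pow₀ (n := r) hl
    nlinarith
  · intro i hi hir
    rw [aff_deriv hg, abs_mul, abs_pow]
    gcongr
    · exact pow_le_of_le_one (abs_nonneg _) hs (by omega)
    · exact hB i hi hir _
  · intro i hi hir
    rw [norm_iteratedFDeriv_eq_norm_iteratedDeriv, aff_deriv sS_smooth, norm_mul, norm_pow,
      Real.norm_of_nonneg (by linarith : (0:ℝ) ≤ l)]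
    gcongr
    · exact hM i hi hir _

end Bd

section LemA
open Filter Topology Set
open scoped Nat
local notation "C∞" => ((⊤ : ℕ∞) : WithTop ℕ∞)

def gG (x : ℝ) : ℝ := x - Real.sin (2 * Real.pi * x) / (2 * Real.pi)
def gH (x : ℝ) : ℝ := - Real.cos (Real.pi * x)

theorem gG_smooth : ContDiff ℝ C∞ gG := by unfold gG; fun_prop
theorem gH_smooth : ContDiff ℝ C∞ gH := by unfold gH; fun_prop

theorem gG_shift (N : ℤ) (x : ℝ) : gG (x + N) = gG x + N := by
  unfold gG
  rw [show 2 * Real.pi * (x + N) = 2 * Real.pi * x + N * (2 * Real.pi) by ring, Real.sin_add_int_mul_two_pi]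
  ring
theorem gH_shift (N : ℤ) (x : ℝ) : gH (x + (2 * N : ℤ)) = gH x := by
  unfold gH
  push_cast
  rw [show Real.pi * (x + 2 * N) = Real.pi * x + N * (2 * Real.pi) by ring, Real.cos_add_int_mul_two_pi]

theorem gG_hasDeriv (x : ℝ) : HasDerivAt gG (2 * Real.sin (Real.pi * x) ^ 2) x := by
  unfold gG
  have h := (hasDerivAt_id x).sub ((((hasDerivAt_id x).const_mul (2 * Real.pi)).sin).div_const (2 * Real.pi))
  refine h.congr_deriv ?_
  have hpi := Real.pi_pos
  simp only [id, mul_one]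
  rw [mul_div_cancel_right₀ _ (by positivity), mul_assoc, Real.cos_two_mul, Real.cos_sq']
  ring
theorem gH_hasDeriv (x : ℝ) : HasDerivAt gH (Real.pi * Real.sin (Real.pi * x)) x := by
  unfold gH
  have h := (((hasDerivAt_id x).const_mul (Real.pi)).cos).neg
  refine h.congr_deriv ?_
  simp only [id]; ring

theorem gG_mono : Monotone gG :=
  monotone_of_deriv_nonneg (fun x => (gG_hasDeriv x).differentiableAt)
    (fun x => by rw [(gG_hasDeriv x).deriv]; positivity)

theorem gG_near (x : ℝ) : |gG x - x| ≤ 1 := by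
  unfold gG
  have hpi := Real.pi_gt_three
  rw [show x - Real.sin (2 * Real.pi * x) / (2 * Real.pi) - x = -(Real.sin (2 * Real.pi * x) / (2 * Real.pi)) by ring,
    abs_neg, abs_div, div_le_one (by positivity), abs_of_pos (by positivity : 0 < 2 * Real.pi)]
  linarith [Real.abs_sin_le_one (2 * Real.pi * x)]

theorem gG_strict {d : ℝ} (hd : 0 < d) : ∃ c : ℝ, 0 < c ∧ ∀ x x', d ≤ x' - x → c ≤ gG x' - gG x := by
  have hpi := Real.pi_pos
  refine ⟨d - |Real.sin (Real.pi * d)| / Real.pi, ?_, fun x x' h => ?_⟩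
  · rw [sub_pos, div_lt_iff₀ hpi, mul_comm d]
    rw [abs_lt]
    have hp : 0 < Real.pi * d := by positivity
    constructor
    · have h2 := Real.lt_sin (x := -(Real.pi * d)) (by linarith)
      rw [Real.sin_neg] at h2
      have := Real.sin_le_one (Real.pi * d)
      have h3 := Real.sin_lt hp
      by_contra hc
      push Not at hc
      have := Real.neg_one_le_sin (Real.pi * d)
      have := Real.sin_pos_of_pos_of_lt_pi hp (by linarith [Real.pi_gt_three])
      linarith
    · exact Real.sin_lt hp
  · have h1 : gG (x + d) ≤ gG x' := gG_mono (by linarith)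
    have h2 : d - |Real.sin (Real.pi * d)| / Real.pi ≤ gG (x + d) - gG x := by
      unfold gG
      have h3 : Real.sin (2 * Real.pi * (x + d)) - Real.sin (2 * Real.pi * x) =
          2 * Real.sin (Real.pi * d) * Real.cos (2 * Real.pi * x + Real.pi * d) := by
        rw [Real.sin_sub_sin]; congr 2 <;> ring_nf
      have h4 : Real.sin (Real.pi * d) * Real.cos (2 * Real.pi * x + Real.pi * d) ≤ |Real.sin (Real.pi * d)| := by
        refine (le_abs_self _).trans ?_
        rw [abs_mul]
        exact mul_le_of_le_one_right (abs_nonneg _) (Real.abs_cos_le_one _)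
      have h5 : (Real.sin (2 * Real.pi * (x + d)) - Real.sin (2 * Real.pi * x)) / (2 * Real.pi) ≤
          |Real.sin (Real.pi * d)| / Real.pi := by
        rw [div_le_div_iff₀ (by positivity) hpi, h3]; nlinarith
      rw [sub_div] at h5
      linarith
    linarith

theorem gGH (j : ℤ) {x x' : ℝ} (h1 : (j:ℝ) ≤ x) (h : x ≤ x') (h2 : x' ≤ j + 1) :
    gG x' - gG x ≤ Real.cos (Real.pi * j) * (gH x' - gH x) := by
  have hm : MonotoneOn (fun z => Real.cos (Real.pi * j) * gH z - gG z) (Icc (j:ℝ) (j+1)) := by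
    have hd : ∀ z : ℝ, HasDerivAt (fun z => Real.cos (Real.pi * j) * gH z - gG z)
      (Real.cos (Real.pi * j) * (Real.pi * Real.sin (Real.pi * z)) - 2 * Real.sin (Real.pi * z) ^ 2) z :=
      fun z => ((gH_hasDeriv z).const_mul _).sub (gG_hasDeriv z)
    refine monotoneOn_of_deriv_nonneg (convex_Icc _ _) (fun z _ => (hd z).continuousAt.continuousWithinAt)
      (fun z _ => (hd z).differentiableAt.differentiableWithinAt) fun z hz => ?_
    rw [(hd z).deriv]
    rw [interior_Icc] at hz
    have hpi := Real.pi_gt_three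
    have hs : Real.sin (Real.pi * z) = Real.cos (Real.pi * j) * Real.sin (Real.pi * (z - j)) := by
      have hsj : Real.sin (Real.pi * j) = 0 := by rw [mul_comm]; exact Real.sin_int_mul_pi j
      rw [show Real.pi * z = Real.pi * (z - j) + Real.pi * j by ring, Real.sin_add, hsj]; ring
    have hc := cos_pi_int_sq j
    have h0 : 0 ≤ Real.sin (Real.pi * (z - j)) := Real.sin_nonneg_of_nonneg_of_le_pi
      (by have := hz.1; nlinarith) (by have := hz.2; nlinarith)
    have h1 := Real.sin_le_one (Real.pi * (z - j))
    rw [hs]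
    set a := Real.cos (Real.pi * j)
    set s := Real.sin (Real.pi * (z - j))
    have : a * (Real.pi * (a * s)) - 2 * (a * s)^2 = (a*a) * (s * (Real.pi - 2 * s)) := by ring
    rw [this, hc]
    have : 0 ≤ Real.pi - 2 * s := by linarith
    positivity
  have := hm (show x ∈ Icc (j:ℝ) (j+1) from ⟨h1, by linarith⟩) ⟨by linarith, h2⟩ h
  simp only at this
  linarith

theorem psi_form (L : ℕ) (θ y : ℝ) : psi L θ y =
    (JJ (θ - 1/2) + 1/2 - JJ θ) * sS (8 * y + -8 * KK L (θ + 1/2)) + JJ θ := by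
  unfold psi EE
  rw [show 8 * (y - KK L (θ + 1/2)) = 8 * y + -8 * KK L (θ + 1/2) by ring]
  ring

theorem psi_amp (θ : ℝ) : |JJ (θ - 1/2) + 1/2 - JJ θ| ≤ 6 := by
  have h1 := abs_le.1 (JJ_bound θ)
  have h2 := abs_le.1 (JJ_bound (θ - 1/2))
  rw [abs_le]; constructor <;> linarith [h1.1, h1.2, h2.1, h2.2]

theorem psi_near (L : ℕ) (θ y : ℝ) : |psi L θ y - θ| ≤ 3 := by
  have h1 := abs_le.1 (JJ_bound θ)
  have h2 := abs_le.1 (JJ_bound (θ - 1/2))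
  have h3 : 0 ≤ EE L θ y := sS_nonneg _
  have h4 : EE L θ y ≤ 1 := sS_le _
  unfold psi
  rw [abs_le]; constructor <;> nlinarith [h1.1, h1.2, h2.1, h2.2]

theorem UU_near {L : ℕ} (hL : 1 ≤ L) (θ : ℝ) : |UU L θ - θ / L| ≤ 3 := by
  have h1 := abs_le.1 (KK_bound hL (θ + 1/4))
  have hL' : (1:ℝ) ≤ L := by exact_mod_cast hL
  have h2 : (θ + 1/4) / L = θ / L + 1/4/L := add_div _ _ _
  have h3 : (1/4 : ℝ) / L ≤ 1/4 := div_le_self (by norm_num) hL'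
  have h4 : 0 ≤ (1/4 : ℝ) / L := by positivity
  have := cw_le θ
  have := le_cw θ
  unfold UU
  rw [h2] at h1
  rw [abs_le]; constructor <;> linarith [h1.1, h1.2]

theorem rh_ne {L : ℕ} (hL : 1 ≤ L) (r : ℕ) {θ : ℝ} (h : deriv (UU L) θ = 0) : rh L r θ (UU L θ) ≠ 0 := by
  obtain ⟨i, rfl⟩ := UU_deriv_zero hL h
  have hcos : ∀ N : ℤ, Real.cos (Real.pi * N) ≠ 0 := fun N h0 => by
    have := cos_pi_int_sq N
    rw [h0] at this; norm_num at this
  unfold rh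
  rcases Int.even_or_odd' i with ⟨a, rfl | rfl⟩
  · rw [show ((2 * a : ℤ) : ℝ) / 2 = a by push_cast; ring]
    have hcw : cw a = -1 := by have := cw_shift a 0; simp only [zero_add] at this; rw [this]; simp [cw]
    obtain ⟨N, hN⟩ := KK_flat hL a
    have e1 : KK L (a + 1/4) = N := hN _ (by norm_num)
    have e2 : KK L a = N := hN _ (by norm_num)
    have hz : 8 * (UU L a - KK L a) = cw a := by unfold UU; rw [e1, e2]; ring
    rw [cR_zero (by linarith [graph_hi hL a]), hz, hcw, e1]
    have := cL_pos (show (-1:ℝ) < -1/4 by norm_num)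
    refine mul_ne_zero (hcos N) ?_
    rw [zero_add]
    exact mul_ne_zero (pow_ne_zero _ (by norm_num)) this.ne'
  · rw [show ((2 * a + 1 : ℤ) : ℝ) / 2 = a + 1/2 by push_cast; ring]
    have hcw : cw (a + 1/2) = 1 := by
      rw [cw_half]
      have := cw_shift a 0; simp only [zero_add] at this; rw [this]; simp [cw]
    obtain ⟨N, hN⟩ := KK_flat hL (a + 1)
    have e1 : KK L (a + 1/2 + 1/4) = N := hN _ (by rw [abs_le]; push_cast; constructor <;> linarith)
    have e2 : KK L (a + 1/2 + 1/2) = N := hN _ (by rw [abs_le]; push_cast; constructor <;> linarith)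
    have hz : 8 * (UU L (a + 1/2) - KK L (a + 1/2 + 1/2)) = cw (a+1/2) := by unfold UU; rw [e1, e2]; ring
    rw [cL_zero (by linarith [graph_lo hL (a + 1/2)]), hz, hcw, e1]
    have := cR_pos (show (1/4:ℝ) < 1 by norm_num)
    refine mul_ne_zero (hcos N) ?_
    rw [mul_zero, add_zero]
    exact this.ne'

end LemA

section LemA2
open Filter Topology Set
open scoped Nat
local notation "C∞" => ((⊤ : ℕ∞) : WithTop ℕ∞)

/-- One-dimensional wrinkling data. -/
structure OneD (r : ℕ) (C ν : ℝ) where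
  U : ℝ → ℝ
  G : ℝ → ℝ → ℝ
  Lam : ℝ → ℝ → ℝ
  T : ℝ → ℝ → ℝ
  rho : ℝ → ℝ → ℝ
  U_smooth : ContDiff ℝ C∞ U
  G_smooth : ContDiff ℝ C∞ (fun z : ℝ × ℝ => G z.1 z.2)
  Lam_smooth : ContDiff ℝ C∞ (fun z : ℝ × ℝ => Lam z.1 z.2)
  T_smooth : ContDiff ℝ C∞ (fun z : ℝ × ℝ => T z.1 z.2)
  rho_smooth : ∀ t, ContDiff ℝ C∞ (rho t)
  U_shift : ∀ (N : ℤ) t, U (t + N) = U t + N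
  G_shift : ∀ (N : ℤ) t y, G (t + N) (y + N) = G t y + N
  Lam_shift : ∀ (N : ℤ) t y, Lam (t + N) (y + N) = Lam t y
  T_shift : ∀ (N : ℤ) t y, T (t + N) (y + N) = T t y
  U_near : ∀ t, |U t - t| ≤ ν
  U_count : {t | deriv U t = 0}.Countable
  H : ∀ t, ∀ᶠ y in 𝓝 (U t), HasDerivAt (fun s => G s y) 0 t ∧ HasDerivAt (fun s => Lam s y) 0 t ∧
    HasDerivAt (fun s => T s y) (rho t y * (U t - y) ^ r) t
  G_near : ∀ t y, |G t y - t| ≤ ν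
  G_jet : ∀ t y b, 1 ≤ b → b ≤ r → ‖iteratedFDeriv ℝ b (G t) y‖ ≤ ν
  Lam_near : ∀ t y, |Lam t y| ≤ ν
  Lam_jet : ∀ t y b, 1 ≤ b → b ≤ r → ‖iteratedFDeriv ℝ b (Lam t) y‖ ≤ ν
  rho_ne : ∀ t, deriv U t = 0 → rho t (U t) ≠ 0
  sep : ∃ η0 : ℝ, 0 < η0 ∧ ∀ η, 0 < η → η < η0 → ∀ t t', t ≠ t' → U t = U t' →
    C * |G t' (U t) - G t (U t)| < |Lam t' (U t) - Lam t (U t) + η * (T t' (U t) - T t (U t))|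

theorem sep_real {L m : ℕ} (hL : 1 ≤ L) (hm : 1 ≤ m) (r : ℕ) {C : ℝ} (hC : 0 ≤ C) :
    ∃ η0 : ℝ, 0 < η0 ∧ ∀ η, 0 < η → η < η0 → ∀ θ θ' : ℝ, θ < θ' → UU L θ = UU L θ' →
    C * |gG (psi L θ' (UU L θ') / L) / (2 * m) - gG (psi L θ (UU L θ) / L) / (2 * m)| <
     |(C+1) / (2*m) * gH (psi L θ' (UU L θ') / L) - (C+1)/(2*m) * gH (psi L θ (UU L θ) / L) +
       η * (TT L r θ' (UU L θ') - TT L r θ (UU L θ))| := by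
  have hL' : (1:ℝ) ≤ L := by exact_mod_cast hL
  have hm' : (1:ℝ) ≤ m := by exact_mod_cast hm
  obtain ⟨c0, hc0, hstrict⟩ := gG_strict (d := e1 / 2 / L) (by have := e1_pos; positivity)
  -- bound of T on the graph
  have hcont : Continuous (fun θ => TT L r θ (UU L θ)) :=
    (comp2 (TT_smooth hL r) contDiff_id (UU_smooth hL)).continuous
  have hper : Function.Periodic (fun θ => TT L r θ (UU L θ)) (2 * L) := by
    intro θ
    have h1 := UU_shift hL 2 θ
    have h2 := TT_shift hL r 1 θ (UU L θ)
    push_cast at h1 h2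
    simp only
    rw [h1]; convert h2 using 2 <;> ring
  obtain ⟨M, hM⟩ := (isCompact_Icc (a := (0:ℝ)) (b := 2 * L)).exists_bound_of_continuousOn hcont.continuousOn
  have hM' : ∀ θ, |TT L r θ (UU L θ)| ≤ M := by
    intro θ
    obtain ⟨y, hy, hxy⟩ := hper.exists_mem_Ico₀ (by positivity) θ
    rw [hxy]
    exact hM y ⟨hy.1, hy.2.le⟩
  have hM0 : 0 ≤ M := (abs_nonneg _).trans (hM' 0)
  refine ⟨c0 / (2 * m) / (2 * M + 1), by positivity, fun η hη hη' θ θ' h hU => ?_⟩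
  obtain ⟨j, hj1, hj2, hj3, hj4⟩ := sep_main hL r h hU
  set p := psi L θ (UU L θ)
  set p' := psi L θ' (UU L θ')
  have h1 : (j:ℝ) ≤ p / L := by rw [le_div_iff₀ (by linarith)]; exact hj1
  have h2 : p / L ≤ p' / L := by gcongr
  have h3 : p' / L ≤ j + 1 := by rw [div_le_iff₀ (by linarith)]; exact hj3
  have hGH := gGH j h1 h2 h3
  have hG : 0 ≤ gG (p' / L) - gG (p / L) := by linarith [gG_mono h2]
  set a := gG (p' / L) - gG (p / L) with ha
  set b := gH (p' / L) - gH (p / L) with hb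
  have t1 := abs_le.1 (hM' θ)
  have t2 := abs_le.1 (hM' θ')
  set τ := TT L r θ' (UU L θ') - TT L r θ (UU L θ) with hτ
  set e := Real.cos (Real.pi * j) with he
  have hee : e * e = 1 := cos_pi_int_sq j
  have hτb : |e * τ| ≤ 2 * M := by
    rw [abs_mul]
    have : |e| ≤ 1 := Real.abs_cos_le_one _
    have : |τ| ≤ 2 * M := by rw [abs_le]; constructor <;> linarith [t1.1, t1.2, t2.1, t2.2]
    nlinarith [abs_nonneg e, abs_nonneg τ]
  rw [show gG (p' / L) / (2 * m) - gG (p / L) / (2 * m) = a / (2 * m) by rw [ha]; ring,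
    show (C+1) / (2*m) * gH (p' / L) - (C+1)/(2*m) * gH (p / L) = (C+1) / (2*m) * b by rw [hb]; ring,
    abs_of_nonneg (by positivity)]
  have key : C * (a / (2 * m)) < e * ((C+1) / (2*m) * b + η * τ) := by
    have k1 : (C+1) / (2*m) * a ≤ (C+1) / (2*m) * (e * b) := by gcongr
    have k2 : e * ((C+1) / (2*m) * b + η * τ) = (C+1) / (2*m) * (e * b) + η * (e * τ) := by ring
    have k3 : (C+1) / (2*m) * a = C * (a / (2 * m)) + a / (2*m) := by ring
    suffices 0 < a / (2*m) + η * (e * τ) by linarith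
    rcases hj4 with hh | hh
    · have k4 := hstrict (p / L) (p' / L) (by rw [← sub_div]; gcongr)
      have k5 : c0 / (2*m) ≤ a / (2*m) := by gcongr
      have k6 : η * (2 * M + 1) < c0 / (2*m) := by rwa [lt_div_iff₀ (by positivity)] at hη'
      have k7 := (abs_le.1 hτb).1
      nlinarith
    · have : 0 ≤ a / (2*m) := by positivity
      have : 0 < η * (e * τ) := mul_pos hη hh
      linarith
  refine key.trans_le ((le_abs_self _).trans ?_)
  rw [abs_mul]
  exact mul_le_of_le_one_left (abs_nonneg _) (Real.abs_cos_le_one _)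

theorem exists_OneD (r : ℕ) {C ν : ℝ} (hC : 0 ≤ C) (hν : 0 < ν) : Nonempty (OneD r C ν) := by
  obtain ⟨m0, hm0⟩ := exists_nat_gt ((C + 4) / ν)
  set m := m0 + 1 with hmdef
  have hm : 1 ≤ m := by omega
  have hm' : (1:ℝ) ≤ m := by exact_mod_cast hm
  have hmC : (C + 4) / m ≤ ν := by
    rw [div_lt_iff₀ hν] at hm0
    rw [div_le_iff₀ (by positivity)]
    have : (m0:ℝ) ≤ m := by rw [hmdef]; push_cast; linarith
    nlinarith
  have hb1 : (C+1) / (2 * m) ≤ ν := by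
    refine le_trans ?_ hmC
    rw [div_le_div_iff₀ (by positivity) (by positivity)]; nlinarith
  have hb4 : 4 / (2 * (m:ℝ)) ≤ ν := by
    refine le_trans ?_ hmC
    rw [div_le_div_iff₀ (by positivity) (by positivity)]; nlinarith
  have g1s : ContDiff ℝ C∞ (fun x => gG x / (2 * m)) := gG_smooth.div_const _
  have g2s : ContDiff ℝ C∞ (fun x => (C+1) / (2*m) * gH x) := contDiff_const.mul gH_smooth
  obtain ⟨B1, hB1, hB1'⟩ := per_deriv_bound g1s (2 / (2 * m)) (fun x => by
    have := gG_shift 2 x; push_cast at this; rw [this]; ring) r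
  obtain ⟨B2, hB2, hB2'⟩ := per_deriv_bound g2s 0 (fun x => by
    have := gH_shift 1 x; push_cast at this; norm_num at this; rw [this]; ring) r
  obtain ⟨M, hM, hM'⟩ := sS_deriv_bound r
  obtain ⟨L0, hL0⟩ := exists_nat_gt (r ! * (6 * (B1 + B2)) * ((16 * m) ^ r * M) ^ r / ν)
  set L := L0 + 6 with hLdef
  have hL : 1 ≤ L := by omega
  have hL6 : (6:ℝ) ≤ L := by rw [hLdef]; push_cast; linarith [Nat.cast_nonneg (α := ℝ) L0]
  have hLb : r ! * (6 / L * (B1 + B2)) * ((16 * m) ^ r * M) ^ r ≤ ν := by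
    rw [div_lt_iff₀ hν] at hL0
    have : (L0:ℝ) ≤ L := by rw [hLdef]; push_cast; linarith
    have e : r ! * (6 / L * (B1 + B2)) * ((16 * m) ^ r * M) ^ r =
      r ! * (6 * (B1 + B2)) * ((16 * m) ^ r * M) ^ r / L := by ring
    rw [e, div_le_iff₀ (by positivity)]
    nlinarith
  -- small jets
  have jet : ∀ (g : ℝ → ℝ) (hg : ContDiff ℝ C∞ g) (B : ℝ) (hB1 : 1 ≤ B) (hBB : B ≤ B1 + B2)
      (hB : ∀ i, 1 ≤ i → i ≤ r → ∀ x, |iteratedDeriv i g x| ≤ B) (t y : ℝ) (b : ℕ), 1 ≤ b → b ≤ r →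
      ‖iteratedFDeriv ℝ b (fun y => g (psi L (2 * m * L * t) (2 * m * y) / L)) y‖ ≤ ν := by
    intro g hg B hBone hBB hB t y b hb hbr
    set θ := 2 * m * L * t
    have e : (fun y => g (psi L θ (2 * m * y) / L)) = fun y =>
      g ((JJ (θ - 1/2) + 1/2 - JJ θ) / L * sS ((16 * m) * y + -8 * KK L (θ + 1/2)) + JJ θ / L) := by
      funext y
      rw [psi_form, show 8 * (2 * (m:ℝ) * y) = 16 * m * y by ring]
      congr 1; ring
    have hs : |(JJ (θ - 1/2) + 1/2 - JJ θ) / L| ≤ 6 / L := by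
      rw [abs_div, abs_of_pos (by linarith : (0:ℝ) < L)]
      gcongr
      exact psi_amp θ
    have hs1 : 6 / (L:ℝ) ≤ 1 := by rw [div_le_one (by linarith)]; exact hL6
    rw [e]
    refine (shape1 hg hBone hM hB hM' _ _ _ _ (hs.trans hs1) (by linarith) y b hb hbr).trans ?_
    refine le_trans ?_ hLb
    gcongr
  have psis : ContDiff ℝ C∞ (fun z : ℝ × ℝ => psi L (2 * m * L * z.1) (2 * m * z.2) / L) :=
    (comp2 (psi_smooth hL) (by fun_prop) (by fun_prop)).div_const _
  have shiftθ : ∀ (N : ℤ) (t : ℝ), 2 * m * L * (t + N) = 2 * m * L * t + ((2 * (m * N) : ℤ) : ℝ) * L := by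
    intro N t; push_cast; ring
  have shifty : ∀ (N : ℤ) (t : ℝ), 2 * m * (t + N) = 2 * m * t + ((2 * (m * N) : ℤ) : ℝ) := by
    intro N t; push_cast; ring
  have hLne : (L:ℝ) ≠ 0 := by positivity
  have hmne : (m:ℝ) ≠ 0 := by positivity
  have psish : ∀ (N : ℤ) (t y : ℝ), psi L (2 * m * L * (t + N)) (2 * m * (y + N)) / L =
      psi L (2 * m * L * t) (2 * m * y) / L + ((2 * (m * N) : ℤ) : ℝ) := by
    intro N t y
    rw [shiftθ, shifty, psi_shift hL]
    field_simp
  have hgraph : ∀ t, 2 * m * (UU L (2 * m * L * t) / (2 * m)) = UU L (2 * m * L * t) := by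
    intro t; field_simp
  have hUd : ∀ t, HasDerivAt (fun t => UU L (2 * m * L * t) / (2 * m)) (L * deriv (UU L) (2 * m * L * t)) t := by
    intro t
    have h1 : HasDerivAt (UU L) (deriv (UU L) (2 * m * L * t)) (2 * m * L * t) :=
      ((smooth_diff (UU_smooth hL)) _).hasDerivAt
    have h2 := (h1.scomp t ((hasDerivAt_id t).const_mul (2 * (m:ℝ) * L))).div_const (2 * m)
    refine h2.congr_deriv ?_
    simp only [smul_eq_mul, mul_one]; field_simp
  have hUz : ∀ t, deriv (fun t => UU L (2 * m * L * t) / (2 * m)) t = 0 → deriv (UU L) (2 * m * L * t) = 0 := by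
    intro t ht
    rw [(hUd t).deriv] at ht
    exact (mul_eq_zero.1 ht).resolve_left hLne
  refine ⟨{ U := fun t => UU L (2 * m * L * t) / (2 * m)
            G := fun t y => gG (psi L (2 * m * L * t) (2 * m * y) / L) / (2 * m)
            Lam := fun t y => (C+1) / (2*m) * gH (psi L (2 * m * L * t) (2 * m * y) / L)
            T := fun t y => TT L r (2 * m * L * t) (2 * m * y)
            rho := fun t y => rh L r (2 * m * L * t) (2 * m * y) * ((2 * m) ^ r * (2 * m * L))
            U_smooth := (comp1 (UU_smooth hL) (by fun_prop)).div_const _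
            G_smooth := comp1 (F := fun x => gG x / (2 * m)) g1s psis
            Lam_smooth := comp1 (F := fun x => (C+1) / (2*m) * gH x) g2s psis
            T_smooth := comp2 (TT_smooth hL r) (by fun_prop) (by fun_prop)
            rho_smooth := ?_, U_shift := ?_, G_shift := ?_, Lam_shift := ?_, T_shift := ?_, U_near := ?_
            U_count := ?_, H := ?_, G_near := ?_
            G_jet := fun t y b hb hbr => jet _ g1s B1 hB1 (by linarith) hB1' t y b hb hbr
            Lam_near := ?_
            Lam_jet := fun t y b hb hbr => jet _ g2s B2 hB2 (by linarith) hB2' t y b hb hbr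
            rho_ne := ?_, sep := ?_ }⟩
  · intro t
    unfold rh
    have h1 : ContDiff ℝ C∞ (fun y : ℝ => cR (8 * (2 * m * y - KK L (2 * m * L * t + 1/2)))) :=
      comp1 cR_smooth (by fun_prop)
    have h2 : ContDiff ℝ C∞ (fun y : ℝ => cL (8 * (2 * m * y - KK L (2 * m * L * t)))) :=
      comp1 cL_smooth (by fun_prop)
    fun_prop
  · intro N t
    rw [shiftθ, UU_shift hL]; push_cast; field_simp
  · intro N t y
    rw [psish, gG_shift]; push_cast; field_simp
  · intro N t y
    rw [psish, gH_shift]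
  · intro N t y
    rw [shiftθ, shifty]; exact TT_shift hL r _ _ _
  · intro t
    have h := UU_near hL (2 * m * L * t)
    rw [show 2 * m * L * t / L = 2 * m * t by field_simp] at h
    rw [show UU L (2 * m * L * t) / (2 * m) - t = (UU L (2 * m * L * t) - 2 * m * t) / (2 * m) by field_simp, abs_div,
      abs_of_pos (by positivity : (0:ℝ) < 2 * m)]
    refine le_trans ?_ hb4
    gcongr; linarith
  · refine (Set.countable_range (fun i : ℤ => (i : ℝ) / (4 * m * L))).mono ?_
    intro t ht
    obtain ⟨i, hi⟩ := UU_deriv_zero hL (hUz t ht)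
    refine ⟨i, ?_⟩
    simp only
    field_simp
    linarith
  · intro t
    have hy : Tendsto (fun z : ℝ × ℝ => (2 * m * L * z.1, 2 * m * z.2)) (𝓝 (t, UU L (2 * m * L * t) / (2 * m)))
        (𝓝 (2 * m * L * t, UU L (2 * m * L * t))) := by
      have : Continuous (fun z : ℝ × ℝ => (2 * m * L * z.1, 2 * m * z.2)) := by fun_prop
      have h2 := this.tendsto (t, UU L (2 * m * L * t) / (2 * m))
      simp only [hgraph] at h2
      exact h2
    have e1 := (hy.eventually (psi_loc hL (2 * m * L * t))).curry_nhds
    have e2 := (hy.eventually (TT_loc hL r (2 * m * L * t)))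
    rw [nhds_prod_eq] at e2
    have e1 := (hy.eventually (psi_loc hL (2 * m * L * t)))
    rw [nhds_prod_eq] at e1
    have e1' := (eventually_swap_iff.1 e1).curry
    have e2' := (eventually_swap_iff.1 e2).curry
    filter_upwards [e1', e2'] with y hy1 hy2
    simp only [Prod.swap, Prod.fst_swap, Prod.snd_swap] at hy1 hy2
    refine ⟨?_, ?_, ?_⟩
    · refine (hasDerivAt_const t (gG (psi L (2 * m * L * t) (2 * m * y) / L) / (2 * m))).congr_of_eventuallyEq ?_
      filter_upwards [hy1] with s hs
      rw [hs]
    · refine (hasDerivAt_const t ((C+1) / (2*m) * gH (psi L (2 * m * L * t) (2 * m * y) / L))).congr_of_eventuallyEq ?_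
      filter_upwards [hy1] with s hs
      rw [hs]
    · have hq := (QQ_hasDeriv hL r (2 * m * L * t) (2 * m * y)).scomp t ((hasDerivAt_id t).const_mul (2 * (m:ℝ) * L))
      have hq2 := ((hq.sub_const (QQ L r (2 * m * L * t) (2 * m * y))).const_mul (rh L r (2 * m * L * t) (2 * m * y))).const_add
        (TT L r (2 * m * L * t) (2 * m * y))
      refine (hq2.congr_of_eventuallyEq ?_).congr_deriv ?_
      · filter_upwards [hy2] with s hs
        rw [hs]; rfl
      · simp only [smul_eq_mul, mul_one]
        have : UU L (2 * m * L * t) - 2 * m * y = (2 * m) * (UU L (2 * m * L * t) / (2 * m) - y) := by field_simp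
        rw [this, mul_pow]; ring
  · intro t y
    have h := abs_le.1 (psi_near L (2 * m * L * t) (2 * m * y))
    set p := psi L (2 * m * L * t) (2 * m * y)
    have h2 := abs_le.1 (gG_near (p / L))
    have h3 : |gG (p / L) - 2 * m * t| ≤ 4 := by
      have k1 : p / L - 2 * m * t = (p - 2 * m * L * t) / L := by field_simp
      have k2 : |p / L - 2 * m * t| ≤ 3 := by
        rw [k1, abs_div, abs_of_pos (by linarith : (0:ℝ) < L)]
        rw [div_le_iff₀ (by linarith)]
        exact (abs_le.2 h).trans (by linarith)
      have k3 := abs_le.1 k2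
      rw [abs_le]; constructor <;> linarith [k3.1, k3.2, h2.1, h2.2]
    rw [show gG (p / L) / (2 * m) - t = (gG (p / L) - 2 * m * t) / (2 * m) by field_simp, abs_div,
      abs_of_pos (by positivity : (0:ℝ) < 2 * m)]
    refine le_trans ?_ hb4
    gcongr
  · intro t y
    rw [abs_mul, abs_of_pos (by positivity : (0:ℝ) < (C+1) / (2*m))]
    refine le_trans (mul_le_of_le_one_right (by positivity) ?_) hb1
    unfold gH; rw [abs_neg]; exact Real.abs_cos_le_one _
  · intro t ht
    rw [hgraph]
    exact mul_ne_zero (rh_ne hL r (hUz t ht)) (by positivity)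
  · obtain ⟨η0, hη0, hs⟩ := sep_real hL hm r hC
    refine ⟨η0, hη0, fun η h1 h2 => ?_⟩
    have key : ∀ t t' : ℝ, t < t' → UU L (2 * m * L * t) / (2 * m) = UU L (2 * m * L * t') / (2 * m) → _ :=
      fun t t' htt hU => hs η h1 h2 (2 * m * L * t) (2 * m * L * t') (by gcongr)
        (by rw [← hgraph t, hU, hgraph t'])
    intro t t' hne hU
    have hU' : UU L (2 * m * L * t) = UU L (2 * m * L * t') := by rw [← hgraph t, hU, hgraph t']
    rw [hgraph]
    rcases lt_or_gt_of_ne hne with hlt | hlt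
    · have := key t t' hlt hU
      rw [← hU'] at this
      exact this
    · have := key t' t hlt hU.symm
      rw [← hU'] at this
      rw [abs_sub_comm] at this
      refine this.trans_eq ?_
      rw [← abs_neg]; congr 1; ring

end LemA2

section MDsec
open Filter Topology Set
open scoped Nat
local notation "C∞" => ((⊤ : ℕ∞) : WithTop ℕ∞)

section jets
variable {E F G : Type} [NormedAddCommGroup E] [NormedSpace ℝ E] [NormedAddCommGroup F] [NormedSpace ℝ F]
  [NormedAddCommGroup G] [NormedSpace ℝ G]

theorem jet_add_le {f g : E → F} (hf : ContDiff ℝ C∞ f) (hg : ContDiff ℝ C∞ g) (b : ℕ) (x : E) :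
    ‖iteratedFDeriv ℝ b (fun x => f x + g x) x‖ ≤ ‖iteratedFDeriv ℝ b f x‖ + ‖iteratedFDeriv ℝ b g x‖ := by
  have := iteratedFDeriv_add_apply (𝕜 := ℝ) (i := b) (x := x) (f := f) (g := g)
      ((hf.of_le (nat_le_smooth b)).contDiffAt) ((hg.of_le (nat_le_smooth b)).contDiffAt)
  have h3 : (fun x => f x + g x) = f + g := rfl
  rw [h3, this]
  exact norm_add_le _ _

theorem jet_left_le (A : F →L[ℝ] G) (hA : ‖A‖ ≤ 1) {f : E → F} (hf : ContDiff ℝ C∞ f) (b : ℕ) (x : E) :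
    ‖iteratedFDeriv ℝ b (fun x => A (f x)) x‖ ≤ ‖iteratedFDeriv ℝ b f x‖ := by
  have := A.norm_iteratedFDeriv_comp_left (f := f) (x := x) hf.contDiffAt (nat_le_smooth b)
  refine this.trans (mul_le_of_le_one_left (norm_nonneg _) hA)

theorem jet_right_le (A : E →L[ℝ] F) (hA : ‖A‖ ≤ 1) {f : F → G} (hf : ContDiff ℝ C∞ f) (b : ℕ) (x : E) :
    ‖iteratedFDeriv ℝ b (fun x => f (A x)) x‖ ≤ ‖iteratedFDeriv ℝ b f (A x)‖ := by
  have := A.iteratedFDeriv_comp_right hf x (nat_le_smooth b)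
  rw [show (fun x => f (A x)) = f ∘ A from rfl, this]
  refine (ContinuousMultilinearMap.norm_compContinuousLinearMap_le _ _).trans
    (mul_le_of_le_one_right (norm_nonneg _) ?_)
  rw [Finset.prod_const]
  exact pow_le_one₀ (norm_nonneg _) hA

theorem jet_lin_le (A : E →L[ℝ] F) (hA : ‖A‖ ≤ 1) (b : ℕ) (hb : 1 ≤ b) (x : E) :
    ‖iteratedFDeriv ℝ b (fun x => A x) x‖ ≤ 1 := by
  obtain ⟨c, rfl⟩ : ∃ c, b = c + 1 := ⟨b - 1, by omega⟩
  rw [← norm_iteratedFDeriv_fderiv]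
  have : fderiv ℝ (fun x => A x) = fun _ => A := by funext x; exact A.fderiv
  rw [this]
  rcases Nat.eq_zero_or_pos c with rfl | h
  · simpa using hA
  · rw [iteratedFDeriv_const_of_ne (by omega)]; simp

/-- composition bound, orders `1 ≤ b ≤ r` only -/
theorem comp_smallV {g : F → G} {f : E → F}
    (hg : ContDiff ℝ C∞ g) (hf : ContDiff ℝ C∞ f) (x : E) (r : ℕ) {C D : ℝ} (hC0 : 0 ≤ C) (hD1 : 1 ≤ D)
    (hC : ∀ i, 1 ≤ i → i ≤ r → ‖iteratedFDeriv ℝ i g (f x)‖ ≤ C)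
    (hD : ∀ i, 1 ≤ i → i ≤ r → ‖iteratedFDeriv ℝ i f x‖ ≤ D) (b : ℕ) (hb : 1 ≤ b) (hbr : b ≤ r) :
    ‖iteratedFDeriv ℝ b (fun y => g (f y)) x‖ ≤ r ! * C * D ^ r := by
  have cst : ∀ {E' : Type} [NormedAddCommGroup E'] [NormedSpace ℝ E'] {h : E' → G} (_ : ContDiff ℝ C∞ h) (a : G) (z : E')
      (i : ℕ), 1 ≤ i → iteratedFDeriv ℝ i (fun y => h y + a) z = iteratedFDeriv ℝ i h z := by
    intro E' _ _ h hh a z i hi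
    have h2 := iteratedFDeriv_add_apply (𝕜 := ℝ) (i := i) (x := z) (f := h) (g := fun _ => a)
      ((hh.of_le (nat_le_smooth i)).contDiffAt) contDiffAt_const
    have h3 : (fun y => h y + a) = h + fun _ => a := rfl
    rw [h3, h2, iteratedFDeriv_const_of_ne (by omega)]
    simp
  have hgf : ContDiff ℝ C∞ (fun y => g (f y)) := hg.comp hf
  rw [← cst hgf (-g (f x)) x b hb]
  have h := norm_iteratedFDeriv_comp_le (𝕜 := ℝ) (g := fun z => g z + -g (f x)) (f := f) (n := b)
    (hg.add contDiff_const) hf (nat_le_smooth b) x (C := C) (D := D) ?_ ?_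
  · refine h.trans ?_
    have : (b ! : ℝ) ≤ r ! := by exact_mod_cast Nat.factorial_le hbr
    have : D ^ b ≤ D ^ r := pow_le_pow_right₀ hD1 hbr
    gcongr
  · intro i hi
    rcases Nat.eq_zero_or_pos i with rfl | hpos
    · simpa using hC0
    · rw [cst hg _ _ _ hpos]
      exact hC i hpos (by omega)
  · intro i hi hi'
    exact (hD i hi (by omega)).trans (le_self_pow₀ hD1 (by omega))
end jets

def pA (n : ℕ) : Vec (n+2) →L[ℝ] Vec (n+1) :=
  ContinuousLinearMap.pi fun i => ContinuousLinearMap.proj i.castSucc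
def pl (n : ℕ) : Vec (n+2) →L[ℝ] ℝ := ContinuousLinearMap.proj (Fin.last (n+1))
def jA (n : ℕ) : Vec (n+1) →L[ℝ] Vec (n+2) :=
  ContinuousLinearMap.pi (Fin.lastCases 0 fun i => ContinuousLinearMap.proj i)
def jl (n : ℕ) : ℝ →L[ℝ] Vec (n+2) :=
  ContinuousLinearMap.pi (Fin.lastCases (ContinuousLinearMap.id ℝ ℝ) fun _ => 0)
def ez (n : ℕ) : Vec (n+1) := Pi.single 0 1

theorem pA_apply (n : ℕ) (v : Vec (n+2)) (i : Fin (n+1)) : pA n v i = v i.castSucc := rfl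
theorem pl_apply (n : ℕ) (v : Vec (n+2)) : pl n v = v (Fin.last _) := rfl
theorem pA_jA (n : ℕ) (u : Vec (n+1)) : pA n (jA n u) = u := by
  funext i; simp [pA, jA]
theorem pA_jl (n : ℕ) (s : ℝ) : pA n (jl n s) = 0 := by
  funext i; simp [pA, jl]
theorem pl_jA (n : ℕ) (u : Vec (n+1)) : pl n (jA n u) = 0 := by simp [pl, jA]
theorem pl_jl (n : ℕ) (s : ℝ) : pl n (jl n s) = s := by simp [pl, jl]
theorem pA_ez (n : ℕ) : pA n (ez (n+1)) = ez n := by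
  funext i
  rw [pA_apply]
  unfold ez
  by_cases h : i = 0
  · subst h; simp
  · rw [Pi.single_eq_of_ne h, Pi.single_eq_of_ne]
    simpa using h
theorem pl_ez (n : ℕ) : pl n (ez (n+1)) = 0 := by
  rw [pl_apply]; unfold ez; rw [Pi.single_eq_of_ne]
  simp [Fin.ext_iff]
theorem vec_ext {n : ℕ} {u v : Vec (n+2)} (h1 : pA n u = pA n v) (h2 : pl n u = pl n v) : u = v := by
  funext i
  refine Fin.lastCases h2 (fun i => ?_) i
  exact congrFun h1 i
theorem vec_norm_le {n : ℕ} {u : Vec (n+2)} {c : ℝ} (hc : 0 ≤ c) (h1 : ‖pA n u‖ ≤ c) (h2 : |pl n u| ≤ c) : ‖u‖ ≤ c := by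
  rw [pi_norm_le_iff_of_nonneg hc] at h1 ⊢
  intro i
  refine Fin.lastCases h2 (fun i => ?_) i
  exact h1 i
theorem pA_norm (n : ℕ) : ‖pA n‖ ≤ 1 := by
  refine ContinuousLinearMap.opNorm_le_bound _ zero_le_one fun v => ?_
  rw [one_mul, pi_norm_le_iff_of_nonneg (norm_nonneg _)]
  intro i; exact norm_le_pi_norm v _
theorem pl_norm (n : ℕ) : ‖pl n‖ ≤ 1 := by
  refine ContinuousLinearMap.opNorm_le_bound _ zero_le_one fun v => ?_
  rw [one_mul]; exact norm_le_pi_norm v _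
theorem jA_norm (n : ℕ) : ‖jA n‖ ≤ 1 := by
  refine ContinuousLinearMap.opNorm_le_bound _ zero_le_one fun v => ?_
  rw [one_mul]
  refine vec_norm_le (norm_nonneg _) ?_ ?_
  · rw [pA_jA]
  · rw [pl_jA]; simp
theorem jl_norm (n : ℕ) : ‖jl n‖ ≤ 1 := by
  refine ContinuousLinearMap.opNorm_le_bound _ zero_le_one fun v => ?_
  rw [one_mul]
  refine vec_norm_le (norm_nonneg _) ?_ ?_
  · rw [pA_jl]; simp
  · rw [pl_jl]; exact le_rfl
theorem ez_norm (n : ℕ) : ‖ez n‖ ≤ 1 := by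
  unfold ez
  rw [Pi.norm_single]; simp
theorem pA_zcast (n : ℕ) (m : Fin (n+2) → ℤ) : pA n (zcast m) = zcast (fun i => m i.castSucc) := rfl
theorem pl_zcast (n : ℕ) (m : Fin (n+2) → ℤ) : pl n (zcast m) = m (Fin.last _) := rfl
theorem pA_open (n : ℕ) : IsOpenMap (pA n) :=
  (pA n).isOpenMap (fun u => ⟨jA n u, pA_jA n u⟩)

def pz (n : ℕ) : Vec (n+1) →L[ℝ] ℝ := ContinuousLinearMap.proj 0
theorem pz_norm (n : ℕ) : ‖pz n‖ ≤ 1 := by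
  refine ContinuousLinearMap.opNorm_le_bound _ zero_le_one fun v => ?_
  rw [one_mul]; exact norm_le_pi_norm v _
theorem pz_pA (n : ℕ) (v : Vec (n+2)) : pz n (pA n v) = pz (n+1) v := by
  simp [pz, pA]
theorem pz_apply (n : ℕ) (v : Vec (n+1)) : pz n v = v 0 := rfl
theorem pz_ez (n : ℕ) : pz n (ez n) = 1 := by simp [pz, ez]

/-- Multi-dimensional wrinkling data. -/
structure MD (n r : ℕ) (C ν : ℝ) where
  X : Vec (n+1) → Vec (n+1)
  Y : Vec (n+1) → ℝ
  G : Vec (n+1) → Vec (n+1) → Vec (n+1)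
  Lam : Vec (n+1) → Vec (n+1) → ℝ
  T : Vec (n+1) → Vec (n+1) → ℝ
  rho : Vec (n+1) → Vec (n+1) → ℝ
  X_smooth : ContDiff ℝ C∞ X
  Y_smooth : ContDiff ℝ C∞ Y
  G_smooth : ContDiff ℝ C∞ (fun z : Vec (n+1) × Vec (n+1) => G z.1 z.2)
  Lam_smooth : ContDiff ℝ C∞ (fun z : Vec (n+1) × Vec (n+1) => Lam z.1 z.2)
  T_smooth : ContDiff ℝ C∞ (fun z : Vec (n+1) × Vec (n+1) => T z.1 z.2)
  rho_smooth : ∀ t, ContDiff ℝ C∞ (rho t)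
  X_shift : ∀ (m : Fin (n+1) → ℤ) p, X (p + zcast m) = X p + zcast m
  G_shift : ∀ (m : Fin (n+1) → ℤ) p x, G (p + zcast m) (x + zcast m) = G p x + zcast m
  Lam_shift : ∀ (m : Fin (n+1) → ℤ) p x, Lam (p + zcast m) (x + zcast m) = Lam p x
  T_shift : ∀ (m : Fin (n+1) → ℤ) p x, T (p + zcast m) (x + zcast m) = T p x
  X_near : ∀ p, ‖X p - p‖ ≤ ν
  dense : Dense {p | Function.Injective (fderiv ℝ X p)}
  H : ∀ p, ∀ᶠ x in 𝓝 (X p), HasFDerivAt (fun s => G s x) (0 : Vec (n+1) →L[ℝ] Vec (n+1)) p ∧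
    HasFDerivAt (fun s => Lam s x) (0 : Vec (n+1) →L[ℝ] ℝ) p ∧
    HasFDerivAt (fun s => T s x) ((rho p x * (Y (X p) - Y x) ^ r) • pz n) p
  G_near : ∀ p x, ‖G p x - p‖ ≤ ν
  G_jet : ∀ p x b, 1 ≤ b → b ≤ r → ‖iteratedFDeriv ℝ b (G p) x‖ ≤ ν
  Lam_near : ∀ p x, |Lam p x| ≤ ν
  Lam_jet : ∀ p x b, 1 ≤ b → b ≤ r → ‖iteratedFDeriv ℝ b (Lam p) x‖ ≤ ν
  imm : ∀ p v, fderiv ℝ X p v = 0 → v ≠ 0 → pz n v ≠ 0 ∧ rho p (X p) ≠ 0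
  Yd : ∀ x, fderiv ℝ Y x (ez n) = 1
  sep : ∃ η0 : ℝ, 0 < η0 ∧ ∀ η, 0 < η → η < η0 → ∀ p q, p ≠ q → X p = X q →
    C * ‖G q (X p) - G p (X p)‖ < |Lam q (X p) - Lam p (X p) + η * (T q (X p) - T p (X p))|

end MDsec

section Base
open Filter Topology Set
open scoped Nat
local notation "C∞" => ((⊤ : ℕ∞) : WithTop ℕ∞)

def jz : ℝ →L[ℝ] Vec 1 := ContinuousLinearMap.pi fun _ => ContinuousLinearMap.id ℝ ℝ
theorem pz_jz (s : ℝ) : pz 0 (jz s) = s := rfl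
theorem v1_ext {u v : Vec 1} (h : pz 0 u = pz 0 v) : u = v := by
  funext i
  obtain rfl : i = 0 := Subsingleton.elim _ _
  exact h
theorem jz_pz (u : Vec 1) : jz (pz 0 u) = u := v1_ext rfl
theorem v1_norm (u : Vec 1) : ‖u‖ = |pz 0 u| := by
  refine le_antisymm ?_ (norm_le_pi_norm u 0)
  rw [pi_norm_le_iff_of_nonneg (abs_nonneg _)]
  intro i
  obtain rfl : i = 0 := Subsingleton.elim _ _
  exact le_rfl
theorem jz_norm : ‖jz‖ ≤ 1 := by
  refine ContinuousLinearMap.opNorm_le_bound _ zero_le_one fun v => ?_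
  rw [one_mul, v1_norm, pz_jz]; rfl

theorem MD_base {r : ℕ} {C ν : ℝ} (D : OneD r C ν) : Nonempty (MD 0 r C ν) := by
  have hsm : ∀ {f : ℝ → ℝ → ℝ}, ContDiff ℝ C∞ (fun z : ℝ × ℝ => f z.1 z.2) → ∀ t, ContDiff ℝ C∞ (f t) :=
    fun hf t => comp2 hf contDiff_const contDiff_id
  have hXd : ∀ p, HasFDerivAt (fun p => jz (D.U (pz 0 p))) (jz.comp ((deriv D.U (pz 0 p)) • pz 0)) p := by
    intro p
    have h1 : HasDerivAt D.U (deriv D.U (pz 0 p)) (pz 0 p) := (smooth_diff D.U_smooth _).hasDerivAt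
    exact jz.hasFDerivAt.comp p (h1.comp_hasFDerivAt p (pz 0).hasFDerivAt)
  have pzz : ∀ m : Fin 1 → ℤ, pz 0 (zcast m) = m 0 := fun _ => rfl
  refine ⟨{ X := fun p => jz (D.U (pz 0 p))
            Y := fun x => pz 0 x
            G := fun p x => jz (D.G (pz 0 p) (pz 0 x))
            Lam := fun p x => D.Lam (pz 0 p) (pz 0 x)
            T := fun p x => D.T (pz 0 p) (pz 0 x)
            rho := fun p x => D.rho (pz 0 p) (pz 0 x)
            X_smooth := jz.contDiff.comp (comp1 D.U_smooth (pz 0).contDiff)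
            Y_smooth := (pz 0).contDiff
            G_smooth := jz.contDiff.comp (comp2 D.G_smooth ((pz 0).contDiff.comp contDiff_fst) ((pz 0).contDiff.comp contDiff_snd))
            Lam_smooth := comp2 D.Lam_smooth ((pz 0).contDiff.comp contDiff_fst) ((pz 0).contDiff.comp contDiff_snd)
            T_smooth := comp2 D.T_smooth ((pz 0).contDiff.comp contDiff_fst) ((pz 0).contDiff.comp contDiff_snd)
            rho_smooth := fun p => comp1 (D.rho_smooth _) (pz 0).contDiff
            X_shift := ?_, G_shift := ?_, Lam_shift := ?_, T_shift := ?_, X_near := ?_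
            dense := ?_, H := ?_, G_near := ?_
            G_jet := ?_, Lam_near := fun p x => D.Lam_near _ _, Lam_jet := ?_
            imm := ?_, Yd := ?_, sep := ?_ }⟩
  · intro m p
    apply v1_ext
    rw [map_add, map_add, pz_jz, pz_jz, pzz, D.U_shift]
  · intro m p x
    apply v1_ext
    rw [map_add, map_add, map_add, pz_jz, pz_jz, pzz, D.G_shift]
  · intro m p x
    rw [map_add, map_add, pzz, D.Lam_shift]
  · intro m p x
    rw [map_add, map_add, pzz, D.T_shift]
  · intro p
    rw [v1_norm, map_sub, pz_jz]; exact D.U_near _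
  · have hop : IsOpenMap (pz 0) := (pz 0).isOpenMap (fun u => ⟨jz u, pz_jz u⟩)
    refine ((D.U_count.dense_compl ℝ).preimage hop).mono ?_
    intro p hp
    simp only [mem_preimage, mem_compl_iff, mem_setOf_eq] at hp
    rw [mem_setOf_eq, (hXd p).fderiv, injective_iff_map_eq_zero]
    intro v hv
    have := congrArg (pz 0) hv
    simp only [ContinuousLinearMap.comp_apply, pz_jz, ContinuousLinearMap.smul_apply, smul_eq_mul, map_zero] at this
    exact v1_ext (by rw [map_zero]; exact (mul_eq_zero.1 this).resolve_left hp)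
  · intro p
    have hc : Tendsto (pz 0) (𝓝 (jz (D.U (pz 0 p)))) (𝓝 (D.U (pz 0 p))) := (pz 0).continuous.tendsto _
    filter_upwards [hc.eventually (D.H (pz 0 p))] with x hx
    obtain ⟨h1, h2, h3⟩ := hx
    refine ⟨?_, ?_, ?_⟩
    · have := jz.hasFDerivAt.comp p (h1.comp_hasFDerivAt p (pz 0).hasFDerivAt)
      refine this.congr_fderiv ?_
      ext; simp
    · have := (h2.comp_hasFDerivAt p (pz 0).hasFDerivAt)
      refine this.congr_fderiv ?_
      ext; simp
    · exact (h3.comp_hasFDerivAt p (pz 0).hasFDerivAt)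
  · intro p x
    rw [v1_norm, map_sub, pz_jz]; exact D.G_near _ _
  · intro p x b hb hbr
    refine (jet_left_le jz jz_norm (comp1 (hsm D.G_smooth _) (pz 0).contDiff) b x).trans ?_
    exact (jet_right_le (pz 0) (pz_norm 0) (hsm D.G_smooth _) b x).trans (D.G_jet _ _ b hb hbr)
  · intro p x b hb hbr
    exact (jet_right_le (pz 0) (pz_norm 0) (hsm D.Lam_smooth _) b x).trans (D.Lam_jet _ _ b hb hbr)
  · intro p v hv hv0
    have hz : pz 0 v ≠ 0 := fun h => hv0 (v1_ext (by rw [h, map_zero]))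
    refine ⟨hz, ?_⟩
    rw [(hXd p).fderiv] at hv
    have := congrArg (pz 0) hv
    simp only [ContinuousLinearMap.comp_apply, pz_jz, ContinuousLinearMap.smul_apply, smul_eq_mul, map_zero] at this
    exact D.rho_ne _ ((mul_eq_zero.1 this).resolve_right hz)
  · intro x
    have : fderiv ℝ (fun x => pz 0 x) x = pz 0 := (pz 0).fderiv
    rw [this, pz_ez]
  · obtain ⟨η0, h0, hs⟩ := D.sep
    refine ⟨η0, h0, fun η h1 h2 p q hpq hX => ?_⟩
    have hU : D.U (pz 0 p) = D.U (pz 0 q) := congrArg (pz 0) hX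
    have := hs η h1 h2 (pz 0 p) (pz 0 q) (fun h => hpq (v1_ext h)) hU
    rw [v1_norm, map_sub]
    exact this

end Base

section Phi
open Filter Topology Set
open scoped Nat
local notation "C∞" => ((⊤ : ℕ∞) : WithTop ℕ∞)

def ph (N : ℕ) (δ t z : ℝ) : ℝ :=
  ((JJ (N * t - 1/2) + 1/2 - JJ (N * t)) * sS (2 / δ * z) + JJ (N * t)) / N

theorem ph_smooth (N : ℕ) (δ : ℝ) : ContDiff ℝ C∞ (fun z : ℝ × ℝ => ph N δ z.1 z.2) := by
  unfold ph
  have h1 : ContDiff ℝ C∞ (fun z : ℝ × ℝ => JJ (N * z.1)) := comp1 JJ_smooth (by fun_prop)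
  have h2 : ContDiff ℝ C∞ (fun z : ℝ × ℝ => JJ (N * z.1 - 1/2)) := comp1 JJ_smooth (by fun_prop)
  have h3 : ContDiff ℝ C∞ (fun z : ℝ × ℝ => sS (2 / δ * z.2)) := comp1 sS_smooth (by fun_prop)
  fun_prop

theorem ph_shift {N : ℕ} (hN : 1 ≤ N) (δ : ℝ) (m : ℤ) (t z : ℝ) : ph N δ (t + m) z = ph N δ t z + m := by
  have hN' : (N:ℝ) ≠ 0 := by positivity
  unfold ph
  have e1 := JJ_shift (N * m) (N * t)
  have e2 := JJ_shift (N * m) (N * t - 1/2)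
  push_cast at e1 e2
  rw [show (N:ℝ) * (t + m) - 1/2 = N * t - 1/2 + N * m by ring, show (N:ℝ) * (t + m) = N * t + N * m by ring, e1, e2]
  field_simp
  ring

theorem ph_near {N : ℕ} (hN : 1 ≤ N) (δ t z : ℝ) : |ph N δ t z - t| ≤ 3 / N := by
  have hN' : (1:ℝ) ≤ N := by exact_mod_cast hN
  have h1 := abs_le.1 (JJ_bound (N * t))
  have h2 := abs_le.1 (JJ_bound (N * t - 1/2))
  have h3 : 0 ≤ sS (2 / δ * z) := sS_nonneg _
  have h4 : sS (2 / δ * z) ≤ 1 := sS_le _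
  have : ph N δ t z - t = ((JJ (N * t - 1/2) + 1/2 - JJ (N * t)) * sS (2 / δ * z) + JJ (N * t) - N * t) / N := by
    unfold ph; field_simp
  rw [this, abs_div, abs_of_pos (by linarith : (0:ℝ) < N)]
  gcongr
  rw [abs_le]; constructor <;> nlinarith [h1.1, h1.2, h2.1, h2.2]

theorem ph_amp {N : ℕ} (hN : 1 ≤ N) (t : ℝ) : |(JJ (N * t - 1/2) + 1/2 - JJ (N * t)) / N| ≤ 6 / N := by
  have hN' : (1:ℝ) ≤ N := by exact_mod_cast hN
  rw [abs_div, abs_of_pos (by linarith : (0:ℝ) < N)]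
  gcongr
  exact psi_amp _

theorem ph_form (N : ℕ) (δ t z : ℝ) : ph N δ t z =
    JJ (N * t) / N + (JJ (N * t - 1/2) + 1/2 - JJ (N * t)) / N * sS (2 / δ * z + 0) := by
  unfold ph; rw [add_zero]; ring

theorem sS_lip {M : ℝ} (hM : ∀ x, |iteratedDeriv 1 sS x| ≤ M) (a b : ℝ) : |sS a - sS b| ≤ M * |a - b| := by
  have := Convex.norm_image_sub_le_of_norm_deriv_le (f := sS) (s := univ) (x := b) (y := a) (C := M)
    (fun x _ => smooth_diff sS_smooth x) (fun x _ => by have := hM x; rwa [iteratedDeriv_one] at this)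
    convex_univ (mem_univ _) (mem_univ _)
  exact this

theorem ph_lip {N : ℕ} (hN : 1 ≤ N) {δ M : ℝ} (hδ : 0 < δ) (hM : ∀ x, |iteratedDeriv 1 sS x| ≤ M)
    (hb : 6 / N * (M * (2 / δ)) ≤ 1) (t z z' : ℝ) : |ph N δ t z - ph N δ t z'| ≤ |z - z'| := by
  rw [ph_form, ph_form, add_sub_add_left_eq_sub, ← mul_sub, abs_mul]
  have h1 := ph_amp hN t
  have h2 := sS_lip hM (2 / δ * z + 0) (2 / δ * z' + 0)
  have h3 : |2 / δ * z + 0 - (2 / δ * z' + 0)| = 2 / δ * |z - z'| := by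
    rw [show 2 / δ * z + 0 - (2 / δ * z' + 0) = 2 / δ * (z - z') by ring, abs_mul, abs_of_pos (by positivity)]
  rw [h3] at h2
  calc _ ≤ 6 / N * (M * (2 / δ * |z - z'|)) := by gcongr
    _ = 6 / N * (M * (2 / δ)) * |z - z'| := by ring
    _ ≤ _ := mul_le_of_le_one_left (abs_nonneg _) hb

theorem ph_jet {N : ℕ} (hN : 1 ≤ N) {δ M : ℝ} {r : ℕ} (hδ : 0 < δ) (hδ1 : δ ≤ 1) (hM1 : 1 ≤ M)
    (hM : ∀ i, 1 ≤ i → i ≤ r → ∀ x, |iteratedDeriv i sS x| ≤ M) (t z : ℝ) (i : ℕ) (hi : 1 ≤ i) (hir : i ≤ r) :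
    |iteratedDeriv i (ph N δ t) z| ≤ 6 / N * ((2 / δ) ^ r * M) := by
  have hl : 1 ≤ 2 / δ := by rw [le_div_iff₀ hδ]; linarith
  have e : ph N δ t = fun z => JJ (N * t) / N + (JJ (N * t - 1/2) + 1/2 - JJ (N * t)) / N * sS (2 / δ * z + 0) := by
    funext z; exact ph_form N δ t z
  rw [e, iteratedDeriv_const_add (by omega), iteratedDeriv_const_mul_field, aff_deriv sS_smooth, abs_mul, abs_mul, abs_pow,
    abs_of_pos (by positivity : 0 < 2 / δ)]
  have := ph_amp hN t
  have := hM i hi hir (2 / δ * z + 0)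
  have : (2 / δ) ^ i ≤ (2 / δ) ^ r := pow_le_pow_right₀ hl hir
  gcongr

theorem ph_loc {N : ℕ} {δ t z : ℝ} (hδ : 0 < δ) (h : |z / δ - cw (N * t)| < 1/4) :
    HasDerivAt (fun s => ph N δ s z) 0 t := by
  have hz : 2 / δ * z = 2 * (z / δ) := by ring
  have h' := abs_lt.1 h
  have hc : Tendsto (fun s : ℝ => N * s) (𝓝 t) (𝓝 (N * t)) := (by fun_prop : Continuous (fun s : ℝ => N * s)).tendsto t
  suffices hs : ∀ᶠ s in 𝓝 t, ph N δ s z = ph N δ t z from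
    (hasDerivAt_const t (ph N δ t z)).congr_of_eventuallyEq hs
  by_cases c1 : ∃ i : ℤ, |N * t - i| ≤ 1/16
  · obtain ⟨i, hi⟩ := c1
    have hw := cw_zone_lo' i hi
    have hS : sS (2 / δ * z) = 0 := sS_zero (by rw [hz]; linarith [h'.2])
    filter_upwards [hc.eventually (JJ_loc i (by linarith : |N * t - i| < 15/32))] with s hs
    unfold ph; rw [hS, hs]; ring
  by_cases c2 : ∃ i : ℤ, |N * t - i - 1/2| ≤ 1/16
  · obtain ⟨i, hi⟩ := c2
    have hw := cw_zone_hi' i hi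
    have hS : sS (2 / δ * z) = 1 := sS_one (by rw [hz]; linarith [h'.1])
    have hi' : |N * t - 1/2 - i| < 15/32 := by
      rw [show N * t - 1/2 - i = N * t - i - 1/2 by ring]; linarith
    filter_upwards [hc.eventually (JJ_loc' i hi')] with s hs
    unfold ph; rw [hS, hs]; ring
  push Not at c1 c2
  have f1 : ∃ i : ℤ, |N * t - i| < 15/32 := by
    obtain ⟨i, hi⟩ := near_int (N * t)
    have a1 := c2 i
    have a2 := c2 (i-1)
    push_cast at a2
    refine ⟨i, ?_⟩
    rw [abs_le] at hi
    rw [lt_abs] at a1 a2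
    rw [abs_lt]
    rcases a1 with a1 | a1 <;> rcases a2 with a2 | a2 <;> constructor <;> linarith [hi.1, hi.2]
  have f2 : ∃ i : ℤ, |N * t - 1/2 - i| < 15/32 := by
    obtain ⟨i, hi⟩ := near_int (N * t - 1/2)
    have a1 := c1 i
    have a2 := c1 (i+1)
    push_cast at a2
    refine ⟨i, ?_⟩
    rw [abs_le] at hi
    rw [lt_abs] at a1 a2
    rw [abs_lt]
    rcases a1 with a1 | a1 <;> rcases a2 with a2 | a2 <;> constructor <;> linarith [hi.1, hi.2]
  obtain ⟨i, hi⟩ := f1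
  obtain ⟨j, hj⟩ := f2
  filter_upwards [hc.eventually (JJ_loc i hi), hc.eventually (JJ_loc' j hj)] with s hs hs'
  unfold ph; rw [hs, hs']

end Phi

section Step
open Filter Topology Set
open scoped Nat
local notation "C∞" => ((⊤ : ℕ∞) : WithTop ℕ∞)

theorem exists_N (B : ℝ) : ∃ N : ℕ, 1 ≤ N ∧ B ≤ N := by
  obtain ⟨N, hN⟩ := exists_nat_ge (max B 1)
  refine ⟨N, ?_, (le_max_left _ _).trans hN⟩
  exact_mod_cast (le_max_right _ _).trans hN

theorem MD_step {n r : ℕ} {C : ℝ} (hC : 0 ≤ C) (ih : ∀ ν' : ℝ, 0 < ν' → Nonempty (MD n r C ν')) {ν : ℝ} (hν : 0 < ν) :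
    Nonempty (MD (n+1) r C ν) := by
  obtain ⟨M, hM1, hM⟩ := sS_deriv_bound (r+1)
  obtain ⟨δ, hδ, hδ1, hδν⟩ : ∃ δ : ℝ, 0 < δ ∧ δ ≤ 1 ∧ δ ≤ ν / 2 :=
    ⟨min (ν/2) 1, by positivity, min_le_right _ _, min_le_left _ _⟩
  obtain ⟨N, hN, hNB⟩ := exists_N (3 / ν + 6 * (M * (2 / δ)) + r ! * (6 * ((2 / δ)^r * M)) * 2 ^ r * (2 / ν))
  have hN' : (1:ℝ) ≤ N := by exact_mod_cast hN
  have q1 : 0 ≤ 3 / ν := by positivity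
  have q2 : 0 ≤ 6 * (M * (2 / δ)) := by positivity
  have q3 : 0 ≤ r ! * (6 * ((2 / δ)^r * M)) * 2 ^ r * (2 / ν) := by positivity
  have n1 : 3 / (N:ℝ) ≤ ν := by
    have : 3 / ν ≤ N := by linarith
    rw [div_le_iff₀ (by positivity)] at this ⊢; linarith
  have n2 : 6 / (N:ℝ) * (M * (2 / δ)) ≤ 1 := by
    have : 6 * (M * (2 / δ)) ≤ N := by linarith
    rw [div_mul_eq_mul_div, div_le_one (by positivity)]; exact this
  have n3 : r ! * (6 / (N:ℝ) * ((2 / δ)^r * M)) * 2 ^ r ≤ ν / 2 := by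
    have h1 : r ! * (6 * ((2 / δ)^r * M)) * 2 ^ r * (2 / ν) ≤ N := by linarith
    have h2 : r ! * (6 / (N:ℝ) * ((2 / δ)^r * M)) * 2 ^ r = (r ! * (6 * ((2 / δ)^r * M)) * 2 ^ r * (2 / ν)) / N * (ν / 2) := by
      field_simp
    rw [h2]
    refine mul_le_of_le_one_left (by positivity) ?_
    rw [div_le_one (by positivity)]; exact h1
  clear q1 q2 q3
  -- the wiggle
  obtain ⟨w, hwdef⟩ : ∃ w : ℝ → ℝ, w = fun t => δ * cw (N * t) := ⟨_, rfl⟩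
  have hw : ContDiff ℝ C∞ w := by
    rw [hwdef]
    have : ContDiff ℝ C∞ (fun t : ℝ => cw (N * t)) := comp1 cw_smooth (by fun_prop)
    fun_prop
  have hwsh : ∀ (m : ℤ) t, w (t + m) = w t := by
    intro m t
    have := cw_shift (N * m) (N * t)
    push_cast at this
    rw [hwdef]; simp only
    rw [mul_add, this]
  have hwb : ∀ t, |w t| ≤ δ := by
    intro t
    rw [hwdef]; simp only
    rw [abs_mul, abs_of_pos hδ]
    refine mul_le_of_le_one_right hδ.le ?_
    rw [abs_le]; exact ⟨le_cw _, cw_le _⟩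
  obtain ⟨W, hW1, hW⟩ := per_deriv_bound hw 0 (fun x => by have := hwsh 2 x; push_cast at this; rw [this, add_zero]) r
  -- the flattening map
  obtain ⟨wE, hwE⟩ : ∃ wE : ℝ →L[ℝ] Vec (n+1), wE = ContinuousLinearMap.toSpanSingleton ℝ (ez n) := ⟨_, rfl⟩
  have hwE_apply : ∀ s, wE s = s • ez n := by intro s; rw [hwE]; simp
  have hwE_norm : ‖wE‖ ≤ 1 := by rw [hwE, ContinuousLinearMap.norm_toSpanSingleton]; exact ez_norm n
  obtain ⟨a, hadef⟩ : ∃ a : Vec (n+2) → Vec (n+1), a = fun x => pA n x + (-wE) (w (pl n x)) := ⟨_, rfl⟩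
  have ha_apply : ∀ x, a x = pA n x - w (pl n x) • ez n := by
    intro x; rw [hadef]; simp [hwE_apply, sub_eq_add_neg]
  have hwl : ContDiff ℝ C∞ (fun x => w (pl n x)) := comp1 hw (pl n).contDiff
  have hwEl : ContDiff ℝ C∞ (fun x => (-wE) (w (pl n x))) := (-wE).contDiff.comp hwl
  have hwEl' : ContDiff ℝ C∞ (fun x => wE (w (pl n x))) := wE.contDiff.comp hwl
  have ha : ContDiff ℝ C∞ a := by rw [hadef]; exact (pA n).contDiff.add hwEl
  have ha_jet : ∀ x b, 1 ≤ b → b ≤ r → ‖iteratedFDeriv ℝ b a x‖ ≤ 1 + W := by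
    intro x b hb hbr
    rw [hadef]
    refine (jet_add_le (pA n).contDiff hwEl b x).trans (add_le_add (jet_lin_le _ (pA_norm n) b hb x) ?_)
    refine (jet_left_le _ (by rw [norm_neg]; exact hwE_norm) hwl b x).trans ?_
    refine (jet_right_le _ (pl_norm n) hw b x).trans ?_
    rw [norm_iteratedFDeriv_eq_norm_iteratedDeriv]
    exact hW b hb hbr _
  have ha_shift : ∀ (m : Fin (n+2) → ℤ) x, a (x + zcast m) = a x + zcast (fun i => m i.castSucc) := by
    intro m x
    rw [ha_apply, ha_apply, map_add, map_add, pl_zcast, hwsh, pA_zcast]; abel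
  -- old data
  obtain ⟨ν', hν', v1, v2, v3⟩ : ∃ ν' : ℝ, 0 < ν' ∧ ν' ≤ ν / 2 ∧ ν' ≤ δ / 16 ∧ r ! * ν' * (1 + W) ^ r ≤ min (ν / 2) 1 := by
    have hK : 0 < r ! * (1 + W) ^ r := by positivity
    refine ⟨min (min (ν/2) (δ/16)) (min (ν/2) 1 / (r ! * (1 + W) ^ r)), by positivity, ?_, ?_, ?_⟩
    · exact (min_le_left _ _).trans (min_le_left _ _)
    · exact (min_le_left _ _).trans (min_le_right _ _)
    · have := min_le_right (min (ν/2) (δ/16)) (min (ν/2) 1 / (r ! * (1 + W) ^ r))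
      rw [le_div_iff₀ hK] at this
      linarith
  obtain ⟨D⟩ := ih ν' hν'
  have hsm : ∀ {F : Type} [NormedAddCommGroup F] [NormedSpace ℝ F] {f : Vec (n+1) → Vec (n+1) → F},
      ContDiff ℝ C∞ (fun z : Vec (n+1) × Vec (n+1) => f z.1 z.2) → ∀ t, ContDiff ℝ C∞ (f t) :=
    fun hf t => hf.comp (contDiff_const.prodMk contDiff_id)
  have hcomp : ∀ {F : Type} [NormedAddCommGroup F] [NormedSpace ℝ F] {f : Vec (n+1) → Vec (n+1) → F},
      ContDiff ℝ C∞ (fun z : Vec (n+1) × Vec (n+1) => f z.1 z.2) →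
      ContDiff ℝ C∞ (fun z : Vec (n+2) × Vec (n+2) => f (pA n z.1) (a z.2)) :=
    fun hf => hf.comp (((pA n).contDiff.comp contDiff_fst).prodMk (ha.comp contDiff_snd))
  obtain ⟨X, hXdef⟩ : ∃ X : Vec (n+2) → Vec (n+2),
      X = fun p => jA n (D.X (pA n p) + wE (w (pl n p))) + jl n (pl n p) := ⟨_, rfl⟩
  have hpX : ∀ p, pA n (X p) = D.X (pA n p) + w (pl n p) • ez n := by
    intro p; rw [hXdef]; simp only [map_add, pA_jA, pA_jl, hwE_apply, add_zero]
  have hlX : ∀ p, pl n (X p) = pl n p := by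
    intro p; rw [hXdef]; simp only [map_add, pl_jA, pl_jl, zero_add]
  have haX : ∀ p, a (X p) = D.X (pA n p) := by
    intro p; rw [ha_apply, hpX, hlX]; abel
  have hXs : ContDiff ℝ C∞ X := by
    rw [hXdef]
    exact ((jA n).contDiff.comp ((D.X_smooth.comp (pA n).contDiff).add hwEl')).add ((jl n).contDiff.comp (pl n).contDiff)
  have hXd : ∀ p v, fderiv ℝ X p v = 0 → pl n v = 0 ∧ fderiv ℝ D.X (pA n p) (pA n v) = 0 := by
    intro p v hv
    have hdX := (smooth_diff hXs p).hasFDerivAt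
    have e1 : pl n v = 0 := by
      have h1 : HasFDerivAt (fun p => pl n (X p)) ((pl n).comp (fderiv ℝ X p)) p := (pl n).hasFDerivAt.comp p hdX
      have h2 : HasFDerivAt (fun p => pl n (X p)) (pl n) p := by
        have : (fun p => pl n (X p)) = pl n := funext hlX
        rw [this]; exact (pl n).hasFDerivAt
      have := congrArg (fun A => A v) (h1.unique h2)
      simp only [ContinuousLinearMap.comp_apply, hv, map_zero] at this
      exact this.symm
    refine ⟨e1, ?_⟩
    have h1 : HasFDerivAt (fun p => a (X p)) ((fderiv ℝ a (X p)).comp (fderiv ℝ X p)) p :=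
      (smooth_diff ha (X p)).hasFDerivAt.comp p hdX
    have h2 : HasFDerivAt (fun p => a (X p)) ((fderiv ℝ D.X (pA n p)).comp (pA n)) p := by
      have : (fun p => a (X p)) = fun p => D.X (pA n p) := funext haX
      rw [this]; exact (smooth_diff D.X_smooth _).hasFDerivAt.comp p (pA n).hasFDerivAt
    have := congrArg (fun A => A v) (h1.unique h2)
    simp only [ContinuousLinearMap.comp_apply, hv, map_zero] at this
    exact this.symm
  -- the auxiliary height
  obtain ⟨hh, hhdef⟩ : ∃ hh : Vec (n+2) → Vec (n+2) → ℝ,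
      hh = fun p x => pz (n+1) x + (-(pz n)) (D.G (pA n p) (a x)) := ⟨_, rfl⟩
  have hh_smooth : ContDiff ℝ C∞ (fun z : Vec (n+2) × Vec (n+2) => hh z.1 z.2) := by
    rw [hhdef]
    exact ((pz (n+1)).contDiff.comp contDiff_snd).add ((-(pz n)).contDiff.comp (hcomp D.G_smooth))
  have hGa_jet : ∀ p x b, 1 ≤ b → b ≤ r → ‖iteratedFDeriv ℝ b (fun x => D.G (pA n p) (a x)) x‖ ≤ min (ν/2) 1 := by
    intro p x b hb hbr
    exact (comp_smallV (hsm D.G_smooth _) ha x r hν'.le (by linarith) (fun i h1 h2 => D.G_jet _ _ i h1 h2)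
      (fun i h1 h2 => ha_jet x i h1 h2) b hb hbr).trans v3
  have hLa_jet : ∀ p x b, 1 ≤ b → b ≤ r → ‖iteratedFDeriv ℝ b (fun x => D.Lam (pA n p) (a x)) x‖ ≤ min (ν/2) 1 := by
    intro p x b hb hbr
    exact (comp_smallV (hsm D.Lam_smooth _) ha x r hν'.le (by linarith) (fun i h1 h2 => D.Lam_jet _ _ i h1 h2)
      (fun i h1 h2 => ha_jet x i h1 h2) b hb hbr).trans v3
  have hGa : ∀ p, ContDiff ℝ C∞ (fun x => D.G (pA n p) (a x)) := fun p => (hsm D.G_smooth _).comp ha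
  have hhs : ∀ p, ContDiff ℝ C∞ (hh p) := fun p => hh_smooth.comp (contDiff_const.prodMk contDiff_id)
  have hh_jet : ∀ p x b, 1 ≤ b → b ≤ r → ‖iteratedFDeriv ℝ b (hh p) x‖ ≤ 2 := by
    intro p x b hb hbr
    rw [hhdef]
    refine (jet_add_le (pz (n+1)).contDiff ((-(pz n)).contDiff.comp (hGa p)) b x).trans ?_
    have h1 := jet_lin_le _ (pz_norm (n+1)) b hb x
    have h2 := (jet_left_le (-(pz n)) (by rw [norm_neg]; exact pz_norm n) (hGa p) b x).trans (hGa_jet p x b hb hbr)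
    have h3 := min_le_right (ν/2) 1
    exact (add_le_add h1 (h2.trans h3)).trans (by norm_num)
  have hphs : ∀ t, ContDiff ℝ C∞ (ph N δ t) := fun t => comp2 (ph_smooth N δ) contDiff_const contDiff_id
  have hphh : ∀ p, ContDiff ℝ C∞ (fun x => ph N δ (pl n p) (hh p x)) := fun p => comp1 (hphs _) (hhs p)
  refine ⟨{ X := X
            Y := fun x => D.Y (a x)
            G := fun p x => jA n (D.G (pA n p) (a x)) + jl n (ph N δ (pl n p) (hh p x))
            Lam := fun p x => D.Lam (pA n p) (a x)
            T := fun p x => D.T (pA n p) (a x)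
            rho := fun p x => D.rho (pA n p) (a x)
            X_smooth := hXs
            Y_smooth := D.Y_smooth.comp ha
            G_smooth := ((jA n).contDiff.comp (hcomp D.G_smooth)).add ((jl n).contDiff.comp
              (comp2 (ph_smooth N δ) ((pl n).contDiff.comp contDiff_fst) hh_smooth))
            Lam_smooth := hcomp D.Lam_smooth
            T_smooth := hcomp D.T_smooth
            rho_smooth := fun p => (D.rho_smooth _).comp ha
            X_shift := ?_, G_shift := ?_, Lam_shift := ?_, T_shift := ?_, X_near := ?_
            dense := ?_, H := ?_, G_near := ?_
            G_jet := ?_, Lam_near := fun p x => (D.Lam_near _ _).trans (by linarith), Lam_jet := ?_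
            imm := ?_, Yd := ?_, sep := ?_ }⟩
  · intro m p
    apply vec_ext
    · rw [hpX, map_add, map_add, map_add, hpX, pA_zcast, pl_zcast, hwsh, D.X_shift]; abel
    · rw [hlX, map_add, map_add, hlX]
  · intro m p x
    have e : hh (p + zcast m) (x + zcast m) = hh p x := by
      rw [hhdef]; simp only
      rw [ha_shift, map_add, map_add, pA_zcast, D.G_shift, map_add, ← pA_zcast, ContinuousLinearMap.neg_apply _ (pA n (zcast m)), pz_pA]; ring
    rw [e, ha_shift]
    apply vec_ext
    · simp only [map_add, pA_jA, pA_jl, pA_zcast, D.G_shift, add_zero]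
    · simp only [map_add, pl_jA, pl_jl, pl_zcast, ph_shift hN, zero_add]
  · intro m p x
    rw [ha_shift, map_add, pA_zcast, D.Lam_shift]
  · intro m p x
    rw [ha_shift, map_add, pA_zcast, D.T_shift]
  · intro p
    refine vec_norm_le hν.le ?_ ?_
    · rw [map_sub, hpX, show D.X (pA n p) + w (pl n p) • ez n - pA n p = (D.X (pA n p) - pA n p) + w (pl n p) • ez n by abel]
      have h1 := D.X_near (pA n p)
      have h2 : ‖w (pl n p) • ez n‖ ≤ δ := by
        rw [norm_smul]
        exact (mul_le_of_le_one_right (norm_nonneg _) (ez_norm n)).trans (hwb _)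
      exact (norm_add_le _ _).trans (by linarith)
    · rw [map_sub, hlX]; simpa using hν.le
  · refine (D.dense.preimage (pA_open n)).mono ?_
    intro p hp
    have hp' : Function.Injective (fderiv ℝ D.X (pA n p)) := hp
    show Function.Injective (fderiv ℝ X p)
    rw [injective_iff_map_eq_zero] at hp' ⊢
    intro v hv
    obtain ⟨h1, h2⟩ := hXd p v hv
    exact vec_ext (by rw [hp' _ h2, map_zero]) (by rw [h1, map_zero])
  · intro p
    have hc : Tendsto a (𝓝 (X p)) (𝓝 (D.X (pA n p))) := by
      rw [← haX]; exact ha.continuous.tendsto _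
    have hcond : ∀ᶠ x in 𝓝 (X p), |hh p x / δ - cw (N * pl n p)| < 1/4 := by
      have hcont : Continuous (fun x => |hh p x / δ - cw (N * pl n p)|) := by
        have := (hhs p).continuous
        fun_prop
      refine (hcont.tendsto (X p)).eventually_lt_const ?_
      have e1 : hh p (X p) = pz n (D.X (pA n p) - D.G (pA n p) (D.X (pA n p))) + δ * cw (N * pl n p) := by
        rw [hhdef]; simp only
        rw [haX, ← pz_pA, hpX, map_add, map_sub, map_smul, pz_ez, hwdef]
        simp only [ContinuousLinearMap.neg_apply, smul_eq_mul]; ring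
      have e2 : |pz n (D.X (pA n p) - D.G (pA n p) (D.X (pA n p)))| ≤ δ / 8 := by
        refine ((pz n).le_of_opNorm_le (pz_norm n) _).trans ?_
        rw [one_mul]
        have h1 := D.X_near (pA n p)
        have h2 := D.G_near (pA n p) (D.X (pA n p))
        have h3 := norm_sub_le_norm_sub_add_norm_sub (D.X (pA n p)) (pA n p) (D.G (pA n p) (D.X (pA n p)))
        rw [norm_sub_rev (pA n p)] at h3
        linarith
      show |hh p (X p) / δ - cw (N * pl n p)| < 1/4
      rw [e1, add_div, mul_div_cancel_left₀ _ hδ.ne', add_sub_cancel_right, abs_div, abs_of_pos hδ, div_lt_iff₀ hδ]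
      linarith
    filter_upwards [hc.eventually (D.H (pA n p)), hcond] with x hx hx2
    obtain ⟨h1, h2, h3⟩ := hx
    have k1 : HasFDerivAt (fun s => D.G (pA n s) (a x)) (0 : Vec (n+2) →L[ℝ] Vec (n+1)) p := by
      have := h1.comp p (pA n).hasFDerivAt
      rwa [ContinuousLinearMap.zero_comp] at this
    refine ⟨?_, ?_, ?_⟩
    · have k2 : HasFDerivAt (fun s => hh s x) (0 : Vec (n+2) →L[ℝ] ℝ) p := by
        rw [hhdef]; simp only
        have := ((-(pz n)).hasFDerivAt.comp p k1).const_add (pz (n+1) x)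
        rwa [ContinuousLinearMap.comp_zero] at this
      have k3 : HasFDerivAt (fun s => (pl n s, hh s x)) ((pl n).prod (0 : Vec (n+2) →L[ℝ] ℝ)) p :=
        (pl n).hasFDerivAt.prodMk k2
      have k4 := ((smooth_diff (ph_smooth N δ)) (pl n p, hh p x)).hasFDerivAt
      have k5 : fderiv ℝ (fun z : ℝ × ℝ => ph N δ z.1 z.2) (pl n p, hh p x) (1, 0) = 0 := by
        have j1 : HasDerivAt (fun s : ℝ => (s, hh p x)) ((1:ℝ), (0:ℝ)) (pl n p) :=
          (hasDerivAt_id _).prodMk (hasDerivAt_const _ _)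
        have j2 := k4.comp_hasDerivAt (pl n p) j1
        exact j2.unique (ph_loc hδ hx2)
      have k6 : HasFDerivAt (fun s => ph N δ (pl n s) (hh s x)) (0 : Vec (n+2) →L[ℝ] ℝ) p := by
        have := k4.comp p k3
        refine this.congr_fderiv ?_
        ext1 v
        have e : (pl n v, (0:ℝ)) = (pl n v) • ((1:ℝ), (0:ℝ)) := by simp
        show fderiv ℝ (fun z : ℝ × ℝ => ph N δ z.1 z.2) (pl n p, hh p x) (pl n v, 0) = 0
        rw [e, map_smul, k5, smul_zero]
      have := ((jA n).hasFDerivAt.comp p k1).add ((jl n).hasFDerivAt.comp p k6)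
      rw [ContinuousLinearMap.comp_zero, ContinuousLinearMap.comp_zero, add_zero] at this
      exact this
    · have := h2.comp p (pA n).hasFDerivAt
      rwa [ContinuousLinearMap.zero_comp] at this
    · have := h3.comp p (pA n).hasFDerivAt
      refine this.congr_fderiv ?_
      ext1 v
      rw [haX]
      simp only [ContinuousLinearMap.comp_apply, ContinuousLinearMap.smul_apply, pz_pA]
  · intro p x
    refine vec_norm_le hν.le ?_ ?_
    · simp only [map_sub, map_add, pA_jA, pA_jl, add_zero]
      exact (D.G_near _ _).trans (by linarith)
    · simp only [map_sub, map_add, pl_jA, pl_jl, zero_add]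
      exact (ph_near hN δ _ _).trans n1
  · intro p x b hb hbr
    refine (jet_add_le ((jA n).contDiff.comp (hGa p)) ((jl n).contDiff.comp (hphh p)) b x).trans ?_
    have h1 := (jet_left_le (jA n) (jA_norm n) (hGa p) b x).trans (hGa_jet p x b hb hbr)
    have h2 := (jet_left_le (jl n) (jl_norm n) (hphh p) b x).trans
      (comp_small (hphs _) (hhs p) x r (C := 6 / N * ((2 / δ)^r * M)) (D := 2) (by positivity) (by norm_num)
        (fun i hi hir => ph_jet hN hδ hδ1 hM1 (fun j hj hjr y => hM j hj (by omega) y) _ _ i hi hir)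
        (fun i hi hir => hh_jet p x i hi hir) b hb hbr)
    have h3 := min_le_left (ν/2) 1
    exact (add_le_add (h1.trans h3) (h2.trans n3)).trans (by linarith)
  · intro p x b hb hbr
    exact (hLa_jet p x b hb hbr).trans ((min_le_left _ _).trans (by linarith))
  · intro p v hv hv0
    obtain ⟨h1, h2⟩ := hXd p v hv
    rw [haX, ← pz_pA]
    refine D.imm _ _ h2 fun h => hv0 (vec_ext (by rw [h, map_zero]) (by rw [h1, map_zero]))
  · intro x
    have ha1 : HasFDerivAt a (pA n + (-wE).comp ((deriv w (pl n x)) • pl n)) x := by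
      rw [hadef]
      have j1 : HasDerivAt w (deriv w (pl n x)) (pl n x) := (smooth_diff hw _).hasDerivAt
      exact (pA n).hasFDerivAt.add ((-wE).hasFDerivAt.comp x (j1.comp_hasFDerivAt x (pl n).hasFDerivAt))
    have h2 := (smooth_diff D.Y_smooth (a x)).hasFDerivAt.comp x ha1
    have h3 : fderiv ℝ (fun x => D.Y (a x)) x = _ := h2.fderiv
    rw [h3]
    simp only [ContinuousLinearMap.comp_apply, ContinuousLinearMap.add_apply, pA_ez, ContinuousLinearMap.smul_apply, pl_ez,
      smul_zero, map_zero, add_zero, D.Yd]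
  · obtain ⟨η0, h0, hs⟩ := D.sep
    refine ⟨η0, h0, fun η h1 h2 p q hpq hX => ?_⟩
    have hl : pl n p = pl n q := by rw [← hlX p, hX, hlX]
    have hX' : D.X (pA n p) = D.X (pA n q) := by rw [← haX, hX, haX]
    have := hs η h1 h2 (pA n p) (pA n q) (fun h => hpq (vec_ext h hl)) hX'
    rw [haX]
    refine lt_of_le_of_lt (mul_le_mul_of_nonneg_left ?_ hC) this
    refine vec_norm_le (norm_nonneg _) ?_ ?_
    · simp only [map_sub, map_add, pA_jA, pA_jl, add_zero]; exact le_rfl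
    · simp only [map_sub, map_add, pl_jA, pl_jl, zero_add]
      rw [hl]
      refine (ph_lip hN hδ (fun x => hM 1 le_rfl (by omega) x) n2 _ _ _).trans ?_
      have e : hh q (X p) - hh p (X p) = -(pz n (D.G (pA n q) (D.X (pA n p)) - D.G (pA n p) (D.X (pA n p)))) := by
        rw [hhdef]; simp only [haX, map_sub, ContinuousLinearMap.neg_apply]; ring
      rw [e, abs_neg]
      refine ((pz n).le_of_opNorm_le (pz_norm n) _).trans ?_
      rw [one_mul]

theorem exists_MD (r : ℕ) {C : ℝ} (hC : 0 ≤ C) (n : ℕ) : ∀ ν : ℝ, 0 < ν → Nonempty (MD n r C ν) := by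
  induction n with
  | zero =>
    intro ν hν
    obtain ⟨D⟩ := exists_OneD r hC hν
    exact MD_base D
  | succ n ih => exact fun ν hν => MD_step hC ih hν

end Step

section Final
open Filter Topology Set
open scoped Nat
local notation "C∞" => ((⊤ : ℕ∞) : WithTop ℕ∞)

theorem main_succ
    (n ℓ r k : ℕ) (hℓ : 1 ≤ ℓ)
    (ε : ℝ) (hε : 0 < ε)
    (σ : (i : ℕ) → Vec k × Vec (n+1) → SymMap (n+1) ℓ i)
    (hσcont : ∀ i ≤ r, Continuous (σ i))
    (hσperK : ∀ i ≤ r, ∀ (mk : Fin k → ℤ) (κ : Vec k) (p : Vec (n+1)),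
      σ i (κ + zcast mk, p) = σ i (κ, p))
    (hσperN : ∀ i ≤ r, ∀ (κ : Vec k) (m : Fin (n+1) → ℤ) (p : Vec (n+1)),
      σ i (κ, p + zcast m) = σ i (κ, p))
    (hσsym : ∀ i ≤ r, ∀ (κ : Vec k) (p : Vec (n+1)), IsSymmMap (σ i (κ, p))) :
    ∃ (X : Vec k × Vec (n+1) → Vec (n+1)) (ζ : (i : ℕ) → Vec k × Vec (n+1) → SymMap (n+1) ℓ i),
      -- jointly smooth, ℤ^k-periodic in the parameter
      ContDiff ℝ (⊤ : ℕ∞) X ∧ (∀ i ≤ r, ContDiff ℝ (⊤ : ℕ∞) (ζ i)) ∧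
      (∀ (mk : Fin k → ℤ) (κ : Vec k) (p : Vec (n+1)), X (κ + zcast mk, p) = X (κ, p)) ∧
      (∀ i ≤ r, ∀ (mk : Fin k → ℤ) (κ : Vec k) (p : Vec (n+1)),
        ζ i (κ + zcast mk, p) = ζ i (κ, p)) ∧
      -- (a) for each κ, a ℤⁿ-equivariant integral r-jet tuple (valued in `Sym^i`)
      (∀ i ≤ r, ∀ (κ : Vec k) (p : Vec (n+1)), IsSymmMap (ζ i (κ, p))) ∧
      (∀ (κ : Vec k) (m : Fin (n+1) → ℤ) (p : Vec (n+1)), X (κ, p + zcast m) = X (κ, p) + zcast m) ∧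
      (∀ i ≤ r, ∀ (κ : Vec k) (m : Fin (n+1) → ℤ) (p : Vec (n+1)), ζ i (κ, p + zcast m) = ζ i (κ, p)) ∧
      (∀ (κ : Vec k), ∀ i < r, ∀ (p v : Vec (n+1)) (w : Fin i → Vec (n+1)),
        (fderiv ℝ (fun q => ζ i (κ, q)) p v) w
          = ζ (i + 1) (κ, p) (Fin.cons (fderiv ℝ (fun q => X (κ, q)) p v) w)) ∧
      -- (b) dense graphicality locus
      (∀ κ : Vec k, Dense {p : Vec (n+1) | Function.Bijective ⇑(fderiv ℝ (fun q => X (κ, q)) p)}) ∧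
      -- (c) the full lift is an injective immersion modulo ℤⁿ
      (∀ (κ : Vec k) (p : Vec (n+1)),
        Function.Injective (fun v : Vec (n+1) =>
          (fderiv ℝ (fun q => X (κ, q)) p v,
            fun i : Fin (r + 1) => fderiv ℝ (fun q => ζ i.1 (κ, q)) p v))) ∧
      (∀ (κ : Vec k) (p q : Vec (n+1)) (m : Fin (n+1) → ℤ),
        X (κ, p) = X (κ, q) + zcast m → (∀ i ≤ r, ζ i (κ, p) = ζ i (κ, q)) →
        p = q + zcast m) ∧
      -- (d) if ℓ ≥ 2 or r is even, the front itself is injective modulo ℤⁿ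
      ((2 ≤ ℓ ∨ Even r) → ∀ (κ : Vec k) (p q : Vec (n+1)) (m : Fin (n+1) → ℤ),
        X (κ, p) = X (κ, q) + zcast m → ζ 0 (κ, p) = ζ 0 (κ, q) → p = q + zcast m) ∧
      -- (e) approximation
      (∀ (κ : Vec k) (p : Vec (n+1)), ‖X (κ, p) - p‖ < ε) ∧
      (∀ i ≤ r, ∀ (κ : Vec k) (p : Vec (n+1)), ‖ζ i (κ, p) - σ i (κ, p)‖ < ε) := by
  obtain ⟨Pf, C, ν, hC, hν, hν1, hPs, hPk, hPn, hPL, hPj⟩ := propP (n+1) ℓ r k (ε/2) (by positivity) σ hσcont hσperK hσperN hσsym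
  obtain ⟨ν', hν', v1, v2, v3⟩ : ∃ ν' : ℝ, 0 < ν' ∧ ν' ≤ ν ∧ ν' ≤ 1/2 ∧ ν' ≤ ε/8 :=
    ⟨min ν (min (1/2) (ε/8)), by positivity, min_le_left _ _, (min_le_right _ _).trans (min_le_left _ _),
      (min_le_right _ _).trans (min_le_right _ _)⟩
  obtain ⟨D⟩ := exists_MD r hC n ν' hν'
  have hsm : ∀ {F : Type} [NormedAddCommGroup F] [NormedSpace ℝ F] {f : Vec (n+1) → Vec (n+1) → F},
      ContDiff ℝ C∞ (fun z : Vec (n+1) × Vec (n+1) => f z.1 z.2) → ∀ t, ContDiff ℝ C∞ (f t) :=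
    fun hf t => hf.comp (contDiff_const.prodMk contDiff_id)
  -- shift invariance of jets
  have jshift : ∀ {F : Type} [NormedAddCommGroup F] [NormedSpace ℝ F] (f : Vec (n+1) → Vec (n+1) → F)
      (_ : ∀ (m : Fin (n+1) → ℤ) p x, f (p + zcast m) (x + zcast m) = f p x) (i : ℕ) (m : Fin (n+1) → ℤ) (p : Vec (n+1)),
      iteratedFDeriv ℝ i (f (p + zcast m)) (D.X (p + zcast m)) = iteratedFDeriv ℝ i (f p) (D.X p) := by
    intro F _ _ f hf i m p
    rw [D.X_shift, ← iteratedFDeriv_comp_add_right]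
    congr 1
    funext x; exact hf m p x
  -- bound for T
  have hTb : ∀ i, ∃ M, 0 ≤ M ∧ ∀ p, ‖iteratedFDeriv ℝ i (D.T p) (D.X p)‖ ≤ M := by
    intro i
    refine periodic_bounded' _ ?_ (jshift D.T D.T_shift i)
    have h1 := smooth_parjet i (f := D.T) D.T_smooth
    exact h1.continuous.comp (continuous_id.prodMk D.X_smooth.continuous)
  choose M hM0 hM using hTb
  obtain ⟨K, hK, hKM⟩ : ∃ K : ℝ, 0 < K ∧ ∀ i ≤ r, M i ≤ K := by
    have h0 : 0 ≤ ∑ i ∈ Finset.range (r+1), M i := Finset.sum_nonneg fun i _ => hM0 i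
    refine ⟨∑ i ∈ Finset.range (r+1), M i + 1, by linarith, fun i hi => ?_⟩
    have := Finset.single_le_sum (f := M) (s := Finset.range (r+1)) (fun i _ => hM0 i) (Finset.mem_range.2 (by omega : i < r+1))
    linarith
  obtain ⟨η0, hη0, hsep⟩ := D.sep
  obtain ⟨η, hη, hηη, hηK⟩ : ∃ η : ℝ, 0 < η ∧ η < η0 ∧ η * K ≤ ε/8 := by
    refine ⟨min (η0/2) (ε/8/K), by positivity, (min_le_left _ _).trans_lt (by linarith), ?_⟩
    have := min_le_right (η0/2) (ε/8/K)
    rwa [le_div_iff₀ hK] at this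
  replace hsep := hsep η hη hηη
  -- the direction
  obtain ⟨E, pr, hE, hpr, hprE⟩ : ∃ (E : ℝ →L[ℝ] Vec ℓ) (pr : Vec ℓ →L[ℝ] ℝ), ‖E‖ ≤ 1 ∧ ‖pr‖ ≤ 1 ∧ ∀ s, pr (E s) = s := by
    refine ⟨ContinuousLinearMap.toSpanSingleton ℝ (Pi.single ⟨0, hℓ⟩ 1), ContinuousLinearMap.proj ⟨0, hℓ⟩, ?_, ?_, ?_⟩
    · rw [ContinuousLinearMap.norm_toSpanSingleton, Pi.norm_single]; simp
    · refine ContinuousLinearMap.opNorm_le_bound _ zero_le_one fun v => ?_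
      rw [one_mul]; exact norm_le_pi_norm v _
    · intro s; simp
  obtain ⟨S, hSdef⟩ : ∃ S : Vec (n+1) → Vec (n+1) → ℝ, S = fun p x => D.Lam p x + (η • ContinuousLinearMap.id ℝ ℝ) (D.T p x) := ⟨_, rfl⟩
  have hS_apply : ∀ p x, S p x = D.Lam p x + η * D.T p x := by intro p x; rw [hSdef]; rfl
  have hSs : ContDiff ℝ C∞ (fun z : Vec (n+1) × Vec (n+1) => S z.1 z.2) := by
    rw [hSdef]; exact D.Lam_smooth.add ((η • ContinuousLinearMap.id ℝ ℝ).contDiff.comp D.T_smooth)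
  obtain ⟨Φ, hΦdef⟩ : ∃ Φ : Vec k × Vec (n+1) → Vec (n+1) → Vec ℓ,
      Φ = fun z x => Pf z.1 (D.G z.2 x, x) + E (S z.2 x) := ⟨_, rfl⟩
  have hΦs : ContDiff ℝ C∞ (Function.uncurry Φ) := by
    rw [hΦdef]
    have h1 : ContDiff ℝ C∞ (fun z : (Vec k × Vec (n+1)) × Vec (n+1) => (z.1.2, z.2)) := by fun_prop
    have h2 : ContDiff ℝ C∞ (fun z : (Vec k × Vec (n+1)) × Vec (n+1) => D.G z.1.2 z.2) := D.G_smooth.comp h1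
    have h3 : ContDiff ℝ C∞ (fun z : (Vec k × Vec (n+1)) × Vec (n+1) => S z.1.2 z.2) := hSs.comp h1
    have h4 : ContDiff ℝ C∞ (fun z : (Vec k × Vec (n+1)) × Vec (n+1) => (z.1.1, (D.G z.1.2 z.2, z.2))) := by fun_prop
    exact (hPs.comp h4).add (E.contDiff.comp h3)
  have hΦκ : ∀ κ, ContDiff ℝ C∞ (Function.uncurry fun q => Φ (κ, q)) := by
    intro κ
    have h1 : ContDiff ℝ C∞ (fun z : Vec (n+1) × Vec (n+1) => ((κ, z.1), z.2)) := by fun_prop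
    exact hΦs.comp h1
  have hΦz : ∀ z, ContDiff ℝ C∞ (Φ z) := by
    intro z
    have h1 : ContDiff ℝ C∞ (fun x : Vec (n+1) => (z, x)) := by fun_prop
    exact hΦs.comp h1
  have hΦk : ∀ (mk : Fin k → ℤ) κ p, Φ (κ + zcast mk, p) = Φ (κ, p) := by
    intro mk κ p; rw [hΦdef]; funext x; simp only; rw [hPk]
  have hSsh : ∀ (m : Fin (n+1) → ℤ) p x, S (p + zcast m) (x + zcast m) = S p x := by
    intro m p x; rw [hS_apply, hS_apply, D.Lam_shift, D.T_shift]
  have hΦn : ∀ κ (m : Fin (n+1) → ℤ) p x, Φ (κ, p + zcast m) (x + zcast m) = Φ (κ, p) x := by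
    intro κ m p x; rw [hΦdef]; simp only; rw [D.G_shift, hPn, hSsh]
  -- variation of the family in the source variable
  have hvar : ∀ κ p v, (fun x => fderiv ℝ (fun q => Φ (κ, q) x) p v) =ᶠ[𝓝 (D.X p)]
      fun x => (D.Y (D.X p) - D.Y x) ^ r • E (η * D.rho p x * pz n v) := by
    intro κ p v
    filter_upwards [D.H p] with x hx
    obtain ⟨h1, h2, h3⟩ := hx
    have a1 : HasFDerivAt (fun q => (D.G q x, x)) ((0 : Vec (n+1) →L[ℝ] Vec (n+1)).prod (0 : Vec (n+1) →L[ℝ] Vec (n+1))) p :=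
      h1.prodMk (hasFDerivAt_const _ _)
    have a2 : ContDiff ℝ C∞ (Pf κ) := hPs.comp (contDiff_const.prodMk contDiff_id)
    have a3 := (smooth_diff a2 (D.G p x, x)).hasFDerivAt.comp p a1
    have a4 : HasFDerivAt (fun q => S q x) (0 + (η • ContinuousLinearMap.id ℝ ℝ).comp
        ((D.rho p x * (D.Y (D.X p) - D.Y x) ^ r) • pz n)) p := by
      rw [hSdef]
      exact h2.add ((η • ContinuousLinearMap.id ℝ ℝ).hasFDerivAt.comp p h3)
    have a6 : HasFDerivAt (fun q => E (S q x)) (E.comp (0 + (η • ContinuousLinearMap.id ℝ ℝ).comp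
        ((D.rho p x * (D.Y (D.X p) - D.Y x) ^ r) • pz n))) p := E.hasFDerivAt.comp p a4
    have a5 := a3.add a6
    have a7 : (fun q => Φ (κ, q) x) = ((Pf κ) ∘ fun q => (D.G q x, x)) + fun q => E (S q x) := by
      rw [hΦdef]; rfl
    rw [a7, a5.fderiv]
    have e : ((0 : Vec (n+1) →L[ℝ] Vec (n+1)).prod (0 : Vec (n+1) →L[ℝ] Vec (n+1))) v = 0 := rfl
    simp only [add_apply, ContinuousLinearMap.comp_apply, e, map_zero, zero_add, smul_apply,
      ContinuousLinearMap.id_apply, zero_apply, smul_eq_mul]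
    rw [← E.map_smul]
    congr 1
    rw [smul_eq_mul]; ring
  have hvarj : ∀ κ p v i, iteratedFDeriv ℝ i (fun x => fderiv ℝ (fun q => Φ (κ, q) x) p v) (D.X p) =
      iteratedFDeriv ℝ i (fun x => (D.Y (D.X p) - D.Y x) ^ r • E (η * D.rho p x * pz n v)) (D.X p) :=
    fun κ p v i => (Filter.EventuallyEq.iteratedFDeriv ℝ (hvar κ p v) i).eq_of_nhds
  have hu : ∀ p, ContDiff ℝ C∞ (fun x => D.Y (D.X p) - D.Y x) := fun p => contDiff_const.sub D.Y_smooth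
  have hg : ∀ p v, ContDiff ℝ C∞ (fun x => E (η * D.rho p x * pz n v)) := by
    intro p v
    have := D.rho_smooth p
    exact E.contDiff.comp ((contDiff_const.mul this).mul contDiff_const)
  have hjet := fun p v => jet_pow_smul r (hu p) (hg p v) (D.X p) (sub_self _)
  have hder := fun κ i p v w => fderiv_jet_along i (hΦκ κ) D.X_smooth p v w
  -- injectivity of the front
  have hfront : ∀ κ p q, D.X p = D.X q → iteratedFDeriv ℝ 0 (Φ (κ, p)) (D.X p) = iteratedFDeriv ℝ 0 (Φ (κ, q)) (D.X q) → p = q := by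
    intro κ p q hX h0
    by_contra hne
    have h1 := hsep p q hne hX
    have h2 := congrArg (fun A => A (fun _ => 0)) h0
    simp only [iteratedFDeriv_zero_apply] at h2
    rw [← hX, hΦdef] at h2
    have h3 := congrArg pr h2
    simp only [map_add, hprE, hS_apply] at h3
    have nr : ∀ s, D.X s = D.X p → ‖D.G s (D.X p) - D.X p‖ ≤ 1 := by
      intro s hs
      have b1 := D.G_near s (D.X p)
      have b2 := D.X_near s
      rw [hs, norm_sub_rev] at b2
      have := norm_sub_le_norm_sub_add_norm_sub (D.G s (D.X p)) s (D.X p)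
      linarith
    have h4 := hPL κ (D.X p) (D.G q (D.X p)) (D.G p (D.X p)) (nr q hX.symm) (nr p rfl)
    have h5 : |pr (Pf κ (D.G q (D.X p), D.X p) - Pf κ (D.G p (D.X p), D.X p))| ≤ 1 * _ := pr.le_of_opNorm_le hpr _
    rw [one_mul, map_sub] at h5
    have h6 : D.Lam q (D.X p) - D.Lam p (D.X p) + η * (D.T q (D.X p) - D.T p (D.X p)) =
        -(pr (Pf κ (D.G q (D.X p), D.X p)) - pr (Pf κ (D.G p (D.X p), D.X p))) := by linarith
    rw [h6, abs_neg] at h1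
    linarith
  have hζn : ∀ κ i (m : Fin (n+1) → ℤ) p, iteratedFDeriv ℝ i (Φ (κ, p + zcast m)) (D.X (p + zcast m)) =
      iteratedFDeriv ℝ i (Φ (κ, p)) (D.X p) := fun κ i m p => jshift (fun p => Φ (κ, p)) (hΦn κ) i m p
  have hinj : ∀ κ p q (m : Fin (n+1) → ℤ), D.X p = D.X q + zcast m →
      iteratedFDeriv ℝ 0 (Φ (κ, p)) (D.X p) = iteratedFDeriv ℝ 0 (Φ (κ, q)) (D.X q) → p = q + zcast m := by
    intro κ p q m hX h0
    refine hfront κ p (q + zcast m) (by rw [hX, D.X_shift]) ?_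
    rw [hζn, h0]
  refine ⟨fun z => D.X z.2, fun i z => iteratedFDeriv ℝ i (Φ z) (D.X z.2), D.X_smooth.comp contDiff_snd, ?_, ?_, ?_, ?_, ?_, ?_,
    ?_, ?_, ?_, ?_, ?_, ?_, ?_⟩
  · intro i hi
    exact (smooth_parjet i hΦs).comp (contDiff_id.prodMk (D.X_smooth.comp contDiff_snd))
  · intro mk κ p; rfl
  · intro i hi mk κ p
    show iteratedFDeriv ℝ i (Φ (κ + zcast mk, p)) _ = _
    rw [hΦk]
  · intro i hi κ p e v
    exact jet_symm i (hΦz _) e _ v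
  · intro κ m p; exact D.X_shift m p
  · intro i hi κ m p; exact hζn κ i m p
  · intro κ i hi p v w
    refine (hder κ i p v w).trans ?_
    rw [hvarj, (hjet p v).1 i hi]
    simp
  · intro κ
    refine D.dense.mono ?_
    intro p hp
    exact ⟨hp, (LinearMap.injective_iff_surjective (f := (fderiv ℝ D.X p).toLinearMap)).1 hp⟩
  · intro κ p v v' hvv
    have e1 : fderiv ℝ D.X p v = fderiv ℝ D.X p v' := congrArg Prod.fst hvv
    have e2 := congrFun (congrArg Prod.snd hvv) ⟨r, by omega⟩
    have e3 : fderiv ℝ (fun q => iteratedFDeriv ℝ r (Φ (κ, q)) (D.X q)) p v =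
      fderiv ℝ (fun q => iteratedFDeriv ℝ r (Φ (κ, q)) (D.X q)) p v' := e2
    by_contra hne
    have hX : fderiv ℝ D.X p (v - v') = 0 := by rw [map_sub, e1, sub_self]
    obtain ⟨i1, i2⟩ := D.imm p (v - v') hX (sub_ne_zero.2 hne)
    have h1 := hder κ r p (v - v') (fun _ => ez n)
    rw [map_sub (fderiv ℝ (fun q => iteratedFDeriv ℝ r (Φ (κ, q)) (D.X q)) p), e3, sub_self,
      hvarj, (hjet p (v - v')).2, hX,
      (iteratedFDeriv ℝ (r+1) (Φ (κ, p)) (D.X p)).map_coord_zero (0 : Fin (r+1)) (by simp), add_zero] at h1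
    have hd : fderiv ℝ (fun x => D.Y (D.X p) - D.Y x) (D.X p) (ez n) = -1 := by
      have := ((smooth_diff D.Y_smooth (D.X p)).hasFDerivAt.const_sub (D.Y (D.X p))).fderiv
      rw [this, neg_apply, D.Yd]
    have h2 := congrArg pr h1
    rw [map_smul, hprE] at h2
    simp only [hd, Finset.prod_const, ContinuousMultilinearMap.zero_apply, map_zero, smul_eq_mul] at h2
    have h3 : (r ! * (-1) ^ (Finset.univ : Finset (Fin r)).card) * (η * D.rho p (D.X p) * pz n (v - v')) ≠ (0:ℝ) := by
      refine mul_ne_zero (mul_ne_zero (by positivity) (pow_ne_zero _ (by norm_num))) (mul_ne_zero (mul_ne_zero hη.ne' i2) i1)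
    exact h3 h2.symm
  · intro κ p q m hX h
    exact hinj κ p q m hX (h 0 (by omega))
  · intro _ κ p q m hX h
    exact hinj κ p q m hX h
  · intro κ p
    exact lt_of_le_of_lt (D.X_near p) (by linarith)
  · intro i hi κ p
    have hG := hsm D.G_smooth p
    have hP : ContDiff ℝ C∞ (fun x => Pf κ (D.G p x, x)) := hPs.comp (contDiff_const.prodMk (hG.prodMk contDiff_id))
    have hSp := hsm hSs p
    have hES : ContDiff ℝ C∞ (fun x => E (S p x)) := E.contDiff.comp hSp
    have h1 := hPj i hi κ (D.G p) (D.X p) p hG ((D.G_near _ _).trans v1) ((D.X_near _).trans v1)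
      (fun b hb hbr => (D.G_jet _ _ b hb hbr).trans v1)
    have hL := hsm D.Lam_smooth p
    have hT := hsm D.T_smooth p
    have h2 : ‖iteratedFDeriv ℝ i (D.Lam p) (D.X p)‖ ≤ ε/8 := by
      rcases Nat.eq_zero_or_pos i with rfl | hpos
      · rw [norm_iteratedFDeriv_zero]; exact (D.Lam_near _ _).trans v3
      · exact (D.Lam_jet _ _ i hpos hi).trans v3
    have h3 : ‖iteratedFDeriv ℝ i (fun x => (η • ContinuousLinearMap.id ℝ ℝ) (D.T p x)) (D.X p)‖ ≤ ε/8 := by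
      have := (η • ContinuousLinearMap.id ℝ ℝ).norm_iteratedFDeriv_comp_left (f := D.T p) (x := D.X p) hT.contDiffAt (nat_le_smooth i)
      have hn : ‖η • ContinuousLinearMap.id ℝ ℝ‖ ≤ η := by
        rw [norm_smul, Real.norm_of_nonneg hη.le]
        exact mul_le_of_le_one_right hη.le ContinuousLinearMap.norm_id_le
      refine this.trans (le_trans ?_ hηK)
      exact mul_le_mul hn ((hM i p).trans (hKM i hi)) (norm_nonneg _) hη.le
    have h4 : ‖iteratedFDeriv ℝ i (fun x => E (S p x)) (D.X p)‖ ≤ ε/8 + ε/8 := by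
      refine (jet_left_le E hE hSp i _).trans ?_
      rw [hSdef]
      exact (jet_add_le hL ((η • ContinuousLinearMap.id ℝ ℝ).contDiff.comp hT) i _).trans (add_le_add h2 h3)
    have h5 : iteratedFDeriv ℝ i (Φ (κ, p)) (D.X p) = iteratedFDeriv ℝ i (fun x => Pf κ (D.G p x, x)) (D.X p) +
        iteratedFDeriv ℝ i (fun x => E (S p x)) (D.X p) := by
      rw [hΦdef]
      exact iteratedFDeriv_add_apply ((hP.of_le (nat_le_smooth i)).contDiffAt) ((hES.of_le (nat_le_smooth i)).contDiffAt)
    show ‖iteratedFDeriv ℝ i (Φ (κ, p)) (D.X p) - σ i (κ, p)‖ < ε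
    rw [h5, add_sub_right_comm]
    refine (norm_add_le _ _).trans_lt ?_
    linarith

end Final

/-- Parametric holonomic approximation with embedded integral lifts
(del Pino–Toussaint, Theorem B.4), over the `n`-torus with `k`-torus parameter space. -/
theorem parametric_holonomic_approximation_embedded_lifts
    (n ℓ r k : ℕ) (hn : 1 ≤ n) (hℓ : 1 ≤ ℓ) (hr : 1 ≤ r) (hk : 1 ≤ k)
    (hcontact : ¬(r = 1 ∧ ℓ = 1))
    (ε : ℝ) (hε : 0 < ε)
    (σ : (i : ℕ) → Vec k × Vec n → SymMap n ℓ i)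
    (hσcont : ∀ i ≤ r, Continuous (σ i))
    (hσperK : ∀ i ≤ r, ∀ (mk : Fin k → ℤ) (κ : Vec k) (p : Vec n),
      σ i (κ + zcast mk, p) = σ i (κ, p))
    (hσperN : ∀ i ≤ r, ∀ (κ : Vec k) (m : Fin n → ℤ) (p : Vec n),
      σ i (κ, p + zcast m) = σ i (κ, p))
    (hσsym : ∀ i ≤ r, ∀ (κ : Vec k) (p : Vec n), IsSymmMap (σ i (κ, p))) :
    ∃ (X : Vec k × Vec n → Vec n) (ζ : (i : ℕ) → Vec k × Vec n → SymMap n ℓ i),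
      -- jointly smooth, ℤ^k-periodic in the parameter
      ContDiff ℝ (⊤ : ℕ∞) X ∧ (∀ i ≤ r, ContDiff ℝ (⊤ : ℕ∞) (ζ i)) ∧
      (∀ (mk : Fin k → ℤ) (κ : Vec k) (p : Vec n), X (κ + zcast mk, p) = X (κ, p)) ∧
      (∀ i ≤ r, ∀ (mk : Fin k → ℤ) (κ : Vec k) (p : Vec n),
        ζ i (κ + zcast mk, p) = ζ i (κ, p)) ∧
      -- (a) for each κ, a ℤⁿ-equivariant integral r-jet tuple (valued in `Sym^i`)
      (∀ i ≤ r, ∀ (κ : Vec k) (p : Vec n), IsSymmMap (ζ i (κ, p))) ∧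
      (∀ (κ : Vec k) (m : Fin n → ℤ) (p : Vec n), X (κ, p + zcast m) = X (κ, p) + zcast m) ∧
      (∀ i ≤ r, ∀ (κ : Vec k) (m : Fin n → ℤ) (p : Vec n), ζ i (κ, p + zcast m) = ζ i (κ, p)) ∧
      (∀ (κ : Vec k), ∀ i < r, ∀ (p v : Vec n) (w : Fin i → Vec n),
        (fderiv ℝ (fun q => ζ i (κ, q)) p v) w
          = ζ (i + 1) (κ, p) (Fin.cons (fderiv ℝ (fun q => X (κ, q)) p v) w)) ∧
      -- (b) dense graphicality locus
      (∀ κ : Vec k, Dense {p : Vec n | Function.Bijective ⇑(fderiv ℝ (fun q => X (κ, q)) p)}) ∧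
      -- (c) the full lift is an injective immersion modulo ℤⁿ
      (∀ (κ : Vec k) (p : Vec n),
        Function.Injective (fun v : Vec n =>
          (fderiv ℝ (fun q => X (κ, q)) p v,
            fun i : Fin (r + 1) => fderiv ℝ (fun q => ζ i.1 (κ, q)) p v))) ∧
      (∀ (κ : Vec k) (p q : Vec n) (m : Fin n → ℤ),
        X (κ, p) = X (κ, q) + zcast m → (∀ i ≤ r, ζ i (κ, p) = ζ i (κ, q)) →
        p = q + zcast m) ∧
      -- (d) if ℓ ≥ 2 or r is even, the front itself is injective modulo ℤⁿ
      ((2 ≤ ℓ ∨ Even r) → ∀ (κ : Vec k) (p q : Vec n) (m : Fin n → ℤ),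
        X (κ, p) = X (κ, q) + zcast m → ζ 0 (κ, p) = ζ 0 (κ, q) → p = q + zcast m) ∧
      -- (e) approximation
      (∀ (κ : Vec k) (p : Vec n), ‖X (κ, p) - p‖ < ε) ∧
      (∀ i ≤ r, ∀ (κ : Vec k) (p : Vec n), ‖ζ i (κ, p) - σ i (κ, p)‖ < ε) := by
  obtain ⟨n, rfl⟩ : ∃ n', n = n' + 1 := ⟨n - 1, by omega⟩
  exact main_succ n ℓ r k hℓ ε hε σ hσcont hσperK hσperN hσsym
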